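/- Let x ∈ 𝕋^d and Λ ∈ ℝ^d, and let w̃ ∈ C^{2,α}_#(𝒴^d) solve the divergence-form equation −div_y( e^{|Λ+∇_y w̃|²/2 + V(x,y)} (Λ + ∇_y w̃) ) = 0 in 𝒴^d. Then there exists β ∈ (0,1) and a constant C_Λ > 0, depending on Λ but not on x and bounded uniformly for Λ in compact subsets of ℝ^d, such that ‖w̃‖_{C^{2,β}_#(𝒴^d)} ≤ C_Λ. -/

import Mathlib

open MeasureTheory Filter Topology Function

noncomputable section

/-- The unit cell `𝒴^d = [0,1)^d`. -/
def cube (d : ℕ) : Set (Fin d → ℝ) := Set.univ.pi fun _ => Set.Ico (0 : ℝ) 1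

/-- `ℤ^d`-periodicity of a function on `ℝ^d`; functions on the torus `𝕋^d`
(and `𝒴^d`-periodic functions) are identified with such functions. -/
def ZPer {d : ℕ} (f : (Fin d → ℝ) → ℝ) : Prop :=
  ∀ (x : Fin d → ℝ) (k : Fin d → ℤ), f (fun i => x i + (k i : ℝ)) = f x

/-- The `i`-th partial derivative. -/
def pder {d : ℕ} (i : Fin d) (f : (Fin d → ℝ) → ℝ) (x : Fin d → ℝ) : ℝ :=
  fderiv ℝ f x (Pi.single i 1)

/-- `V : 𝕋^d × ℝ^d → ℝ` smooth, `𝒴^d`-periodic in the second variable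
(and periodic in the first, i.e. defined on the torus). -/
def SmoothV {d : ℕ} (V : (Fin d → ℝ) → (Fin d → ℝ) → ℝ) : Prop :=
  ContDiff ℝ (⊤ : ℕ∞) (uncurry V) ∧ (∀ y, ZPer fun x => V x y) ∧ (∀ x, ZPer (V x))

/-- `sup_{(x,y) ∈ 𝕋^d × 𝒴^d} V (x,y)` (by periodicity, the sup over all of `ℝ^d × ℝ^d`). -/
def supV {d : ℕ} (V : (Fin d → ℝ) → (Fin d → ℝ) → ℝ) : ℝ :=
  ⨆ q : (Fin d → ℝ) × (Fin d → ℝ), V q.1 q.2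

/-- `inf_{(x,y) ∈ 𝕋^d × 𝒴^d} V (x,y)`. -/
def infV {d : ℕ} (V : (Fin d → ℝ) → (Fin d → ℝ) → ℝ) : ℝ :=
  ⨅ q : (Fin d → ℝ) × (Fin d → ℝ), V q.1 q.2

/-- `α`-Hölder continuity. -/
def HolderCont {d : ℕ} (α : ℝ) (f : (Fin d → ℝ) → ℝ) : Prop :=
  ∃ C : ℝ, ∀ x y, |f x - f y| ≤ C * dist x y ^ α

/-- Membership in `C^{2,α}`: twice continuously differentiable with `α`-Hölder
second partial derivatives. -/
def C2Holder {d : ℕ} (α : ℝ) (w : (Fin d → ℝ) → ℝ) : Prop :=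
  ContDiff ℝ 2 w ∧ ∀ i j, HolderCont α fun y => pder i (fun z => pder j w z) y

/-- Membership in `C^{1,α}`: continuously differentiable with `α`-Hölder
first partial derivatives. -/
def C1Holder {d : ℕ} (α : ℝ) (m : (Fin d → ℝ) → ℝ) : Prop :=
  ContDiff ℝ 1 m ∧ ∀ i, HolderCont α (pder i m)

/-- `w` is a classical solution of the divergence-form equation
`-div_y( e^{|Λ+∇_y w|²/2 + V(x,y)} (Λ + ∇_y w) ) = 0` in `𝒴^d`. -/
def DivFormSol {d : ℕ} (V : (Fin d → ℝ) → (Fin d → ℝ) → ℝ)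
    (x Λ : Fin d → ℝ) (w : (Fin d → ℝ) → ℝ) : Prop :=
  ∀ y, (∑ i, pder i (fun z =>
      Real.exp ((∑ l, (Λ l + pder l w z) ^ 2) / 2 + V x z) * (Λ i + pder i w z)) y) = 0

def gsq {d : ℕ} (f : (Fin d → ℝ) → ℝ) (y : Fin d → ℝ) : ℝ := ∑ i, (pder i f y) ^ 2

def esq {d : ℕ} (y : Fin d → ℝ) : ℝ := ∑ i, (y i) ^ 2

lemma esq_nonneg {d : ℕ} (y : Fin d → ℝ) : 0 ≤ esq y := Finset.sum_nonneg fun _ _ => sq_nonneg _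

lemma gsq_nonneg {d : ℕ} (f : (Fin d → ℝ) → ℝ) (y : Fin d → ℝ) : 0 ≤ gsq f y :=
  Finset.sum_nonneg fun _ _ => sq_nonneg _

lemma contDiff_esq {d : ℕ} {n : WithTop ℕ∞} : ContDiff ℝ n (esq (d := d)) := by
  unfold esq; fun_prop

lemma pder_esq {d : ℕ} (i : Fin d) (y : Fin d → ℝ) : pder i esq y = 2 * y i := by
  have h : HasFDerivAt (esq (d := d))
      (∑ j, (2 * y j) • (ContinuousLinearMap.proj j : (Fin d → ℝ) →L[ℝ] ℝ)) y := by
    unfold esq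
    refine HasFDerivAt.fun_sum fun j _ => ?_
    have := (ContinuousLinearMap.hasFDerivAt
      (ContinuousLinearMap.proj j : (Fin d → ℝ) →L[ℝ] ℝ) (x := y)).pow 2
    simpa using this
  unfold pder
  rw [h.fderiv]
  simp [Pi.single_apply]

lemma continuous_pder {d : ℕ} {f : (Fin d → ℝ) → ℝ} (hf : ContDiff ℝ 1 f) (i : Fin d) :
    Continuous (pder i f) := by
  unfold pder
  exact (hf.continuous_fderiv one_ne_zero).clm_apply continuous_const

lemma continuous_gsq {d : ℕ} {f : (Fin d → ℝ) → ℝ} (hf : ContDiff ℝ 1 f) :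
    Continuous (gsq f) := by
  unfold gsq
  exact continuous_finsetSum _ fun i _ => (continuous_pder hf i).pow 2

lemma pder_mul {d : ℕ} {f g : (Fin d → ℝ) → ℝ} {y : Fin d → ℝ} (i : Fin d)
    (hf : DifferentiableAt ℝ f y) (hg : DifferentiableAt ℝ g y) :
    pder i (fun z => f z * g z) y = f y * pder i g y + pder i f y * g y := by
  unfold pder
  rw [fderiv_fun_mul hf hg]
  simp [mul_comm]

lemma pder_comp {d : ℕ} {f : (Fin d → ℝ) → ℝ} {g : ℝ → ℝ} {y : Fin d → ℝ} (i : Fin d)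
    (hg : DifferentiableAt ℝ g (f y)) (hf : DifferentiableAt ℝ f y) :
    pder i (fun z => g (f z)) y = deriv g (f y) * pder i f y := by
  unfold pder
  have := (hg.hasDerivAt.comp_hasFDerivAt y hf.hasFDerivAt)
  have h2 : HasFDerivAt (fun z => g (f z)) (deriv g (f y) • fderiv ℝ f y) y := this
  rw [h2.fderiv]; simp

/-- The derivative of the smooth transition is bounded. -/
lemma exists_bound_deriv_sT : ∃ c : ℝ, 1 ≤ c ∧ ∀ x, |deriv Real.smoothTransition x| ≤ c := by
  have hc : Continuous (deriv Real.smoothTransition) :=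
    (Real.smoothTransition.contDiff (n := 1)).continuous_deriv (by norm_num)
  obtain ⟨C, hC⟩ := (isCompact_Icc (a := (-1:ℝ)) (b := 2)).exists_bound_of_continuousOn
    hc.continuousOn
  refine ⟨max C 1, le_max_right _ _, fun x => ?_⟩
  by_cases hx : x ∈ Set.Icc (-1:ℝ) 2
  · exact (hC x hx).trans (le_max_left _ _)
  · have : deriv Real.smoothTransition x = 0 := by
      rcases lt_or_ge x (-1) with h | h
      · have : Real.smoothTransition =ᶠ[𝓝 x] fun _ => 0 := by
          filter_upwards [gt_mem_nhds h] with z hz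
          exact Real.smoothTransition.zero_of_nonpos (by linarith)
        rw [this.deriv_eq]; simp
      · have h2 : 2 < x := by
          by_contra h3; exact hx ⟨h, not_lt.1 h3⟩
        have : Real.smoothTransition =ᶠ[𝓝 x] fun _ => 1 := by
          filter_upwards [lt_mem_nhds h2] with z hz
          exact Real.smoothTransition.one_of_one_le (by linarith)
        rw [this.deriv_eq]; simp
    rw [this]; simp

lemma deriv_sT_zero {x : ℝ} (h : x < 0 ∨ 1 < x) : deriv Real.smoothTransition x = 0 := by
  rcases h with h | h
  · have : Real.smoothTransition =ᶠ[𝓝 x] fun _ => 0 := by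
      filter_upwards [gt_mem_nhds h] with z hz
      exact Real.smoothTransition.zero_of_nonpos (by linarith)
    rw [this.deriv_eq]; simp
  · have : Real.smoothTransition =ᶠ[𝓝 x] fun _ => 1 := by
      filter_upwards [lt_mem_nhds h] with z hz
      exact Real.smoothTransition.one_of_one_le (by linarith)
    rw [this.deriv_eq]; simp

lemma isCompact_esq_le {d : ℕ} (c : ℝ) : IsCompact {y : Fin d → ℝ | esq y ≤ c} := by
  refine Metric.isCompact_of_isClosed_isBounded
    (isClosed_le (contDiff_esq (n := 0)).continuous continuous_const) ?_
  refine (Metric.isBounded_closedBall (x := (0 : Fin d → ℝ)) (r := |c| + 1)).subset fun y hy => ?_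
  rw [mem_closedBall_zero_iff, pi_norm_le_iff_of_nonneg (by positivity)]
  intro i
  have h1 : (y i) ^ 2 ≤ esq y :=
    Finset.single_le_sum (f := fun i => (y i) ^ 2) (fun _ _ => sq_nonneg _) (Finset.mem_univ i)
  have h2 : esq y ≤ c := hy
  rw [Real.norm_eq_abs]
  have h3 : |y i| ^ 2 ≤ |c| := by rw [sq_abs]; exact (h1.trans h2).trans (le_abs_self c)
  nlinarith [abs_nonneg (y i), abs_nonneg c]

/-- Cutoff functions. -/
lemma exists_cutoff : ∃ c : ℝ, 1 ≤ c ∧ ∀ (d : ℕ) (r R : ℝ), 0 < r → r < R →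
    ∃ ζ : (Fin d → ℝ) → ℝ, ContDiff ℝ 1 ζ ∧ HasCompactSupport ζ ∧ (∀ y, 0 ≤ ζ y) ∧
      (∀ y, ζ y ≤ 1) ∧ (∀ y, esq y ≤ r ^ 2 → ζ y = 1) ∧ (∀ y, R ^ 2 ≤ esq y → ζ y = 0) ∧
      (∀ y, gsq ζ y ≤ (c / (R - r)) ^ 2) ∧ (∀ y, R ^ 2 ≤ esq y → gsq ζ y = 0) := by
  obtain ⟨c, hc1, hc⟩ := exists_bound_deriv_sT
  refine ⟨2 * c, by linarith, fun d r R hr hrR => ?_⟩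
  have hD : 0 < R ^ 2 - r ^ 2 := by nlinarith
  set ζ : (Fin d → ℝ) → ℝ := fun y => Real.smoothTransition ((R ^ 2 - esq y) / (R ^ 2 - r ^ 2))
    with hζ
  have hcd : ContDiff ℝ 1 ζ :=
    (Real.smoothTransition.contDiff (n := 1)).comp ((contDiff_const.sub contDiff_esq).div_const _)
  have hp : ∀ i y, pder i ζ y =
      deriv Real.smoothTransition ((R ^ 2 - esq y) / (R ^ 2 - r ^ 2)) *
        (-(2 * y i) / (R ^ 2 - r ^ 2)) := by
    intro i y
    have hin : DifferentiableAt ℝ (fun z : Fin d → ℝ => (R ^ 2 - esq z) / (R ^ 2 - r ^ 2)) y :=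
      ((contDiff_const.sub contDiff_esq).div_const _ : ContDiff ℝ 1 _).differentiable
        (by norm_num) y
    rw [hζ, pder_comp (g := Real.smoothTransition)
      (f := fun z : Fin d → ℝ => (R ^ 2 - esq z) / (R ^ 2 - r ^ 2)) i
      ((Real.smoothTransition.contDiff (n := 1)).differentiable (by norm_num) _) hin]
    congr 1
    have : (fun z : Fin d → ℝ => (R ^ 2 - esq z) / (R ^ 2 - r ^ 2)) =
        fun z => (fun t : ℝ => (R ^ 2 - t) / (R ^ 2 - r ^ 2)) (esq z) := rfl
    have hd : HasDerivAt (fun t : ℝ => (R ^ 2 - t) / (R ^ 2 - r ^ 2)) (-1 / (R ^ 2 - r ^ 2))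
        (esq y) := by
      simpa using ((hasDerivAt_id (esq y)).const_sub (R ^ 2)).div_const (R ^ 2 - r ^ 2)
    rw [this, pder_comp (g := fun t : ℝ => (R ^ 2 - t) / (R ^ 2 - r ^ 2)) i hd.differentiableAt
      (contDiff_esq (n := 1) |>.differentiable (by norm_num) y), hd.deriv, pder_esq]
    ring
  have hg : ∀ y, gsq ζ y = (deriv Real.smoothTransition ((R ^ 2 - esq y) / (R ^ 2 - r ^ 2))) ^ 2 *
        (4 * esq y / (R ^ 2 - r ^ 2) ^ 2) := by
    intro y
    unfold gsq
    simp_rw [hp]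
    have : ∀ i, (deriv Real.smoothTransition ((R ^ 2 - esq y) / (R ^ 2 - r ^ 2)) *
        (-(2 * y i) / (R ^ 2 - r ^ 2))) ^ 2 =
        (deriv Real.smoothTransition ((R ^ 2 - esq y) / (R ^ 2 - r ^ 2))) ^ 2 *
          (4 / (R ^ 2 - r ^ 2) ^ 2) * (y i) ^ 2 := by
      intro i
      rw [mul_pow, div_pow]; ring
    simp_rw [this]
    rw [← Finset.mul_sum]
    unfold esq; ring
  have hg0 : ∀ y, R ^ 2 < esq y → gsq ζ y = 0 := by
    intro y hy
    rw [hg, deriv_sT_zero (Or.inl (div_neg_of_neg_of_pos (by linarith) hD))]; simp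
  refine ⟨ζ, hcd, ?_, fun y => Real.smoothTransition.nonneg _,
    fun y => Real.smoothTransition.le_one _, fun y hy => ?_, fun y hy => ?_, fun y => ?_,
    fun y hy => ?_⟩
  · refine HasCompactSupport.intro (isCompact_esq_le (R ^ 2)) fun y hy => ?_
    have : R ^ 2 < esq y := not_le.1 hy
    exact Real.smoothTransition.zero_of_nonpos
      (div_nonpos_of_nonpos_of_nonneg (by linarith) hD.le)
  · exact Real.smoothTransition.one_of_one_le ((one_le_div hD).2 (by linarith))
  · exact Real.smoothTransition.zero_of_nonpos
      (div_nonpos_of_nonpos_of_nonneg (by linarith) hD.le)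
  · rcases le_or_gt (esq y) (R ^ 2) with h | h
    · rw [hg]
      have h1 : (deriv Real.smoothTransition ((R ^ 2 - esq y) / (R ^ 2 - r ^ 2))) ^ 2 ≤ c ^ 2 := by
        rw [← sq_abs]; exact pow_le_pow_left₀ (abs_nonneg _) (hc _) 2
      have h2 : 4 * esq y / (R ^ 2 - r ^ 2) ^ 2 ≤ 4 / (R - r) ^ 2 := by
        have : 0 < R - r := by linarith
        rw [div_le_div_iff₀ (by positivity) (by positivity)]
        have : (R ^ 2 - r ^ 2) ^ 2 = (R - r) ^ 2 * (R + r) ^ 2 := by ring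
        rw [this]
        have h5 : esq y ≤ (R + r) ^ 2 := by nlinarith
        nlinarith [sq_nonneg (R - r)]
      calc _ ≤ c ^ 2 * (4 / (R - r) ^ 2) :=
            mul_le_mul h1 h2 (by have := esq_nonneg y; positivity) (by positivity)
        _ = _ := by rw [div_pow]; ring
    · rw [hg0 y h]; positivity
  · rcases hy.lt_or_eq with h | h
    · exact hg0 y h
    · have : deriv Real.smoothTransition ((R ^ 2 - esq y) / (R ^ 2 - r ^ 2)) = 0 := by
        rw [← h, sub_self, zero_div]
        have : IsLocalMin Real.smoothTransition 0 := by
          refine Filter.Eventually.of_forall fun z => ?_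
          rw [Real.smoothTransition.zero]; exact Real.smoothTransition.nonneg z
        exact this.deriv_eq_zero
      rw [hg, this]; simp

/-- Integral of a partial derivative of a compactly supported `C^1` function. -/
lemma integral_pder_eq_zero {d : ℕ} {g : (Fin d → ℝ) → ℝ} (hg : ContDiff ℝ 1 g)
    (hc : HasCompactSupport g) (i : Fin d) : ∫ y, pder i g y = 0 := by
  have hcp : HasCompactSupport (pder i g) := hc.fderiv_apply ℝ _
  have hI : Integrable (pder i g) := (continuous_pder hg i).integrable_of_hasCompactSupport hcp
  have hI2 : Integrable g := hg.continuous.integrable_of_hasCompactSupport hc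
  have := integral_mul_fderiv_eq_neg_fderiv_mul_of_integrable (μ := volume)
    (f := fun _ : Fin d → ℝ => (1:ℝ)) (g := g) (v := Pi.single i 1) (by simp)
    (by simp only [one_mul]; exact hI) (by simpa using hI2)
    (fun x _ => differentiableAt_const _) (fun x _ => hg.differentiable (by norm_num) x)
  simpa [pder] using this

/-- Subsolution pairs. -/
structure SubPair {d : ℕ} (lam M : ℝ) (W : (Fin d → ℝ) → ℝ) (F : Fin d → (Fin d → ℝ) → ℝ) :
    Prop where
  cW : ContDiff ℝ 1 W
  cF : ∀ i, ContDiff ℝ 1 (F i)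
  hdiv : ∀ y, lam * gsq W y ≤ ∑ i, pder i (F i) y
  hpos : ∀ y, 0 ≤ ∑ i, F i y * pder i W y
  hbd : ∀ y, ∑ i, (F i y) ^ 2 ≤ M ^ 2 * gsq W y

lemma caccioppoli {d : ℕ} {lam M : ℝ} (hlam : 0 < lam) (hM : 0 < M) {W : (Fin d → ℝ) → ℝ}
    {F : Fin d → (Fin d → ℝ) → ℝ} (H : SubPair lam M W F) {h : ℝ → ℝ} (hh : ContDiff ℝ 1 h)
    (h0 : ∀ t, 0 ≤ h t) (h1 : ∀ t, 0 ≤ deriv h t) {ζ : (Fin d → ℝ) → ℝ} (hζ : ContDiff ℝ 1 ζ)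
    (hζc : HasCompactSupport ζ) :
    ∫ y, ζ y ^ 2 * h (W y) * gsq W y ≤ 4 * M ^ 2 / lam ^ 2 * ∫ y, h (W y) * gsq ζ y := by
  have hhW : ContDiff ℝ 1 (fun y => h (W y)) := hh.comp H.cW
  have hcs2 : HasCompactSupport (fun y => ζ y ^ 2 * h (W y)) := by
    refine hζc.mono fun y hy => ?_
    simp only [mem_support] at hy ⊢
    intro h0; apply hy; rw [h0]; simp
  have hcsg : HasCompactSupport (fun y => gsq ζ y) := by
    refine HasCompactSupport.intro hζc fun y hy => ?_
    unfold gsq pder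
    have : fderiv ℝ ζ y = 0 := by
      by_contra hne
      exact hy (tsupport_fderiv_subset ℝ (subset_closure (by simpa using hne)))
    simp [this]
  have hz : ∀ i, ∫ y, pder i (fun z => (ζ z ^ 2 * h (W z)) * F i z) y = 0 := fun i =>
    integral_pder_eq_zero (((hζ.pow 2).mul hhW).mul (H.cF i)) (hcs2.mul_right) i
  have hInt : ∀ i, Integrable (pder i (fun z => (ζ z ^ 2 * h (W z)) * F i z)) := fun i =>
    (continuous_pder (((hζ.pow 2).mul hhW).mul (H.cF i)) i).integrable_of_hasCompactSupport
      ((hcs2.mul_right).fderiv_apply ℝ _)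
  have hsum : ∫ y, ∑ i, pder i (fun z => (ζ z ^ 2 * h (W z)) * F i z) y = 0 := by
    rw [integral_finsetSum _ fun i _ => hInt i]
    exact Finset.sum_eq_zero fun i _ => hz i
  have hpt : ∀ y, (lam / 2) * (ζ y ^ 2 * h (W y) * gsq W y) -
      (2 * M ^ 2 / lam) * (h (W y) * gsq ζ y) ≤
      ∑ i, pder i (fun z => (ζ z ^ 2 * h (W z)) * F i z) y := by
    intro y
    have dζ : DifferentiableAt ℝ ζ y := hζ.differentiable (by norm_num) y
    have dW : DifferentiableAt ℝ W y := H.cW.differentiable (by norm_num) y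
    have dh : DifferentiableAt ℝ h (W y) := hh.differentiable (by norm_num) _
    have e : ∀ i, pder i (fun z => (ζ z ^ 2 * h (W z)) * F i z) y =
        ζ y ^ 2 * h (W y) * pder i (F i) y + ζ y ^ 2 * deriv h (W y) * (F i y * pder i W y) +
        h (W y) * (2 * ζ y * pder i ζ y * F i y) := by
      intro i
      rw [pder_mul i (((hζ.pow 2).mul hhW).differentiable (by norm_num) y)
        ((H.cF i).differentiable (by norm_num) y),
        pder_mul (f := fun z => ζ z ^ 2) (g := fun z => h (W z)) i
          ((hζ.pow 2).differentiable (by norm_num) y) (hhW.differentiable (by norm_num) y),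
        pder_comp i dh dW, pder_comp (g := fun t => t ^ 2) i (by fun_prop) dζ]
      simp
      ring
    simp_rw [e]
    rw [Finset.sum_add_distrib, Finset.sum_add_distrib, ← Finset.mul_sum, ← Finset.mul_sum,
      ← Finset.mul_sum]
    have t1 : ζ y ^ 2 * h (W y) * (lam * gsq W y) ≤
        ζ y ^ 2 * h (W y) * ∑ i, pder i (F i) y :=
      mul_le_mul_of_nonneg_left (H.hdiv y) (mul_nonneg (sq_nonneg _) (h0 _))
    have t2 : 0 ≤ ζ y ^ 2 * deriv h (W y) * ∑ i, F i y * pder i W y :=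
      mul_nonneg (mul_nonneg (sq_nonneg _) (h1 _)) (H.hpos y)
    have t3 : -(lam / 2 * (ζ y ^ 2 * gsq W y) + 2 * M ^ 2 / lam * gsq ζ y) ≤
        ∑ i, 2 * ζ y * pder i ζ y * F i y := by
      have a1 : ∀ i, -(lam / (2 * M ^ 2) * ζ y ^ 2 * (F i y) ^ 2 +
          2 * M ^ 2 / lam * (pder i ζ y) ^ 2) ≤ 2 * ζ y * pder i ζ y * F i y := by
        intro i
        have hm : 0 < lam / (2 * M ^ 2) := by positivity
        have hme : 2 * M ^ 2 / lam = (lam / (2 * M ^ 2))⁻¹ := by rw [inv_div]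
        rw [hme]
        set μ := lam / (2 * M ^ 2)
        have : 0 ≤ μ⁻¹ * (μ * ζ y * F i y + pder i ζ y) ^ 2 := by positivity
        have e2 : μ⁻¹ * (μ * ζ y * F i y + pder i ζ y) ^ 2 =
            μ * ζ y ^ 2 * (F i y) ^ 2 + 2 * ζ y * pder i ζ y * F i y + μ⁻¹ * (pder i ζ y) ^ 2 := by
          field_simp; ring
        linarith
      have a2 := Finset.sum_le_sum fun i (_ : i ∈ Finset.univ) => a1 i
      rw [Finset.sum_neg_distrib, Finset.sum_add_distrib, ← Finset.mul_sum, ← Finset.mul_sum] at a2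
      have a3 : lam / (2 * M ^ 2) * ζ y ^ 2 * ∑ i, (F i y) ^ 2 ≤ lam / 2 * (ζ y ^ 2 * gsq W y) := by
        calc _ ≤ lam / (2 * M ^ 2) * ζ y ^ 2 * (M ^ 2 * gsq W y) :=
              mul_le_mul_of_nonneg_left (H.hbd y) (by positivity)
          _ = _ := by field_simp
      have a4 : ∑ i, (pder i ζ y) ^ 2 = gsq ζ y := rfl
      rw [a4] at a2
      linarith
    have t4 := mul_le_mul_of_nonneg_left t3 (h0 (W y))
    nlinarith
  have i1 : Integrable (fun y => ζ y ^ 2 * h (W y) * gsq W y) :=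
    (((hζ.continuous.pow 2).mul hhW.continuous).mul
      (continuous_gsq H.cW)).integrable_of_hasCompactSupport hcs2.mul_right
  have i2 : Integrable (fun y => h (W y) * gsq ζ y) :=
    (hhW.continuous.mul (continuous_gsq hζ)).integrable_of_hasCompactSupport hcsg.mul_left
  have hfin := integral_mono ((i1.const_mul (lam / 2)).sub (i2.const_mul (2 * M ^ 2 / lam)))
    (integrable_finsetSum _ fun i _ => hInt i) (fun y => hpt y)
  have hsum' : ∫ y, ∑ i, pder i (fun z => (ζ z ^ 2 * h (W z)) * F i z) y = 0 := hsum
  simp only [Pi.sub_apply] at hfin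
  rw [hsum', integral_sub (i1.const_mul _) (i2.const_mul _), integral_const_mul,
    integral_const_mul] at hfin
  have : 4 * M ^ 2 / lam ^ 2 = (2 / lam) * (2 * M ^ 2 / lam) := by field_simp; ring
  rw [this]
  have h3 : 0 < 2 / lam := by positivity
  have h4 := mul_le_mul_of_nonneg_left hfin h3.le
  have h5 : 2 / lam * (lam / 2) = 1 := by field_simp
  rw [mul_sub, ← mul_assoc, ← mul_assoc, h5] at h4
  linarith

lemma iter_zero {p b C : ℝ} (hp : 1 < p) (hb : 1 < b) (hC : 0 < C) :
    ∃ ε0 > 0, ∀ a : ℕ → ℝ, (∀ j, 0 ≤ a j) → (∀ j, a (j + 1) ≤ (C * b ^ j * a j) ^ p) →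
      a 0 ≤ ε0 → Tendsto a atTop (𝓝 0) := by
  have hp1 : 0 < p - 1 := by linarith
  have hb0 : 0 < b := by linarith
  set θ : ℝ := b ^ (-(p / (p - 1))) with hθ
  have hθ0 : 0 < θ := Real.rpow_pos_of_pos hb0 _
  have hθ1 : θ < 1 := Real.rpow_lt_one_of_one_lt_of_neg hb (by
    have : 0 < p / (p - 1) := by positivity
    linarith)
  have hbθ : (b * θ) ^ p = θ := by
    have : b * θ = b ^ (1 + -(p / (p - 1))) := by
      rw [Real.rpow_add hb0, Real.rpow_one]
    rw [this, ← Real.rpow_mul hb0.le, hθ]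
    congr 1
    field_simp; ring
  set ε0 : ℝ := (θ * C ^ (-p)) ^ (1 / (p - 1)) with hε
  have hε0 : 0 < ε0 := by positivity
  have hCε : (C * ε0) ^ p = ε0 * θ := by
    rw [Real.mul_rpow hC.le hε0.le]
    have h1 : ε0 ^ p = ε0 * ε0 ^ (p - 1) := by
      rw [Real.rpow_sub_one hε0.ne']; field_simp
    have h2 : ε0 ^ (p - 1) = θ * C ^ (-p) := by
      rw [hε, ← Real.rpow_mul (by positivity), one_div_mul_cancel hp1.ne', Real.rpow_one]
    rw [h1, h2, Real.rpow_neg hC.le]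
    have : C ^ p ≠ 0 := by positivity
    field_simp
  refine ⟨ε0, hε0, fun a ha hrec h0 => ?_⟩
  have key : ∀ j, a j ≤ ε0 * θ ^ j := by
    intro j
    induction j with
    | zero => simpa using h0
    | succ j ih =>
      calc a (j + 1) ≤ (C * b ^ j * a j) ^ p := hrec j
        _ ≤ (C * b ^ j * (ε0 * θ ^ j)) ^ p := by
            apply Real.rpow_le_rpow
            · have := ha j; positivity
            · gcongr
            · linarith
        _ = ((C * ε0) * (b * θ) ^ j) ^ p := by rw [mul_pow]; ring_nf
        _ = (C * ε0) ^ p * ((b * θ) ^ p) ^ j := by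
            rw [Real.mul_rpow (by positivity) (by positivity), ← Real.rpow_natCast,
              ← Real.rpow_natCast, ← Real.rpow_mul (by positivity), ← Real.rpow_mul (by positivity),
              mul_comm (j : ℝ)]
        _ = ε0 * θ ^ (j + 1) := by rw [hCε, hbθ]; ring
  refine squeeze_zero ha key ?_
  simpa using (tendsto_pow_atTop_nhds_zero_of_lt_one hθ0.le hθ1).const_mul ε0

def lev {d : ℕ} (W : (Fin d → ℝ) → ℝ) (k r : ℝ) : Set (Fin d → ℝ) :=
  {y | esq y < r ^ 2 ∧ k < W y}

lemma continuous_esq {d : ℕ} : Continuous (esq (d := d)) := (contDiff_esq (n := 0)).continuous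

lemma isOpen_lev {d : ℕ} {W : (Fin d → ℝ) → ℝ} (hW : Continuous W) (k r : ℝ) :
    IsOpen (lev W k r) :=
  (isOpen_lt continuous_esq continuous_const).inter (isOpen_lt continuous_const hW)

lemma vol_esq_lt_top {d : ℕ} (r : ℝ) : volume {y : Fin d → ℝ | esq y < r ^ 2} < ⊤ :=
  lt_of_le_of_lt (measure_mono (t := {y : Fin d → ℝ | esq y ≤ r ^ 2})
    (fun y (hy : esq y < r ^ 2) => le_of_lt hy)) (isCompact_esq_le (r ^ 2)).measure_lt_top

lemma vol_lev_lt_top {d : ℕ} (W : (Fin d → ℝ) → ℝ) (k r : ℝ) : volume (lev W k r) < ⊤ :=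
  lt_of_le_of_lt (measure_mono fun _ hy => hy.1) (vol_esq_lt_top r)

lemma norm_fderiv_le {d : ℕ} (f : (Fin d → ℝ) → ℝ) (y : Fin d → ℝ) :
    ‖fderiv ℝ f y‖ ≤ ∑ i, |pder i f y| := by
  refine ContinuousLinearMap.opNorm_le_bound _ (Finset.sum_nonneg fun _ _ => abs_nonneg _) fun v => ?_
  have : v = ∑ i, v i • (Pi.single i (1:ℝ) : Fin d → ℝ) := by
    ext j; simp [Finset.sum_apply, Pi.single_apply]
  conv_lhs => rw [this]
  rw [map_sum, Finset.sum_mul]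
  refine (norm_sum_le _ _).trans (Finset.sum_le_sum fun i _ => ?_)
  rw [map_smul, norm_smul, mul_comm]
  exact mul_le_mul_of_nonneg_left (norm_le_pi_norm v i) (norm_nonneg _)

lemma abs_pder_le_of_gsq {d : ℕ} {f : (Fin d → ℝ) → ℝ} {y : Fin d → ℝ} {a : ℝ} (ha : 0 ≤ a)
    (h : gsq f y ≤ a ^ 2) (i : Fin d) : |pder i f y| ≤ a := by
  have h1 : (pder i f y) ^ 2 ≤ gsq f y :=
    Finset.single_le_sum (f := fun i => (pder i f y) ^ 2) (fun _ _ => sq_nonneg _)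
      (Finset.mem_univ i)
  exact abs_le_of_sq_le_sq (h1.trans h) ha

lemma level_ineq {d : ℕ} (hd : 2 ≤ d) {lam M : ℝ} (hlam : 0 < lam) (hM : 0 < M) :
    ∃ C > 0, ∀ (W : (Fin d → ℝ) → ℝ) (F : Fin d → (Fin d → ℝ) → ℝ), SubPair lam M W F →
      ∀ k l r R : ℝ, 0 < r → r < R → R - r ≤ 1 → k < l → l - k ≤ 1 →
      volume.real (lev W l r) ≤
        (C / ((R - r) * (l - k)) * volume.real (lev W k R)) ^ (Real.conjExponent (d : ℝ)) := by
  obtain ⟨c, hc1, hcut⟩ := exists_cutoff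
  obtain ⟨c', hc1', hst⟩ := exists_bound_deriv_sT
  refine ⟨c' * (4 * M ^ 2 / lam ^ 2 * c ^ 2 + d) + d * c, by positivity,
    fun W F H k l r R hr hrR hRr1 hkl hkl1 => ?_⟩
  have hδ : 0 < R - r := by linarith
  have hη : 0 < l - k := by linarith
  obtain ⟨ζ, hζ, hζc, hζ0, hζ1, hζr, hζR, hζg, hζg0⟩ := hcut d r R hr hrR
  set m := (k + l) / 2 with hm
  have hsT : ContDiff ℝ 1 Real.smoothTransition := Real.smoothTransition.contDiff (n := 1)
  set h1 : ℝ → ℝ := fun t => Real.smoothTransition ((t - k) / (m - k)) with hh1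
  set h2 : ℝ → ℝ := fun t => Real.smoothTransition ((t - m) / (l - m)) with hh2
  have hmk : 0 < m - k := by rw [hm]; linarith
  have hlm : 0 < l - m := by rw [hm]; linarith
  have h1c : ContDiff ℝ 1 h1 := hsT.comp (by fun_prop)
  have h2c : ContDiff ℝ 1 h2 := hsT.comp (by fun_prop)
  have h1d : ∀ t, 0 ≤ deriv h1 t := fun t => by
    have : Monotone h1 := fun s t hst => Real.smoothTransition.monotone (by gcongr)
    exact this.deriv_nonneg
  have h1n : ∀ t, 0 ≤ h1 t := fun t => Real.smoothTransition.nonneg _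
  have h1o : ∀ t, h1 t ≤ 1 := fun t => Real.smoothTransition.le_one _
  have h2n : ∀ t, 0 ≤ h2 t := fun t => Real.smoothTransition.nonneg _
  have h1z : ∀ t, t ≤ k → h1 t = 0 := fun t ht => Real.smoothTransition.zero_of_nonpos
      (div_nonpos_of_nonpos_of_nonneg (by linarith) hmk.le)
  have h1e : ∀ t, m ≤ t → h1 t = 1 := fun t ht => Real.smoothTransition.one_of_one_le
      ((one_le_div hmk).2 (by linarith))
  have h2z : ∀ t, t ≤ m → h2 t = 0 := fun t ht => Real.smoothTransition.zero_of_nonpos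
      (div_nonpos_of_nonpos_of_nonneg (by linarith) hlm.le)
  have h2e : ∀ t, l ≤ t → h2 t = 1 := fun t ht => Real.smoothTransition.one_of_one_le
      ((one_le_div hlm).2 (by linarith))
  have h21 : ∀ t, h2 t ≤ h1 t := fun t => by
    rcases le_total t m with h | h
    · rw [h2z t h]; exact h1n t
    · rw [h1e t h]; exact Real.smoothTransition.le_one _
  have h2d : ∀ t, |deriv h2 t| ≤ 2 * c' / (l - k) * h1 t := fun t => by
    have hin : HasDerivAt (fun t : ℝ => (t - m) / (l - m)) (1 / (l - m)) t := by
      simpa using ((hasDerivAt_id t).sub_const m).div_const (l - m)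
    have : deriv h2 t = deriv Real.smoothTransition ((t - m) / (l - m)) * (1 / (l - m)) := by
      have := ((hsT.differentiable (by norm_num) ((t - m) / (l - m))).hasDerivAt.comp t hin)
      exact this.deriv
    rcases lt_or_ge t m with h | h
    · rw [this, deriv_sT_zero (Or.inl (div_neg_of_neg_of_pos (by linarith) hlm))]
      have := h1n t
      simp; positivity
    · rw [this, h1e t h, abs_mul, mul_one]
      have e : 2 * c' / (l - k) = c' * (1 / (l - m)) := by
        have : l - m = (l - k) / 2 := by rw [hm]; ring
        rw [this]; field_simp
      rw [e, abs_of_pos (by positivity : 0 < 1 / (l - m))]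
      exact mul_le_mul_of_nonneg_right (hst _) (by positivity)
  set f : (Fin d → ℝ) → ℝ := fun y => ζ y * h2 (W y) with hf
  have hfc : ContDiff ℝ 1 f := hζ.mul (h2c.comp H.cW)
  have hfs : HasCompactSupport f := hζc.mul_right
  set S := lev W k R with hS
  have hSm : MeasurableSet S := (isOpen_lev H.cW.continuous k R).measurableSet
  set χ : (Fin d → ℝ) → ℝ := S.indicator (fun _ => (1:ℝ)) with hχ
  have hχI : Integrable χ := by
    rw [hχ, integrable_indicator_iff hSm]
    exact integrableOn_const (vol_lev_lt_top W k R).ne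
  have hχi : ∫ y, χ y = volume.real S := by
    rw [hχ, integral_indicator hSm]; simp
  have hχ0 : ∀ y, 0 ≤ χ y := fun y => Set.indicator_nonneg (fun _ _ => zero_le_one) y
  -- energy
  have hE := caccioppoli hlam hM H h1c h1n h1d hζ hζc
  have hE2 : ∫ y, h1 (W y) * gsq ζ y ≤ (c / (R - r)) ^ 2 * volume.real S := by
    rw [← hχi, ← integral_const_mul]
    refine integral_mono_of_nonneg (Eventually.of_forall fun y => mul_nonneg (h1n _) (gsq_nonneg _ _))
      (hχI.const_mul _) (Eventually.of_forall fun y => ?_)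
    simp only
    by_cases hy : y ∈ S
    · have : χ y = 1 := by simp [hχ, hy]
      rw [this, mul_one]
      calc h1 (W y) * gsq ζ y ≤ 1 * gsq ζ y :=
            mul_le_mul_of_nonneg_right (h1o _) (gsq_nonneg _ _)
        _ ≤ _ := by rw [one_mul]; exact hζg y
    · have : χ y = 0 := by simp [hχ, hy]
      rw [this, mul_zero]
      have hy' : R ^ 2 ≤ esq y ∨ W y ≤ k := by
        by_contra hcon
        push Not at hcon
        exact hy ⟨hcon.1, hcon.2⟩
      rcases hy' with h | h
      · rw [hζg0 y h]; simp
      · rw [h1z _ h]; simp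
  set K1 := c' / (l - k) * (R - r) with hK1
  set K2 := (c' / (l - k) + c) * (d / (R - r)) with hK2
  have hpt : ∀ y, ‖fderiv ℝ f y‖ ≤ K1 * (ζ y ^ 2 * h1 (W y) * gsq W y) + K2 * χ y := by
    intro y
    refine (norm_fderiv_le f y).trans ?_
    have hpd : ∀ i, pder i f y = ζ y * (deriv h2 (W y) * pder i W y) + pder i ζ y * h2 (W y) := by
      intro i
      rw [hf, pder_mul (g := fun y => h2 (W y)) i (hζ.differentiable (by norm_num) y)
        ((h2c.comp H.cW).differentiable (by norm_num) y),
        pder_comp i (h2c.differentiable (by norm_num) _) (H.cW.differentiable (by norm_num) y)]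
    by_cases hy : y ∈ S
    · have hχ1 : χ y = 1 := by simp [hχ, hy]
      rw [hχ1]
      have hi : ∀ i, |pder i f y| ≤ K1 * (ζ y ^ 2 * h1 (W y)) * (pder i W y) ^ 2 +
          (c' / (l - k) + c) * (1 / (R - r)) := by
        intro i
        rw [hpd]
        refine (abs_add_le _ _).trans ?_
        rw [abs_mul, abs_mul, abs_mul, abs_of_nonneg (hζ0 y), abs_of_nonneg (h2n _)]
        have b1 : |pder i ζ y| * h2 (W y) ≤ c / (R - r) * 1 :=
          mul_le_mul (abs_pder_le_of_gsq (by positivity) (hζg y) i)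
            ((h21 _).trans (h1o _)) (h2n _) (by positivity)
        have b2 : ζ y * (|deriv h2 (W y)| * |pder i W y|) ≤
            2 * c' / (l - k) * h1 (W y) * (ζ y * |pder i W y|) := by
          have := mul_le_mul_of_nonneg_right (h2d (W y))
            (mul_nonneg (hζ0 y) (abs_nonneg (pder i W y)))
          linarith
        have b3 : 2 * (ζ y * |pder i W y|) ≤ (R - r) * (ζ y ^ 2 * (pder i W y) ^ 2) +
            1 / (R - r) := by
          have : 0 ≤ (1 / (R - r)) * ((R - r) * (ζ y * |pder i W y|) - 1) ^ 2 := by positivity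
          have e : (1 / (R - r)) * ((R - r) * (ζ y * |pder i W y|) - 1) ^ 2 =
              (R - r) * (ζ y ^ 2 * |pder i W y| ^ 2) + 1 / (R - r) - 2 * (ζ y * |pder i W y|) := by
            field_simp; ring
          rw [sq_abs] at e
          linarith
        have hcl : 0 ≤ c' / (l - k) := by positivity
        have b4 : 2 * c' / (l - k) * h1 (W y) * (ζ y * |pder i W y|) ≤
            c' / (l - k) * h1 (W y) * ((R - r) * (ζ y ^ 2 * (pder i W y) ^ 2)) +
              c' / (l - k) * (1 / (R - r)) := by
          have := mul_le_mul_of_nonneg_left b3 (mul_nonneg hcl (h1n (W y)))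
          have b5 : c' / (l - k) * h1 (W y) * (1 / (R - r)) ≤ c' / (l - k) * 1 * (1 / (R - r)) := by
            gcongr; exact h1o _
          have e5 : 2 * c' / (l - k) * h1 (W y) * (ζ y * |pder i W y|) =
            c' / (l - k) * h1 (W y) * (2 * (ζ y * |pder i W y|)) := by ring
          rw [e5]
          linarith
        have e6 : K1 * (ζ y ^ 2 * h1 (W y)) * (pder i W y) ^ 2 =
          c' / (l - k) * h1 (W y) * ((R - r) * (ζ y ^ 2 * (pder i W y) ^ 2)) := by rw [hK1]; ring
        have e7 : c / (R - r) * 1 = c * (1 / (R - r)) := by ring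
        rw [e6, add_mul]
        linarith
      have hs := Finset.sum_le_sum fun i (_ : i ∈ Finset.univ) => hi i
      rw [Finset.sum_add_distrib, ← Finset.mul_sum] at hs
      simp only [Finset.sum_const, Finset.card_univ, Fintype.card_fin, nsmul_eq_mul] at hs
      refine hs.trans (le_of_eq ?_)
      unfold gsq
      rw [hK2]; ring
    · have hz : ∀ i, pder i f y = 0 := by
        intro i
        rw [hpd]
        have hy' : R ^ 2 ≤ esq y ∨ W y ≤ k := by
          by_contra hcon
          push Not at hcon
          exact hy ⟨hcon.1, hcon.2⟩
        rcases hy' with h | h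
        · have g0 : |pder i ζ y| ≤ 0 := abs_pder_le_of_gsq le_rfl (by rw [hζg0 y h]; simp) i
          rw [hζR y h, abs_nonpos_iff.1 g0]; simp
        · have d0 : |deriv h2 (W y)| ≤ 0 := by
            have := h2d (W y); rw [h1z _ h, mul_zero] at this; exact this
          rw [abs_nonpos_iff.1 d0, h2z _ (by linarith)]; simp
      simp only [hz, abs_zero, Finset.sum_const_zero]
      have t1 := hχ0 y
      have t2 := h1n (W y)
      have t3 := gsq_nonneg W y
      positivity
  have iE : Integrable (fun y => ζ y ^ 2 * h1 (W y) * gsq W y) := by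
    refine Continuous.integrable_of_hasCompactSupport
      (((hζ.continuous.pow 2).mul (h1c.comp H.cW).continuous).mul (continuous_gsq H.cW)) ?_
    refine hζc.mono fun y hy => ?_
    simp only [mem_support] at hy ⊢
    intro h0; apply hy; rw [h0]; simp
  set p := Real.conjExponent (d : ℝ) with hp
  have hd1 : (1:ℝ) < d := by exact_mod_cast hd
  have hpc : Real.HolderConjugate (d : ℝ) p := Real.HolderConjugate.conjExponent hd1
  have hp0 : 0 < p := hpc.symm.pos
  have hfdc : Continuous fun y => ‖fderiv ℝ f y‖ := (hfc.continuous_fderiv one_ne_zero).norm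
  have hfdi : Integrable fun y => fderiv ℝ f y :=
    (hfc.continuous_fderiv one_ne_zero).integrable_of_hasCompactSupport (hfs.fderiv ℝ)
  have hI : ∫ y, ‖fderiv ℝ f y‖ ≤
      (c' * (4 * M ^ 2 / lam ^ 2 * c ^ 2 + d) + d * c) / ((R - r) * (l - k)) * volume.real S := by
    have hv : 0 ≤ volume.real S := measureReal_nonneg
    calc ∫ y, ‖fderiv ℝ f y‖ ≤ ∫ y, (K1 * (ζ y ^ 2 * h1 (W y) * gsq W y) + K2 * χ y) :=
          integral_mono hfdi.norm ((iE.const_mul _).add (hχI.const_mul _)) hpt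
      _ = K1 * (∫ y, ζ y ^ 2 * h1 (W y) * gsq W y) + K2 * volume.real S := by
          rw [integral_add (iE.const_mul _) (hχI.const_mul _), integral_const_mul,
            integral_const_mul, hχi]
      _ ≤ K1 * (4 * M ^ 2 / lam ^ 2 * ((c / (R - r)) ^ 2 * volume.real S)) +
            K2 * volume.real S := by
          gcongr
          exact hE.trans (mul_le_mul_of_nonneg_left hE2 (by positivity))
      _ = ((c' * (4 * M ^ 2 / lam ^ 2 * c ^ 2 + d) + d * c * (l - k)) / ((R - r) * (l - k))) *
            volume.real S := by
          rw [hK1, hK2]; field_simp; ring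
      _ ≤ _ := by
          have : (d:ℝ) * c * (l - k) ≤ d * c * 1 := by gcongr
          refine mul_le_mul_of_nonneg_right (div_le_div_of_nonneg_right ?_ (by positivity)) hv
          linarith
  have hsob := lintegral_pow_le_pow_lintegral_fderiv_aux (ι := Fin d) (p := p)
    (by simpa using hpc) hfc hfs
  have hlow : volume (lev W l r) ≤ ∫⁻ y, ‖f y‖ₑ ^ p := by
    have hm2 : MeasurableSet (lev W l r) := (isOpen_lev H.cW.continuous l r).measurableSet
    rw [← lintegral_indicator_one hm2]
    refine lintegral_mono fun y => ?_
    by_cases hy : y ∈ lev W l r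
    · have : f y = 1 := by
        simp only [hf]
        rw [hζr y hy.1.le, h2e _ hy.2.le, mul_one]
      simp [hy, this]
    · simp [hy]
  have hfin : ∫⁻ y, ‖fderiv ℝ f y‖ₑ = ENNReal.ofReal (∫ y, ‖fderiv ℝ f y‖) := by
    rw [ofReal_integral_norm_eq_lintegral_enorm hfdi]
  have htot := hlow.trans hsob
  rw [hfin, ENNReal.ofReal_rpow_of_nonneg (integral_nonneg fun _ => norm_nonneg _) hp0.le] at htot
  have h3 := ENNReal.toReal_mono ENNReal.ofReal_ne_top htot
  rw [ENNReal.toReal_ofReal (Real.rpow_nonneg (integral_nonneg fun _ => norm_nonneg _) _)] at h3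
  exact h3.trans (Real.rpow_le_rpow (integral_nonneg fun _ => norm_nonneg _) hI hp0.le)

/-- De Giorgi sup bound. -/
lemma sup_bound {d : ℕ} (hd : 2 ≤ d) {lam M : ℝ} (hlam : 0 < lam) (hM : 0 < M) :
    ∃ ε0 > 0, ∀ (W : (Fin d → ℝ) → ℝ) (F : Fin d → (Fin d → ℝ) → ℝ), SubPair lam M W F →
      ∀ k : ℝ, volume.real (lev W k 1) ≤ ε0 → ∀ y, esq y < 1 / 4 → W y ≤ k + 1 := by
  obtain ⟨C, hC, hlev⟩ := level_ineq hd hlam hM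
  have hd1 : (1:ℝ) < d := by exact_mod_cast hd
  have hpc : Real.HolderConjugate (d : ℝ) (Real.conjExponent (d : ℝ)) :=
    Real.HolderConjugate.conjExponent hd1
  obtain ⟨ε0, hε0, hit⟩ := iter_zero (b := 4) (C := 8 * C) hpc.symm.lt (by norm_num) (by positivity)
  refine ⟨ε0, hε0, fun W F H k hk y hy => ?_⟩
  set q : ℕ → ℝ := fun j => (1 / 2 : ℝ) ^ j with hq
  have hq0 : ∀ j, 0 < q j := fun j => by simp only [hq]; positivity
  have hq1 : ∀ j, q j ≤ 1 := fun j => pow_le_one₀ (by norm_num) (by norm_num)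
  have hqs : ∀ j, q (j + 1) = q j / 2 := fun j => by simp only [hq, pow_succ]; ring
  set a : ℕ → ℝ := fun j => volume.real (lev W (k + 1 - q j) (1 / 2 + q j / 2)) with ha
  have hlim := hit a (fun j => measureReal_nonneg) (fun j => by
    have h := hlev W F H (k + 1 - q j) (k + 1 - q (j + 1)) (1 / 2 + q (j + 1) / 2)
      (1 / 2 + q j / 2) (by linarith [hq0 (j+1)]) (by rw [hqs]; linarith [hq0 j])
      (by rw [hqs]; linarith [hq0 j, hq1 j]) (by rw [hqs]; linarith [hq0 j])
      (by rw [hqs]; linarith [hq0 j, hq1 j])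
    have e : C / ((1 / 2 + q j / 2 - (1 / 2 + q (j + 1) / 2)) *
        (k + 1 - q (j + 1) - (k + 1 - q j))) = 8 * C * 4 ^ j := by
      rw [hqs]
      have h4 : (4:ℝ) ^ j * (q j) ^ 2 = 1 := by
        simp only [hq]; rw [← pow_mul, mul_comm j 2, pow_mul, ← mul_pow]; norm_num
      have : q j ≠ 0 := (hq0 j).ne'
      have e2 : (1 / 2 + q j / 2 - (1 / 2 + q j / 2 / 2)) * (k + 1 - q j / 2 - (k + 1 - q j)) =
        (q j) ^ 2 / 8 := by ring
      rw [e2, div_eq_iff (by positivity)]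
      linear_combination (-C) * h4
    rw [e] at h
    exact h) (by
      have : lev W (k + 1 - q 0) (1 / 2 + q 0 / 2) = lev W k 1 := by simp [hq]; norm_num
      simp only [ha]; rw [this]; exact hk)
  have hvz : volume.real (lev W (k + 1) (1 / 2)) ≤ 0 := by
    refine ge_of_tendsto hlim (Eventually.of_forall fun j => ?_)
    refine measureReal_mono (fun z hz => ?_) (vol_lev_lt_top _ _ _).ne
    refine ⟨hz.1.trans_le ?_, ?_⟩
    · have := hq0 j
      gcongr; linarith
    · have := hz.2; linarith [hq0 j]
  by_contra hcon
  push Not at hcon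
  have hne : (lev W (k + 1) (1 / 2)).Nonempty := ⟨y, by
    refine ⟨?_, hcon⟩; norm_num; linarith⟩
  have hpos := (isOpen_lev H.cW.continuous (k + 1) (1 / 2)).measure_pos volume hne
  have : 0 < volume.real (lev W (k + 1) (1 / 2)) :=
    ENNReal.toReal_pos hpos.ne' (vol_lev_lt_top _ _ _).ne
  linarith

lemma lintegral_line_le {d : ℕ} {G : (Fin d → ℝ) → ENNReal} (hG : Measurable G) (x : Fin d → ℝ)
    {t : ℝ} (ht : t ∈ Set.Icc (1/2 : ℝ) 1) :
    ∫⁻ y, G (x + t • (y - x)) ≤ 2 ^ d * ∫⁻ z, G z := by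
  have ht0 : t ≠ 0 := by have := ht.1; intro h; rw [h] at this; norm_num at this
  have hm := Measure.map_addHaar_smul (volume : Measure (Fin d → ℝ)) ht0
  have e : ∀ y, x + t • (y - x) = t • y + (x - t • x) := fun y => by rw [smul_sub]; abel
  simp_rw [e]
  have h1 : ∫⁻ y, G (t • y + (x - t • x)) =
      ∫⁻ y, G (y + (x - t • x)) ∂(Measure.map (t • ·) (volume : Measure (Fin d → ℝ))) := by
    rw [lintegral_map (f := fun y => G (y + (x - t • x))) (hG.comp (measurable_add_const _))
      (measurable_const_smul t)]
  rw [h1, hm, lintegral_smul_measure, lintegral_add_right_eq_self]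
  rw [smul_eq_mul]
  gcongr
  rw [Module.finrank_fin_fun]
  have : |(t ^ d)⁻¹| ≤ 2 ^ d := by
    have htp : 0 < t := by linarith [ht.1]
    rw [abs_of_pos (by positivity), ← inv_pow]
    gcongr
    rw [inv_le_comm₀ htp (by norm_num)]
    have := ht.1; norm_num at this ⊢; exact this
  calc ENNReal.ofReal |(t ^ d)⁻¹| ≤ ENNReal.ofReal (2 ^ d) := ENNReal.ofReal_le_ofReal this
    _ = 2 ^ d := by rw [ENNReal.ofReal_pow (by norm_num)]; norm_num

lemma poincare_cheb {d : ℕ} {W : (Fin d → ℝ) → ℝ} (hW : ContDiff ℝ 1 W) {D A Z : Set (Fin d → ℝ)}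
    (hD : MeasurableSet D) (hDc : Convex ℝ D) (hDd : ∀ x ∈ D, ‖x‖ ≤ 1) (hAm : MeasurableSet A)
    (hZm : MeasurableSet Z)
    (hA : A ⊆ D) (hZ : Z ⊆ D) (δ : ENNReal) (hδ : ∀ x ∈ A, ∀ y ∈ Z, δ ≤ ‖W x - W y‖ₑ) :
    δ * volume A * volume Z ≤ 4 * 2 ^ d * volume D * ∫⁻ z in D, ‖fderiv ℝ W z‖ₑ := by
  set G : (Fin d → ℝ) → ENNReal := D.indicator fun z => ‖fderiv ℝ W z‖ₑ with hGdef
  have hG : Measurable G :=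
    (Continuous.enorm (hW.continuous_fderiv one_ne_zero)).measurable.indicator hD
  have hGi : ∫⁻ z, G z = ∫⁻ z in D, ‖fderiv ℝ W z‖ₑ := lintegral_indicator hD _
  set b : (Fin d → ℝ) → (Fin d → ℝ) → ENNReal := fun x y =>
    ∫⁻ t in Set.Icc (1/2 : ℝ) 1, G (x + t • (y - x)) with hb
  have hmeas3 : Measurable fun q : ((Fin d → ℝ) × (Fin d → ℝ)) × ℝ =>
      G (q.1.1 + q.2 • (q.1.2 - q.1.1)) := hG.comp (by fun_prop)
  have hbm : Measurable fun q : (Fin d → ℝ) × (Fin d → ℝ) => b q.1 q.2 :=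
    Measurable.lintegral_prod_right' hmeas3
  have half : ∀ x ∈ D, ∀ y ∈ D, ‖W y - W (x + (1/2:ℝ) • (y - x))‖ₑ ≤ 2 * b x y := by
    intro x hx y hy
    have hc : ContDiff ℝ 1 fun t : ℝ => W (x + t • (y - x)) := hW.comp (by fun_prop)
    have h := enorm_sub_le_lintegral_deriv_of_contDiffOn_Icc (a := (1/2:ℝ)) (b := 1)
      hc.contDiffOn (by norm_num)
    have e1 : x + (1:ℝ) • (y - x) = y := by rw [one_smul]; abel
    rw [e1] at h
    refine h.trans ?_
    rw [hb]
    simp only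
    rw [← lintegral_const_mul (f := fun t : ℝ => G (x + t • (y - x))) _ (hG.comp (by fun_prop))]
    refine setLIntegral_mono' measurableSet_Icc fun t ht => ?_
    have hmem : x + t • (y - x) ∈ D := by
      have := hDc hx hy (a := 1 - t) (b := t) (by linarith [ht.2]) (by linarith [ht.1]) (by ring)
      convert this using 1
      ext i; simp; ring
    have hG1 : G (x + t • (y - x)) = ‖fderiv ℝ W (x + t • (y - x))‖ₑ := by
      rw [hGdef]; exact Set.indicator_of_mem hmem _
    rw [hG1]
    have hin : HasDerivAt (fun t : ℝ => x + t • (y - x)) (y - x) t := by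
      simpa using ((hasDerivAt_id t).smul_const (y - x)).const_add x
    have hder := ((hW.differentiable (by norm_num) (x + t • (y - x))).hasFDerivAt.comp_hasDerivAt t hin).deriv
    have hder2 : deriv (fun t : ℝ => W (x + t • (y - x))) t =
      fderiv ℝ W (x + t • (y - x)) (y - x) := hder
    rw [hder2]
    rw [← ofReal_norm, ← ofReal_norm]
    rw [show (2:ENNReal) = ENNReal.ofReal 2 by norm_num, ← ENNReal.ofReal_mul (by norm_num)]
    apply ENNReal.ofReal_le_ofReal
    refine (ContinuousLinearMap.le_opNorm _ _).trans ?_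
    rw [mul_comm]
    gcongr
    calc ‖y - x‖ ≤ ‖y‖ + ‖x‖ := norm_sub_le _ _
      _ ≤ 2 := by linarith [hDd x hx, hDd y hy]
  have full : ∀ x ∈ D, ∀ y ∈ D, ‖W x - W y‖ₑ ≤ 2 * b x y + 2 * b y x := by
    intro x hx y hy
    have e : x + (1/2:ℝ) • (y - x) = y + (1/2:ℝ) • (x - y) := by
      ext i; simp; ring
    have h1 := half x hx y hy
    have h2 := half y hy x hx
    rw [← e] at h2
    calc ‖W x - W y‖ₑ = ‖(W x - W (x + (1/2:ℝ) • (y - x))) - (W y - W (x + (1/2:ℝ) • (y - x)))‖ₑ := by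
          congr 1; ring
      _ ≤ _ := (enorm_sub_le).trans (by rw [add_comm]; gcongr)
  have hbint : ∀ x, ∫⁻ y, b x y ≤ 2 ^ d * ∫⁻ z, G z := by
    intro x
    rw [hb]
    simp only
    rw [lintegral_lintegral_swap (Measurable.aemeasurable (by
      exact hG.comp (by fun_prop)))]
    calc ∫⁻ t in Set.Icc (1/2:ℝ) 1, ∫⁻ y, G (x + t • (y - x))
        ≤ ∫⁻ t in Set.Icc (1/2:ℝ) 1, (2 ^ d * ∫⁻ z, G z) :=
          setLIntegral_mono' measurableSet_Icc fun t ht => lintegral_line_le hG x ht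
      _ = (2 ^ d * ∫⁻ z, G z) * volume (Set.Icc (1/2:ℝ) 1) := by rw [setLIntegral_const]
      _ ≤ (2 ^ d * ∫⁻ z, G z) * 1 := by
          gcongr; rw [Real.volume_Icc]; exact ENNReal.ofReal_le_one.2 (by norm_num)
      _ = _ := mul_one _
  have hB1 : ∫⁻ x in A, ∫⁻ y in Z, b x y ≤ volume D * (2 ^ d * ∫⁻ z, G z) := by
    calc ∫⁻ x in A, ∫⁻ y in Z, b x y ≤ ∫⁻ x in A, (2 ^ d * ∫⁻ z, G z) :=
          lintegral_mono fun x => (setLIntegral_le_lintegral _ _).trans (hbint x)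
      _ = (2 ^ d * ∫⁻ z, G z) * volume A := by rw [setLIntegral_const]
      _ ≤ _ := by rw [mul_comm]; gcongr
  have hB2 : ∫⁻ x in A, ∫⁻ y in Z, b y x ≤ volume D * (2 ^ d * ∫⁻ z, G z) := by
    rw [lintegral_lintegral_swap (Measurable.aemeasurable (by
      exact hbm.comp measurable_swap))]
    calc ∫⁻ y in Z, ∫⁻ x in A, b y x ≤ ∫⁻ x in Z, (2 ^ d * ∫⁻ z, G z) :=
          lintegral_mono fun x => (setLIntegral_le_lintegral _ _).trans (hbint x)
      _ = (2 ^ d * ∫⁻ z, G z) * volume Z := by rw [setLIntegral_const]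
      _ ≤ _ := by rw [mul_comm]; gcongr
  have hbm1 : ∀ x, Measurable (b x) := fun x => hbm.comp measurable_prodMk_left
  have hbm2 : ∀ x, Measurable fun y => b y x := fun x => hbm.comp measurable_prodMk_right
  calc δ * volume A * volume Z = ∫⁻ x in A, ∫⁻ y in Z, δ := by
        rw [setLIntegral_const, setLIntegral_const]; ring
    _ ≤ ∫⁻ x in A, ∫⁻ y in Z, (2 * b x y + 2 * b y x) :=
        setLIntegral_mono' hAm fun x hx => setLIntegral_mono' hZm fun y hy =>
          (hδ x hx y hy).trans (full x (hA hx) y (hZ hy))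
    _ = 2 * (∫⁻ x in A, ∫⁻ y in Z, b x y) + 2 * ∫⁻ x in A, ∫⁻ y in Z, b y x := by
        have : ∀ x, ∫⁻ y in Z, (2 * b x y + 2 * b y x) =
            2 * (∫⁻ y in Z, b x y) + 2 * ∫⁻ y in Z, b y x := fun x => by
          rw [lintegral_add_left ((hbm1 x).const_mul 2), lintegral_const_mul _ (hbm1 x),
            lintegral_const_mul _ (hbm2 x)]
        simp_rw [this]
        rw [lintegral_add_left, lintegral_const_mul, lintegral_const_mul]
        · exact Measurable.lintegral_prod_right' (f := fun q : (Fin d → ℝ) × (Fin d → ℝ) => b q.2 q.1)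
            (hbm.comp measurable_swap)
        · exact Measurable.lintegral_prod_right' (f := fun q : (Fin d → ℝ) × (Fin d → ℝ) => b q.1 q.2) hbm
        · exact (Measurable.lintegral_prod_right' (f := fun q : (Fin d → ℝ) × (Fin d → ℝ) => b q.1 q.2) hbm).const_mul 2
    _ ≤ 2 * (volume D * (2 ^ d * ∫⁻ z, G z)) + 2 * (volume D * (2 ^ d * ∫⁻ z, G z)) := by gcongr
    _ = 4 * 2 ^ d * volume D * ∫⁻ z in D, ‖fderiv ℝ W z‖ₑ := by rw [hGi]; ring

/-- Entire solutions of a linear(ized) divergence form uniformly elliptic equation. -/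
structure EllSol {d : ℕ} (lam M : ℝ) (v : (Fin d → ℝ) → ℝ) (J : Fin d → (Fin d → ℝ) → ℝ) :
    Prop where
  cv : ContDiff ℝ 1 v
  cJ : ∀ i, ContDiff ℝ 1 (J i)
  div0 : ∀ y, ∑ i, pder i (J i) y = 0
  hel : ∀ y, lam * gsq v y ≤ ∑ i, J i y * pder i v y
  hbd : ∀ y, ∑ i, (J i y) ^ 2 ≤ M ^ 2 * gsq v y

lemma subPair_log {d : ℕ} {lam M : ℝ} (hlam : 0 < lam) {v : (Fin d → ℝ) → ℝ}
    {J : Fin d → (Fin d → ℝ) → ℝ} (H : EllSol lam M v J) (h1 : ∀ y, v y ≤ 1) {ε : ℝ} (hε : 0 < ε) :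
    SubPair lam M (fun y => -Real.log (1 + ε - v y)) (fun i y => J i y * (1 + ε - v y)⁻¹) := by
  have hs : ∀ y, 0 < 1 + ε - v y := fun y => by linarith [h1 y]
  have hdv : Differentiable ℝ v := H.cv.differentiable (by norm_num)
  have dg : ∀ y, HasDerivAt (fun t : ℝ => -Real.log (1 + ε - t)) ((1 + ε - v y)⁻¹) (v y) := fun y => by
    have := (((hasDerivAt_id (v y)).const_sub (1 + ε)).log (hs y).ne').fun_neg
    simpa [neg_div] using this
  have di : ∀ y, HasDerivAt (fun t : ℝ => (1 + ε - t)⁻¹) (((1 + ε - v y)⁻¹) ^ 2) (v y) := fun y => by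
    have := (((hasDerivAt_id (v y)).const_sub (1 + ε)).fun_inv (hs y).ne')
    simpa [neg_div] using this
  have pW : ∀ i y, pder i (fun y => -Real.log (1 + ε - v y)) y = (1 + ε - v y)⁻¹ * pder i v y := by
    intro i y
    rw [pder_comp (g := fun t : ℝ => -Real.log (1 + ε - t)) i (dg y).differentiableAt (hdv y), (dg y).deriv]
  have pS : ∀ i y, pder i (fun y => (1 + ε - v y)⁻¹) y = ((1 + ε - v y)⁻¹) ^ 2 * pder i v y := by
    intro i y
    rw [pder_comp (g := fun t : ℝ => (1 + ε - t)⁻¹) i (di y).differentiableAt (hdv y), (di y).deriv]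
  have cS : ContDiff ℝ 1 (fun y => (1 + ε - v y)⁻¹) :=
    (contDiff_const.sub H.cv).inv fun y => (hs y).ne'
  have gW : ∀ y, gsq (fun y => -Real.log (1 + ε - v y)) y = ((1 + ε - v y)⁻¹) ^ 2 * gsq v y := by
    intro y
    unfold gsq
    simp_rw [pW, mul_pow]
    rw [Finset.mul_sum]
  refine ⟨((contDiff_const.sub H.cv).log fun y => (hs y).ne').neg, fun i => (H.cJ i).mul cS, ?_, ?_, ?_⟩
  · intro y
    have e : ∀ i, pder i (fun y => J i y * (1 + ε - v y)⁻¹) y =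
        ((1 + ε - v y)⁻¹) ^ 2 * (J i y * pder i v y) + (1 + ε - v y)⁻¹ * pder i (J i) y := by
      intro i
      rw [pder_mul (g := fun y => (1 + ε - v y)⁻¹) i ((H.cJ i).differentiable (by norm_num) y)
        (cS.differentiable (by norm_num) y), pS]
      ring
    simp_rw [e]
    rw [Finset.sum_add_distrib, ← Finset.mul_sum, ← Finset.mul_sum, H.div0, gW]
    have := mul_le_mul_of_nonneg_left (H.hel y) (sq_nonneg ((1 + ε - v y)⁻¹))
    linarith
  · intro y
    have e : ∀ i, J i y * (1 + ε - v y)⁻¹ * pder i (fun y => -Real.log (1 + ε - v y)) y =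
        ((1 + ε - v y)⁻¹) ^ 2 * (J i y * pder i v y) := fun i => by rw [pW]; ring
    simp_rw [e]
    rw [← Finset.mul_sum]
    have := H.hel y
    have := mul_nonneg hlam.le (gsq_nonneg v y)
    exact mul_nonneg (sq_nonneg _) (by linarith)
  · intro y
    rw [gW]
    simp_rw [mul_pow]
    rw [← Finset.sum_mul]
    have := mul_le_mul_of_nonneg_left (H.hbd y) (sq_nonneg ((1 + ε - v y)⁻¹))
    linarith

lemma convex_esq_lt {d : ℕ} : Convex ℝ {y : Fin d → ℝ | esq y < 1} := by
  intro x hx y hy a b ha hb hab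
  simp only [Set.mem_ofPred_eq] at *
  have h : esq (a • x + b • y) ≤ a * esq x + b * esq y := by
    unfold esq
    rw [Finset.mul_sum, Finset.mul_sum, ← Finset.sum_add_distrib]
    refine Finset.sum_le_sum fun i _ => ?_
    simp only [Pi.add_apply, Pi.smul_apply, smul_eq_mul]
    have : a = 1 - b := by linarith
    subst this
    nlinarith [mul_nonneg ha hb, sq_nonneg (x i - y i), mul_nonneg (mul_nonneg ha hb) (sq_nonneg (x i - y i))]
  rcases eq_or_lt_of_le ha with h0 | h0
  · have : b = 1 := by linarith
    subst this; subst h0; linarith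
  · nlinarith

lemma norm_le_of_esq {d : ℕ} {y : Fin d → ℝ} {a : ℝ} (ha : 0 ≤ a) (h : esq y ≤ a ^ 2) : ‖y‖ ≤ a := by
  rw [pi_norm_le_iff_of_nonneg ha]
  intro i
  have h1 : (y i) ^ 2 ≤ esq y :=
    Finset.single_le_sum (f := fun i => (y i) ^ 2) (fun _ _ => sq_nonneg _) (Finset.mem_univ i)
  exact abs_le_of_sq_le_sq (h1.trans h) ha

lemma decay {d : ℕ} (hd : 2 ≤ d) {lam M : ℝ} (hlam : 0 < lam) (hM : 0 < M) :
    ∃ δ > 0, ∀ (v : (Fin d → ℝ) → ℝ) (J : Fin d → (Fin d → ℝ) → ℝ), EllSol lam M v J →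
      (∀ y, v y ≤ 1) →
      volume.real {y : Fin d → ℝ | esq y < 1} / 2 ≤ volume.real {y | esq y < 1 ∧ v y ≤ 1 / 2} →
      ∀ y, esq y < 1 / 4 → v y ≤ 1 - δ := by
  obtain ⟨ε0, hε0, hsup⟩ := sup_bound hd hlam hM
  obtain ⟨c, hc1, hcut⟩ := exists_cutoff
  obtain ⟨ζ, hζ, hζc, hζ0, hζ1, hζr, hζR, hζg, hζg0⟩ := hcut d 1 2 one_pos one_lt_two
  set D : Set (Fin d → ℝ) := {y | esq y < 1} with hD
  have hDo : IsOpen D := isOpen_lt continuous_esq continuous_const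
  have hDf : volume D < ⊤ := by have := vol_esq_lt_top (d := d) 1; simpa [hD] using this
  set m := volume.real D with hm
  have hm0 : 0 < m := ENNReal.toReal_pos
    (hDo.measure_pos volume ⟨0, by simp [hD, esq]⟩).ne' hDf.ne
  set E := 4 * M ^ 2 / lam ^ 2 * ∫ y, 1 * gsq ζ y with hE
  have hE0 : 0 ≤ E := by
    have : 0 ≤ ∫ y, 1 * gsq ζ y := integral_nonneg fun y => by simpa using gsq_nonneg ζ y
    positivity
  set Q := 8 * 2 ^ d * (E + d * m) with hQ
  have hQ0 : 0 ≤ Q := by positivity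
  set k0 := Real.log 2 + Q / ε0 + 1 with hk0
  refine ⟨Real.exp (-(k0 + 1)), Real.exp_pos _, fun v J H hv1 hZ y hy => ?_⟩
  suffices hh : ∀ ε > 0, v y ≤ 1 - Real.exp (-(k0 + 1)) + ε from le_of_forall_pos_le_add hh
  intro ε hε
  have hs : ∀ y, 0 < 1 + ε - v y := fun y => by linarith [hv1 y]
  have HS := subPair_log hlam H hv1 hε
  set W : (Fin d → ℝ) → ℝ := fun y => -Real.log (1 + ε - v y) with hW
  set Z : Set (Fin d → ℝ) := {y | esq y < 1 ∧ v y ≤ 1 / 2} with hZd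
  set A := lev W k0 1 with hA
  have hen := caccioppoli hlam hM HS (h := fun _ => 1) contDiff_const (fun _ => zero_le_one)
    (fun t => by simp) hζ hζc
  simp only [mul_one] at hen
  have iE : Integrable (fun y => ζ y ^ 2 * gsq W y) := by
    refine Continuous.integrable_of_hasCompactSupport
      ((hζ.continuous.pow 2).mul (continuous_gsq HS.cW)) ?_
    refine hζc.mono fun y hy => ?_
    simp only [mem_support] at hy ⊢
    intro h0; apply hy; rw [h0]; simp
  have hgrad : ∫⁻ z in D, ‖fderiv ℝ W z‖ₑ ≤ ENNReal.ofReal (E + d * m) := by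
    calc ∫⁻ z in D, ‖fderiv ℝ W z‖ₑ
        ≤ ∫⁻ z in D, (ENNReal.ofReal (ζ z ^ 2 * gsq W z) + ENNReal.ofReal d) := by
          refine setLIntegral_mono' hDo.measurableSet fun z hz => ?_
          rw [← ofReal_norm, ← ENNReal.ofReal_add
            (mul_nonneg (sq_nonneg _) (gsq_nonneg _ _)) (by positivity)]
          apply ENNReal.ofReal_le_ofReal
          have : ζ z = 1 := hζr z (by have : esq z < 1 := hz; linarith)
          rw [this, one_pow, one_mul]
          refine (norm_fderiv_le W z).trans ?_
          have : ∀ i ∈ Finset.univ, |pder i W z| ≤ (pder i W z) ^ 2 + 1 := fun i _ => by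
            have h1 := sq_abs (pder i W z)
            nlinarith [sq_nonneg (|pder i W z| - 1), abs_nonneg (pder i W z)]
          refine (Finset.sum_le_sum this).trans (le_of_eq ?_)
          rw [Finset.sum_add_distrib]; simp [gsq]
      _ = (∫⁻ z in D, ENNReal.ofReal (ζ z ^ 2 * gsq W z)) + ENNReal.ofReal d * volume D := by
          rw [lintegral_add_right _ measurable_const, setLIntegral_const]
      _ ≤ (∫⁻ z, ENNReal.ofReal (ζ z ^ 2 * gsq W z)) + ENNReal.ofReal d * volume D := by
          gcongr; exact Measure.restrict_le_self
      _ = ENNReal.ofReal (∫ z, ζ z ^ 2 * gsq W z) + ENNReal.ofReal (d * m) := by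
          rw [ofReal_integral_eq_lintegral_ofReal iE (Eventually.of_forall fun z =>
            mul_nonneg (sq_nonneg _) (gsq_nonneg _ _)), ENNReal.ofReal_mul (by positivity), hm,
            ofReal_measureReal hDf.ne]
      _ ≤ ENNReal.ofReal (E + d * m) := by
          rw [ENNReal.ofReal_add hE0 (by positivity)]
          gcongr
  have hAD : A ⊆ D := fun z hz => by have := hz.1; simpa [hD] using this
  have hZD : Z ⊆ D := fun z hz => hz.1
  have hAm : MeasurableSet A := (isOpen_lev HS.cW.continuous k0 1).measurableSet
  have hZm : MeasurableSet Z := hDo.measurableSet.inter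
    (isClosed_le H.cv.continuous continuous_const).measurableSet
  have hkey := poincare_cheb HS.cW hDo.measurableSet convex_esq_lt
    (fun x hx => norm_le_of_esq zero_le_one (by have : esq x < 1 := hx; linarith)) hAm hZm hAD hZD
    (ENNReal.ofReal (k0 - Real.log 2)) (fun x hx z hz => by
      rw [← ofReal_norm]
      apply ENNReal.ofReal_le_ofReal
      have h1 : k0 < W x := hx.2
      have h2 : W z ≤ Real.log 2 := by
        simp only [hW]
        rw [← Real.log_inv]
        refine Real.log_le_log (inv_pos.2 (hs z)) ?_
        rw [inv_le_comm₀ (hs z) (by norm_num)]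
        have := hz.2
        norm_num at this ⊢; linarith
      rw [Real.norm_eq_abs]
      exact le_trans (by linarith) (le_abs_self _))
  have hAf : volume A ≠ ⊤ := (vol_lev_lt_top _ _ _).ne
  have hZf : volume Z ≠ ⊤ := (lt_of_le_of_lt (measure_mono hZD) hDf).ne
  have hkl : 0 ≤ k0 - Real.log 2 := by rw [hk0]; have : 0 ≤ Q / ε0 := by positivity
                                       linarith
  have hreal : (k0 - Real.log 2) * volume.real A * volume.real Z ≤ 4 * 2 ^ d * m * (E + d * m) := by
    have h := hkey.trans (mul_le_mul_right hgrad _)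
    rw [← ofReal_measureReal hAf, ← ofReal_measureReal hZf, ← ofReal_measureReal hDf.ne,
      ← ENNReal.ofReal_mul hkl, ← ENNReal.ofReal_mul (by positivity),
      show (4:ENNReal) * 2 ^ d = ENNReal.ofReal (4 * 2 ^ d) by
        rw [ENNReal.ofReal_mul (by norm_num), ENNReal.ofReal_pow (by norm_num)]; norm_num,
      ← ENNReal.ofReal_mul (by positivity), ← ENNReal.ofReal_mul (by positivity)] at h
    exact (ENNReal.ofReal_le_ofReal_iff (by positivity)).1 h
  have hAs : volume.real A ≤ ε0 := by
    have hA0 : 0 ≤ volume.real A := measureReal_nonneg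
    have h1 : (k0 - Real.log 2) * volume.real A * (m / 2) ≤ 4 * 2 ^ d * m * (E + d * m) :=
      le_trans (mul_le_mul_of_nonneg_left hZ (by positivity)) hreal
    have h2 : (k0 - Real.log 2) * volume.real A ≤ Q := by
      rw [hQ]
      by_contra hc
      push Not at hc
      nlinarith
    have h3 : (k0 - Real.log 2) = Q / ε0 + 1 := by rw [hk0]; ring
    rw [h3] at h2
    by_contra hc
    push Not at hc
    have h4 : (Q / ε0 + 1) * ε0 = Q + ε0 := by field_simp
    have : 0 < Q / ε0 + 1 := by positivity
    nlinarith
  have hfin := hsup W _ HS k0 hAs y hy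
  have : Real.exp (-(k0 + 1)) ≤ 1 + ε - v y := by
    rw [← Real.exp_log (hs y)]
    apply Real.exp_le_exp.2
    simp only [hW] at hfin; linarith
  linarith

lemma pder_comp_clm {d e : ℕ} {f : (Fin d → ℝ) → ℝ} (hf : ContDiff ℝ 1 f)
    (L : (Fin e → ℝ) →L[ℝ] (Fin d → ℝ)) (i : Fin e) (y : Fin e → ℝ) :
    pder i (fun z => f (L z)) y = fderiv ℝ f (L y) (L (Pi.single i 1)) := by
  unfold pder
  have := (hf.differentiable (by norm_num) (L y)).hasFDerivAt.comp y L.hasFDerivAt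
  have h2 : HasFDerivAt (fun z => f (L z)) ((fderiv ℝ f (L y)).comp L) y := this
  rw [h2.fderiv]; rfl

lemma pder_scale {d : ℕ} {f : (Fin d → ℝ) → ℝ} (hf : ContDiff ℝ 1 f) (R : ℝ) (i : Fin d)
    (y : Fin d → ℝ) : pder i (fun z => f (R • z)) y = R * pder i f (R • y) := by
  have := pder_comp_clm hf (R • ContinuousLinearMap.id ℝ (Fin d → ℝ)) i y
  simpa [pder] using this

lemma pder_const_mul {d : ℕ} {f : (Fin d → ℝ) → ℝ} (hf : ContDiff ℝ 1 f) (a : ℝ) (i : Fin d)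
    (y : Fin d → ℝ) : pder i (fun z => a * f z) y = a * pder i f y := by
  unfold pder
  rw [fderiv_const_mul (hf.differentiable (by norm_num) y)]; simp

lemma pder_add_const {d : ℕ} (f : (Fin d → ℝ) → ℝ) (b : ℝ) (i : Fin d)
    (y : Fin d → ℝ) : pder i (fun z => f z + b) y = pder i f y := by
  unfold pder
  rw [fderiv_add_const]

lemma EllSol.scale {d : ℕ} {lam M : ℝ} {v : (Fin d → ℝ) → ℝ} {J : Fin d → (Fin d → ℝ) → ℝ}
    (H : EllSol lam M v J) (a b R : ℝ) :
    EllSol lam M (fun y => a * v (R • y) + b) (fun i y => (a * R) * J i (R • y)) := by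
  have cs : ContDiff ℝ 1 fun y : Fin d → ℝ => R • y := by fun_prop
  have cvR : ContDiff ℝ 1 (fun y => v (R • y)) := H.cv.comp cs
  have cJR : ∀ i, ContDiff ℝ 1 (fun y => J i (R • y)) := fun i => (H.cJ i).comp cs
  have pv : ∀ i y, pder i (fun y => a * v (R • y) + b) y = a * R * pder i v (R • y) := fun i y => by
    rw [pder_add_const, pder_const_mul cvR, pder_scale H.cv]; ring
  have pJ : ∀ i j y, pder i (fun y => (a * R) * J j (R • y)) y = a * R * (R * pder i (J j) (R • y)) :=
    fun i j y => by rw [pder_const_mul (cJR j), pder_scale (H.cJ j)]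
  have gv : ∀ y, gsq (fun y => a * v (R • y) + b) y = (a * R) ^ 2 * gsq v (R • y) := fun y => by
    unfold gsq
    simp_rw [pv, mul_pow _ (pder _ v _)]; rw [Finset.mul_sum]
  refine ⟨(contDiff_const.mul cvR).add contDiff_const, fun i => contDiff_const.mul (cJR i), ?_, ?_, ?_⟩
  · intro y
    simp_rw [pJ]
    rw [← Finset.mul_sum, ← Finset.mul_sum, H.div0]; simp
  · intro y
    rw [gv]
    have e : ∀ i, (a * R) * J i (R • y) * pder i (fun y => a * v (R • y) + b) y =
      (a * R) ^ 2 * (J i (R • y) * pder i v (R • y)) := fun i => by rw [pv]; ring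
    simp_rw [e]
    rw [← Finset.mul_sum]
    have := mul_le_mul_of_nonneg_left (H.hel (R • y)) (sq_nonneg (a * R))
    linarith
  · intro y
    rw [gv]
    simp_rw [mul_pow _ (J _ _)]
    rw [← Finset.mul_sum]
    have := mul_le_mul_of_nonneg_left (H.hbd (R • y)) (sq_nonneg (a * R))
    linarith

lemma liouville_two {d : ℕ} (hd : 2 ≤ d) {lam M : ℝ} (hlam : 0 < lam) (hM : 0 < M)
    {v : (Fin d → ℝ) → ℝ} {J : Fin d → (Fin d → ℝ) → ℝ} (H : EllSol lam M v J)
    {B : ℝ} (hB : ∀ y, |v y| ≤ B) (x y : Fin d → ℝ) : v x = v y := by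
  obtain ⟨δ, hδ, hdec⟩ := decay hd hlam hM
  have hba : BddAbove (Set.range v) := ⟨B, by rintro _ ⟨z, rfl⟩; exact (abs_le.1 (hB z)).2⟩
  have hbb : BddBelow (Set.range v) := ⟨-B, by rintro _ ⟨z, rfl⟩; exact (abs_le.1 (hB z)).1⟩
  set S := ⨆ z, v z with hS
  set m := ⨅ z, v z with hm
  have hSv : ∀ z, v z ≤ S := fun z => le_ciSup hba z
  have hmv : ∀ z, m ≤ v z := fun z => ciInf_le hbb z
  rcases (le_trans (hmv x) (hSv x)).eq_or_lt with heq | hlt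
  · have h1 := hSv x; have h2 := hmv x; have h3 := hSv y; have h4 := hmv y
    linarith
  exfalso
  have hg : 0 < S - m := by linarith
  have hgδ : 0 < δ * (S - m) := by positivity
  obtain ⟨y0, hy0⟩ := exists_lt_of_lt_ciSup (show S - δ * (S - m) < ⨆ z, v z by rw [← hS]; linarith)
  obtain ⟨y1, hy1⟩ := exists_lt_of_ciInf_lt (show ⨅ z, v z < m + δ * (S - m) by rw [← hm]; linarith)
  set R : ℝ := 2 * (1 + esq y0 + esq y1) with hR
  have he0 := esq_nonneg y0
  have he1 := esq_nonneg y1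
  have hR0 : 0 < R := by positivity
  have hes : ∀ (c : ℝ) (z : Fin d → ℝ), esq (c • z) = c ^ 2 * esq z := fun c z => by
    unfold esq; rw [Finset.mul_sum]
    exact Finset.sum_congr rfl fun i _ => by simp [mul_pow]
  have hsm : ∀ z, esq z ≤ esq y0 + esq y1 → esq (R⁻¹ • z) < 1 / 4 := fun z hz => by
    rw [hes, inv_pow, inv_mul_lt_iff₀ (by positivity), hR]
    nlinarith
  have hsb : ∀ z : Fin d → ℝ, R • (R⁻¹ • z) = z := fun z => smul_inv_smul₀ hR0.ne' z
  set u1 : (Fin d → ℝ) → ℝ := fun y => (1 / (S - m)) * v (R • y) + (-m / (S - m)) with hu1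
  set u2 : (Fin d → ℝ) → ℝ := fun y => (-1 / (S - m)) * v (R • y) + (S / (S - m)) with hu2
  have H1 := H.scale (1 / (S - m)) (-m / (S - m)) R
  have H2 := H.scale (-1 / (S - m)) (S / (S - m)) R
  have e1 : ∀ z, u1 z = (v (R • z) - m) / (S - m) := fun z => by simp only [hu1]; ring
  have e2 : ∀ z, u2 z = (S - v (R • z)) / (S - m) := fun z => by simp only [hu2]; ring
  have e12 : ∀ z, u1 z + u2 z = 1 := fun z => by
    rw [e1, e2, ← add_div, div_eq_one_iff_eq hg.ne']; ring
  have b1 : ∀ z, u1 z ≤ 1 := fun z => by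
    rw [e1, div_le_one hg]; linarith [hSv (R • z)]
  have b2 : ∀ z, u2 z ≤ 1 := fun z => by
    rw [e2, div_le_one hg]; linarith [hmv (R • z)]
  set D : Set (Fin d → ℝ) := {y | esq y < 1} with hD
  have hDf : volume D < ⊤ := by have := vol_esq_lt_top (d := d) 1; simpa [hD] using this
  have hcov : volume.real D ≤ volume.real {y | esq y < 1 ∧ u1 y ≤ 1 / 2} +
      volume.real {y | esq y < 1 ∧ u2 y ≤ 1 / 2} := by
    refine le_trans (measureReal_mono ?_ ?_) (measureReal_union_le _ _)
    · intro z hz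
      rcases le_total (u1 z) (1/2) with h | h
      · exact Or.inl ⟨hz, h⟩
      · exact Or.inr ⟨hz, by linarith [e12 z]⟩
    · refine (lt_of_le_of_lt (measure_mono ?_) hDf).ne
      rintro z (hz | hz) <;> exact hz.1
  rcases le_total (volume.real D / 2) (volume.real {y | esq y < 1 ∧ u1 y ≤ 1 / 2}) with h | h
  · have := hdec u1 _ H1 b1 h (R⁻¹ • y0) (hsm y0 (by linarith))
    rw [e1, hsb, div_le_iff₀ hg] at this
    nlinarith
  · have := hdec u2 _ H2 b2 (by linarith) (R⁻¹ • y1) (hsm y1 (by linarith))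
    rw [e2, hsb, div_le_iff₀ hg] at this
    nlinarith

lemma liouville {d : ℕ} {lam M : ℝ} (hlam : 0 < lam) (hM : 0 < M)
    {v : (Fin d → ℝ) → ℝ} {J : Fin d → (Fin d → ℝ) → ℝ} (H : EllSol lam M v J)
    {B : ℝ} (hB : ∀ y, |v y| ≤ B) (x y : Fin d → ℝ) : v x = v y := by
  set L : (Fin (d + 2) → ℝ) →L[ℝ] (Fin d → ℝ) :=
    ContinuousLinearMap.pi fun i => ContinuousLinearMap.proj (Fin.castAdd 2 i) with hL
  have hLa : ∀ z i, L z i = z (Fin.castAdd 2 i) := fun z i => rfl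
  have L1 : ∀ i : Fin d, L (Pi.single (Fin.castAdd 2 i) 1) = Pi.single i 1 := fun i => by
    ext j; rw [hLa]; simp [Pi.single_apply]
  have L2 : ∀ i : Fin 2, L (Pi.single (Fin.natAdd d i) 1) = 0 := fun i => by
    ext j; rw [hLa]
    have : Fin.castAdd 2 j ≠ Fin.natAdd d i := by
      intro h; have := congrArg Fin.val h; simp at this; omega
    simp [Pi.single_apply, this]
  have p1 : ∀ (f : (Fin d → ℝ) → ℝ), ContDiff ℝ 1 f → ∀ (i : Fin d) z,
      pder (Fin.castAdd 2 i) (fun z => f (L z)) z = pder i f (L z) := fun f hf i z => by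
    rw [pder_comp_clm hf, L1]; rfl
  have p2 : ∀ (f : (Fin d → ℝ) → ℝ), ContDiff ℝ 1 f → ∀ (i : Fin 2) z,
      pder (Fin.natAdd d i) (fun z => f (L z)) z = 0 := fun f hf i z => by
    rw [pder_comp_clm hf, L2]; simp
  set J' : Fin (d + 2) → (Fin (d + 2) → ℝ) → ℝ :=
    Fin.addCases (fun i z => J i (L z)) (fun _ _ => 0) with hJ'
  have j1 : ∀ i : Fin d, J' (Fin.castAdd 2 i) = fun z => J i (L z) := fun i => by
    rw [hJ']; exact Fin.addCases_left i
  have j2 : ∀ i : Fin 2, J' (Fin.natAdd d i) = fun z => 0 := fun i => by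
    rw [hJ']; exact Fin.addCases_right i
  have gv : ∀ z, gsq (fun z => v (L z)) z = gsq v (L z) := fun z => by
    unfold gsq
    rw [Fin.sum_univ_add]
    simp_rw [p1 v H.cv, p2 v H.cv]; simp
  have H' : EllSol lam M (fun z => v (L z)) J' := by
    refine ⟨H.cv.comp L.contDiff, fun i => ?_, fun z => ?_, fun z => ?_, fun z => ?_⟩
    · refine Fin.addCases (fun i => ?_) (fun i => ?_) i
      · rw [j1]; exact (H.cJ i).comp L.contDiff
      · rw [j2]; exact contDiff_const
    · rw [Fin.sum_univ_add]
      simp_rw [j1, j2, p1 _ (H.cJ _), H.div0]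
      simp [pder]
    · rw [gv, Fin.sum_univ_add]
      simp_rw [j1, j2, p1 v H.cv]
      simpa using H.hel (L z)
    · rw [gv, Fin.sum_univ_add]
      simp_rw [j1, j2]
      simpa using H.hbd (L z)
  have hsurj : ∀ x : Fin d → ℝ, ∃ z, L z = x := fun x =>
    ⟨Fin.addCases x (fun _ => 0), by ext i; rw [hLa]; simp⟩
  obtain ⟨x', rfl⟩ := hsurj x
  obtain ⟨y', rfl⟩ := hsurj y
  exact liouville_two (by omega) hlam hM H' (B := B) (fun z => hB (L z)) x' y'

lemma ZPer.pder {d : ℕ} {f : (Fin d → ℝ) → ℝ} (hf : ZPer f) (i : Fin d) : ZPer (pder i f) := by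
  intro x k
  have e : f = fun z => f (z + fun i => (k i : ℝ)) := by
    ext z; exact (hf z k).symm
  have h2 : fderiv ℝ (fun z => f (z + fun i => (k i : ℝ))) x =
    fderiv ℝ f (x + fun i => (k i : ℝ)) := fderiv_comp_add_right _
  unfold _root_.pder
  rw [← e] at h2
  rw [h2]; rfl

lemma SmoothV.pder {d : ℕ} {V : (Fin d → ℝ) → (Fin d → ℝ) → ℝ} (hV : SmoothV V) (i : Fin d) :
    SmoothV fun x => pder i (V x) := by
  obtain ⟨h1, h2, h3⟩ := hV
  refine ⟨?_, fun y x k => ?_, fun x => (h3 x).pder i⟩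
  · have e : (uncurry fun x => _root_.pder i (V x)) = fun q : (Fin d → ℝ) × (Fin d → ℝ) =>
        fderiv ℝ (uncurry V) q (0, Pi.single i 1) := by
      ext ⟨x, y⟩
      simp only [uncurry, _root_.pder]
      have hin : HasFDerivAt (fun y : Fin d → ℝ => (x, y))
        (ContinuousLinearMap.inr ℝ (Fin d → ℝ) (Fin d → ℝ)) y := hasFDerivAt_prodMk_right x y
      have hd : HasFDerivAt (uncurry V) (fderiv ℝ (uncurry V) (x, y)) (x, y) :=
        (h1.differentiable (by simp) (x, y)).hasFDerivAt
      have h := hd.comp y hin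
      have h' : HasFDerivAt (V x) ((fderiv ℝ (uncurry V) (x, y)).comp
        (ContinuousLinearMap.inr ℝ (Fin d → ℝ) (Fin d → ℝ))) y := h
      rw [h'.fderiv]
      simp
    rw [e]
    exact (h1.fderiv_right (m := (⊤ : ℕ∞)) (by simp)).clm_apply contDiff_const
  · have : V (fun i => x i + (k i : ℝ)) = V x := by
      ext z; exact h2 z x k
    simp only [this]

/-- reduction mod ℤ^d -/
lemma exists_rep {d : ℕ} (x : Fin d → ℝ) : ∃ k : Fin d → ℤ,
    (fun i => x i + (k i : ℝ)) ∈ Set.Icc (0 : Fin d → ℝ) 1 := by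
  refine ⟨fun i => -⌊x i⌋, ?_, ?_⟩
  · intro i; simp only [Pi.zero_apply]; push_cast; have := Int.floor_le (x i); linarith
  · intro i; simp only [Pi.one_apply]; push_cast; have := Int.lt_floor_add_one (x i); linarith

lemma SmoothV.bounded {d : ℕ} {V : (Fin d → ℝ) → (Fin d → ℝ) → ℝ} (hV : SmoothV V) :
    ∃ G : ℝ, 0 ≤ G ∧ ∀ x y, |V x y| ≤ G := by
  obtain ⟨h1, h2, h3⟩ := hV
  obtain ⟨G, hG⟩ := ((isCompact_Icc (a := (0 : Fin d → ℝ)) (b := 1)).prod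
    (isCompact_Icc (a := (0 : Fin d → ℝ)) (b := 1))).exists_bound_of_continuousOn
    (f := uncurry V) h1.continuous.continuousOn
  have h : ∀ x y, |V x y| ≤ G := fun x y => by
    obtain ⟨k, hk⟩ := exists_rep x
    obtain ⟨l, hl⟩ := exists_rep y
    have e1 : V x y = V (fun i => x i + (k i : ℝ)) y := (h2 y x k).symm
    rw [e1, ← h3 _ y l]
    exact hG (_, _) (Set.mk_mem_prod hk hl)
  exact ⟨G, (abs_nonneg _).trans (h 0 0), h⟩

lemma SmoothV.contDiff {d : ℕ} {V : (Fin d → ℝ) → (Fin d → ℝ) → ℝ} (hV : SmoothV V)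
    (x : Fin d → ℝ) : ContDiff ℝ 1 (V x) := by
  have : V x = uncurry V ∘ fun y => (x, y) := rfl
  rw [this]
  exact (hV.1.of_le (by exact_mod_cast le_top)).comp (contDiff_const.prodMk contDiff_id)

lemma contDiff_pder {d : ℕ} {w : (Fin d → ℝ) → ℝ} (hw : ContDiff ℝ 2 w) (i : Fin d) :
    ContDiff ℝ 1 (pder i w) := by
  unfold pder
  exact (hw.fderiv_right (m := 1) (by norm_num)).clm_apply contDiff_const

lemma pder_add {d : ℕ} {f g : (Fin d → ℝ) → ℝ} {y : Fin d → ℝ} (i : Fin d)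
    (hf : DifferentiableAt ℝ f y) (hg : DifferentiableAt ℝ g y) :
    pder i (fun z => f z + g z) y = pder i f y + pder i g y := by
  unfold pder
  rw [fderiv_fun_add hf hg]; simp

lemma pder_sub {d : ℕ} {f g : (Fin d → ℝ) → ℝ} {y : Fin d → ℝ} (i : Fin d)
    (hf : DifferentiableAt ℝ f y) (hg : DifferentiableAt ℝ g y) :
    pder i (fun z => f z - g z) y = pder i f y - pder i g y := by
  unfold pder
  rw [fderiv_fun_sub hf hg]; simp

lemma pder_sum {d n : ℕ} {f : Fin n → (Fin d → ℝ) → ℝ} {y : Fin d → ℝ} (i : Fin d)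
    (hf : ∀ l, DifferentiableAt ℝ (f l) y) :
    pder i (fun z => ∑ l, f l z) y = ∑ l, pder i (f l) y := by
  unfold pder
  rw [fderiv_fun_sum fun l _ => hf l]; simp

/-- Expansion of the divergence form operator. -/
lemma div_formula {d : ℕ} {p : Fin d → (Fin d → ℝ) → ℝ} (hp : ∀ i, ContDiff ℝ 1 (p i))
    {U : (Fin d → ℝ) → ℝ} (hU : ContDiff ℝ 1 U) (y : Fin d → ℝ) :
    ∑ i, pder i (fun z => Real.exp ((∑ l, (p l z) ^ 2) / 2 + U z) * p i z) y =
      Real.exp ((∑ l, (p l y) ^ 2) / 2 + U y) *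
        (∑ i, pder i (p i) y + ∑ i, ∑ l, p i y * p l y * pder i (p l) y +
          ∑ i, p i y * pder i U y) := by
  set ex : (Fin d → ℝ) → ℝ := fun z => (∑ l, (p l z) ^ 2) / 2 + U z with hex
  have hsq : ∀ l, ContDiff ℝ 1 fun z => (p l z) ^ 2 := fun l => (hp l).pow 2
  have hs : ContDiff ℝ 1 fun z => ∑ l, (p l z) ^ 2 := ContDiff.sum fun l _ => hsq l
  have hs2 : ContDiff ℝ 1 fun z => (∑ l, (p l z) ^ 2) / 2 := hs.div_const 2
  have hexc : ContDiff ℝ 1 ex := hs2.add hU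
  have dif : ∀ {f : (Fin d → ℝ) → ℝ}, ContDiff ℝ 1 f → ∀ y, DifferentiableAt ℝ f y :=
    fun hf y => hf.differentiable (by norm_num) y
  have pex : ∀ i, pder i ex y = ∑ l, p l y * pder i (p l) y + pder i U y := by
    intro i
    rw [hex, pder_add i (dif hs2 y) (dif hU y)]
    congr 1
    have e : (fun z => (∑ l, (p l z) ^ 2) / 2) = fun z => (1/2) * ∑ l, (p l z * p l z) := by
      ext z; simp_rw [pow_two]; ring
    rw [e, pder_const_mul (ContDiff.sum fun l _ => (hp l).mul (hp l)),
      pder_sum i fun l => dif ((hp l).mul (hp l)) y]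
    simp_rw [fun l => pder_mul i (dif (hp l) y) (dif (hp l) y)]
    rw [Finset.mul_sum]
    exact Finset.sum_congr rfl fun l _ => by ring
  have hE : ContDiff ℝ 1 fun z => Real.exp (ex z) := hexc.exp
  have pE : ∀ i, pder i (fun z => Real.exp (ex z)) y = Real.exp (ex y) * pder i ex y := fun i => by
    rw [pder_comp (g := Real.exp) i Real.differentiableAt_exp (dif hexc y), Real.deriv_exp]
  have e : ∀ i, pder i (fun z => Real.exp (ex z) * p i z) y =
      Real.exp (ex y) * (pder i (p i) y + ∑ l, p i y * p l y * pder i (p l) y +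
        p i y * pder i U y) := fun i => by
    rw [pder_mul (f := fun z => Real.exp (ex z)) i (dif hE y) (dif (hp i) y), pE, pex]
    have e3 : ∑ l, p i y * p l y * pder i (p l) y = p i y * ∑ l, p l y * pder i (p l) y := by
      rw [Finset.mul_sum]; exact Finset.sum_congr rfl fun l _ => by ring
    rw [e3]; ring
  refine (Finset.sum_congr rfl fun i _ => e i).trans ?_
  rw [← Finset.mul_sum, Finset.sum_add_distrib, Finset.sum_add_distrib]

/-- Nondivergence form of the equation. -/
lemma nondiv {d : ℕ} {V : (Fin d → ℝ) → (Fin d → ℝ) → ℝ} (hV : SmoothV V)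
    {x Λ : Fin d → ℝ} {w : (Fin d → ℝ) → ℝ} (hw : ContDiff ℝ 2 w) (hs : DivFormSol V x Λ w)
    (y : Fin d → ℝ) :
    ∑ i, pder i (pder i w) y + ∑ i, ∑ l, (Λ i + pder i w y) * (Λ l + pder l w y) *
      pder i (pder l w) y + ∑ i, (Λ i + pder i w y) * pder i (V x) y = 0 := by
  have h := hs y
  have hp : ∀ i, ContDiff ℝ 1 fun z => Λ i + pder i w z := fun i =>
    contDiff_const.add (contDiff_pder hw i)
  rw [div_formula hp (hV.contDiff x) y] at h
  have h2 := (mul_eq_zero.1 h).resolve_left (Real.exp_pos _).ne'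
  have e : ∀ i l, pder i (fun z => Λ l + pder l w z) y = pder i (pder l w) y := fun i l => by
    have : (fun z => Λ l + pder l w z) = fun z => pder l w z + Λ l := by ext z; ring
    rw [this, pder_add_const]
  simp_rw [e] at h2
  exact h2

lemma hasDerivAt_line {d : ℕ} {f : (Fin d → ℝ) → ℝ} (hf : ContDiff ℝ 1 f) (y ξ : Fin d → ℝ) (s : ℝ) :
    HasDerivAt (fun s : ℝ => f (y + s • ξ)) (∑ i, pder i f (y + s • ξ) * ξ i) s := by
  have hin : HasDerivAt (fun t : ℝ => y + t • ξ) ξ s := by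
    simpa using ((hasDerivAt_id s).smul_const ξ).const_add y
  have h := (hf.differentiable (by norm_num) (y + s • ξ)).hasFDerivAt.comp_hasDerivAt s hin
  have hξ : ξ = ∑ i, ξ i • (Pi.single i (1:ℝ) : Fin d → ℝ) := by
    ext j; simp [Finset.sum_apply, Pi.single_apply]
  have e : ∑ i, pder i f (y + s • ξ) * ξ i = fderiv ℝ f (y + s • ξ) ξ := by
    have e2 : ∀ v : Fin d → ℝ, fderiv ℝ f v (∑ i, ξ i • (Pi.single i (1:ℝ) : Fin d → ℝ)) =
        ∑ i, pder i f v * ξ i := fun v => by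
      rw [map_sum]
      refine Finset.sum_congr rfl fun i _ => ?_
      rw [map_smul, smul_eq_mul, mul_comm]; rfl
    rw [← e2, ← hξ]
  rw [e]; exact h

lemma hasDerivAt_line2 {d : ℕ} {f : (Fin d → ℝ) → ℝ} (hf : ContDiff ℝ 2 f) (y ξ : Fin d → ℝ) (s : ℝ) :
    HasDerivAt (fun s : ℝ => ∑ i, pder i f (y + s • ξ) * ξ i)
      (∑ i, ∑ j, pder j (pder i f) (y + s • ξ) * ξ j * ξ i) s := by
  refine HasDerivAt.fun_sum fun i _ => ?_
  have := (hasDerivAt_line (contDiff_pder hf i) y ξ s).mul_const (ξ i)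
  rw [Finset.sum_mul] at this
  exact this

/-- Second order necessary condition. -/
lemma second_order {φ φ' : ℝ → ℝ} {c : ℝ} (h1 : ∀ᶠ s in 𝓝 0, HasDerivAt φ (φ' s) s)
    (h2 : HasDerivAt φ' c 0) (hmax : IsLocalMax φ 0) : c ≤ 0 := by
  by_contra hc
  push Not at hc
  have e : deriv φ =ᶠ[𝓝 0] φ' := h1.mono fun s hs => hs.deriv
  have h0 : deriv φ 0 = 0 := hmax.deriv_eq_zero
  have hdd : deriv (deriv φ) 0 = c := by rw [e.deriv_eq, h2.deriv]
  have hmin := isLocalMin_of_deriv_deriv_pos (f := φ) (x₀ := 0) (by rw [hdd]; exact hc) h0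
    h1.self_of_nhds.continuousAt
  have hconst : φ =ᶠ[𝓝 0] fun _ => φ 0 := by
    filter_upwards [hmax, hmin] with s hs1 hs2
    exact le_antisymm hs1 hs2
  have hd0 : deriv φ =ᶠ[𝓝 0] fun _ => 0 := by
    have := hconst.deriv
    filter_upwards [this] with s hs
    rw [hs]; simp
  have : deriv (deriv φ) 0 = 0 := by rw [hd0.deriv_eq]; simp
  linarith

lemma form_expand {d : ℕ} (Q : Fin d → Fin d → ℝ) (a b : Fin d → ℝ) :
    ∑ i, ∑ j, Q i j * (a - b) j * (a - b) i = 2 * (∑ i, ∑ j, Q i j * a j * a i) +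
      2 * (∑ i, ∑ j, Q i j * b j * b i) - ∑ i, ∑ j, Q i j * (a + b) j * (a + b) i := by
  simp only [Finset.mul_sum, ← Finset.sum_add_distrib, ← Finset.sum_sub_distrib]
  refine Finset.sum_congr rfl fun i _ => Finset.sum_congr rfl fun j _ => ?_
  simp only [Pi.sub_apply, Pi.add_apply]; ring

lemma form_single {d : ℕ} (Q : Fin d → Fin d → ℝ) (k l : Fin d) (a b : ℝ) :
    ∑ i, ∑ j, Q i j * (Pi.single k a - Pi.single l b : Fin d → ℝ) j *
      (Pi.single k a - Pi.single l b : Fin d → ℝ) i =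
      a ^ 2 * Q k k - a * b * (Q k l + Q l k) + b ^ 2 * Q l l := by
  simp only [Pi.sub_apply, mul_sub, sub_mul, Finset.sum_sub_distrib, Pi.single_apply, mul_ite, ite_mul,
    mul_zero, zero_mul, Finset.sum_ite_eq, Finset.sum_ite_eq', Finset.mem_univ, if_true]
  simp only [Finset.sum_ite_irrel, Finset.sum_ite_eq', Finset.sum_const_zero, Finset.mem_univ, if_true,
    Finset.sum_sub_distrib]
  ring

lemma form_le {d : ℕ} {Q : Fin d → Fin d → ℝ}
    (hQ : ∀ ξ : Fin d → ℝ, ∑ i, ∑ j, Q i j * ξ j * ξ i ≤ 0) {N : ℝ} {Λ : Fin d → ℝ}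
    (hΛ : ∀ i, |Λ i| ≤ N) :
    -(∑ i, ∑ j, Q i j * Λ j * Λ i) ≤ N ^ 2 * d * (-∑ i, Q i i) := by
  have hdiag : ∀ i, Q i i ≤ 0 := fun i => by
    have := hQ (Pi.single i 1 - Pi.single i 0)
    rw [form_single] at this
    linarith
  have h1 : ∑ k, ∑ l, ((Λ k) ^ 2 * Q k k - Λ k * Λ l * (Q k l + Q l k) + (Λ l) ^ 2 * Q l l) ≤ 0 :=
    Finset.sum_nonpos fun k _ => Finset.sum_nonpos fun l _ => by
      have := hQ (Pi.single k (Λ k) - Pi.single l (Λ l))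
      rwa [form_single] at this
  have h2 : ∑ k, ∑ l, ((Λ k) ^ 2 * Q k k - Λ k * Λ l * (Q k l + Q l k) + (Λ l) ^ 2 * Q l l) =
      2 * d * ∑ k, (Λ k) ^ 2 * Q k k - 2 * ∑ i, ∑ j, Q i j * Λ j * Λ i := by
    simp only [Finset.sum_add_distrib, Finset.sum_sub_distrib, Finset.sum_const, Finset.card_univ,
      Fintype.card_fin, nsmul_eq_mul, mul_add]
    have e1 : ∑ k, ∑ l, Λ k * Λ l * Q k l = ∑ i, ∑ j, Q i j * Λ j * Λ i :=
      Finset.sum_congr rfl fun i _ => Finset.sum_congr rfl fun j _ => by ring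
    have e2 : ∑ k, ∑ l, Λ k * Λ l * Q l k = ∑ i, ∑ j, Q i j * Λ j * Λ i := by
      rw [Finset.sum_comm]
      exact Finset.sum_congr rfl fun i _ => Finset.sum_congr rfl fun j _ => by ring
    rw [e1, e2, ← Finset.mul_sum]; ring
  have h3 : -∑ k, (Λ k) ^ 2 * Q k k ≤ N ^ 2 * (-∑ i, Q i i) := by
    rw [← Finset.sum_neg_distrib, ← Finset.sum_neg_distrib, Finset.mul_sum]
    refine Finset.sum_le_sum fun i _ => ?_
    have : (Λ i) ^ 2 ≤ N ^ 2 := sq_le_sq' (abs_le.1 (hΛ i)).1 (abs_le.1 (hΛ i)).2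
    nlinarith [hdiag i]
  have hd : (0:ℝ) ≤ d := by positivity
  nlinarith [mul_le_mul_of_nonneg_left h3 hd]

lemma esq_smul {d : ℕ} (c : ℝ) (z : Fin d → ℝ) : esq (c • z) = c ^ 2 * esq z := by
  unfold esq; rw [Finset.mul_sum]
  exact Finset.sum_congr rfl fun i _ => by simp [mul_pow]

lemma dbl_final {N n G X L Tp TL Td : ℝ} (hN : 0 ≤ N) (hn : 0 ≤ n) (hG : 0 ≤ G)
    (hL : L = 4 * G * n * (1 + N ^ 2 * n) * (N + 1) + 1) (hL1 : 1 ≤ L) (hXL : L ≤ X)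
    (heq : -Tp + (-Td) ≤ 2 * G * (n * (N + X))) (hXe : X ^ 2 * 4 ≤ -2 * Tp - 2 * TL)
    (hfl : -TL ≤ N ^ 2 * n * (-Td)) (hTp : Tp ≤ 0) (hTd : 0 ≤ -Td) : False := by
  have hnd : 0 ≤ N ^ 2 * n := by positivity
  have hA : X ^ 2 * 4 ≤ 2 * (1 + N ^ 2 * n) * (2 * G * (n * (N + X))) := by
    have b1 : -Tp + N ^ 2 * n * (-Td) ≤ (1 + N ^ 2 * n) * (-Tp + (-Td)) := by
      nlinarith
    have b2 := mul_le_mul_of_nonneg_left heq (by positivity : 0 ≤ 1 + N ^ 2 * n)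
    linarith
  have hB : N + X ≤ (N + 1) * X := by nlinarith
  have hC : X ^ 2 * 4 ≤ (L - 1) * X := by
    refine hA.trans ?_
    have : 2 * (1 + N ^ 2 * n) * (2 * G * (n * (N + X))) ≤
      2 * (1 + N ^ 2 * n) * (2 * G * (n * ((N + 1) * X))) := by gcongr
    refine this.trans (le_of_eq ?_)
    rw [hL]; ring
  nlinarith

set_option maxHeartbeats 1600000 in
/-- Lipschitz bound by doubling of variables. -/
lemma doubling {d : ℕ} {V : (Fin d → ℝ) → (Fin d → ℝ) → ℝ} (hV : SmoothV V) {N G : ℝ} (hN : 0 ≤ N)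
    (hG : 0 ≤ G) (hVG : ∀ i x y, |pder i (V x) y| ≤ G)
    {x Λ : Fin d → ℝ} (hΛ : ∀ i, |Λ i| ≤ N) {w : (Fin d → ℝ) → ℝ} (hw : ContDiff ℝ 2 w)
    (hper : ZPer w) (hs : DivFormSol V x Λ w) {L D : ℝ}
    (hL : L = 4 * G * d * (1 + N ^ 2 * d) * (N + 1) + 1) (hD : D = d + 1) (y h : Fin d → ℝ)
    (hh : esq h ≤ D ^ 2) : w (y + h) - w y ≤ (L + D) * √(esq h) - esq h / 2 := by
  have hD1 : 1 ≤ D := by rw [hD]; have : (0:ℝ) ≤ d := by positivity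
                         linarith
  have hL1 : 1 ≤ L := by rw [hL]; have : 0 ≤ 4 * G * d * (1 + N ^ 2 * d) * (N + 1) := by positivity
                         linarith
  by_contra hcon
  push Not at hcon
  set Ψ : (Fin d → ℝ) × (Fin d → ℝ) → ℝ := fun q =>
    w (q.1 + q.2) - w q.1 - ((L + D) * √(esq q.2) - esq q.2 / 2) with hΨ
  have hwc := hw.continuous
  have hec := continuous_esq (d := d)
  have hΨc : Continuous Ψ := by
    simp only [hΨ]
    fun_prop
  obtain ⟨k1, hk1⟩ := exists_rep y
  have hperΨ : ∀ y h (k : Fin d → ℤ), Ψ (fun i => y i + (k i : ℝ), h) = Ψ (y, h) := by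
    intro y h k
    simp only [hΨ]
    rw [hper y k]
    have : (fun i => y i + (k i : ℝ)) + h = fun i => (y + h) i + (k i : ℝ) := by
      ext i; simp; ring
    rw [this, hper (y + h) k]
  obtain ⟨⟨y0, h0⟩, hmem, hmax⟩ := ((isCompact_Icc (a := (0 : Fin d → ℝ)) (b := 1)).prod
    (isCompact_esq_le (d := d) (D ^ 2))).exists_isMaxOn
    ⟨(_, h), Set.mk_mem_prod hk1 hh⟩ hΨc.continuousOn
  have hall : ∀ y h, esq h ≤ D ^ 2 → Ψ (y, h) ≤ Ψ (y0, h0) := by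
    intro y h hh
    obtain ⟨k, hk⟩ := exists_rep y
    rw [← hperΨ y h k]
    exact hmax (Set.mk_mem_prod hk hh)
  have hpos : 0 < Ψ (y0, h0) := lt_of_lt_of_le (by simp only [hΨ]; linarith) (hall y h hh)
  have hh0 : esq h0 ≤ D ^ 2 := hmem.2
  set r0 := √(esq h0) with hr0
  have hr0sq : r0 ^ 2 = esq h0 := Real.sq_sqrt (esq_nonneg _)
  have hr0n : 0 ≤ r0 := Real.sqrt_nonneg _
  have hr0D : r0 ≤ D := by
    rw [hr0, Real.sqrt_le_left (by linarith)]; exact hh0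
  have hr0p : 0 < r0 := by
    rcases hr0n.eq_or_lt with h | h
    · exfalso
      have he : esq h0 = 0 := by rw [← hr0sq, ← h]; simp
      have hz : h0 = 0 := by
        have := norm_le_of_esq (y := h0) le_rfl (by rw [he]; simp)
        simpa using this
      simp only [hΨ, hz] at hpos
      simp [esq] at hpos
    · exact h
  have hr0lt : r0 < D := by
    by_contra hge
    have hge : D ≤ r0 := not_lt.1 hge
    set kk : Fin d → ℤ := fun i => -round (h0 i) with hkk
    set h2 : Fin d → ℝ := fun i => h0 i + (kk i : ℝ) with hh2
    have hi : ∀ i, (h2 i) ^ 2 ≤ 1 / 4 := fun i => by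
      have := abs_sub_round (h0 i)
      have e : h2 i = h0 i - round (h0 i) := by simp only [hh2, hkk]; push_cast; ring
      rw [e, ← sq_abs]
      nlinarith [abs_nonneg (h0 i - round (h0 i))]
    have he2 : esq h2 ≤ d / 4 := by
      unfold esq
      refine (Finset.sum_le_sum fun i _ => hi i).trans ?_
      simp; linarith
    have hd0 : (0:ℝ) ≤ d := by positivity
    have he2D : esq h2 < D ^ 2 := by rw [hD]; nlinarith
    obtain ⟨r2, hr2e⟩ : ∃ r, r = √(esq h2) := ⟨_, rfl⟩
    have hr2 : r2 < D := by
      rw [hr2e, Real.sqrt_lt' (by linarith)]; exact he2D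
    have hr2sq : r2 ^ 2 = esq h2 := by rw [hr2e]; exact Real.sq_sqrt (esq_nonneg _)
    have := hall y0 h2 he2D.le
    simp only [hΨ] at this
    have e : w (y0 + h2) = w (y0 + h0) := by
      rw [← hper (y0 + h0) kk]; congr 1; ext i; simp [hh2]; ring
    rw [e, ← hr2e, ← hr2sq, ← hr0, ← hr0sq] at this
    have hDe : r0 = D := le_antisymm hr0D hge
    rw [hDe] at this
    nlinarith
  have hesq0 : esq h0 < D ^ 2 := by rw [← hr0sq]; nlinarith
  set X := L + D - r0 with hX
  have hXL : L ≤ X := by rw [hX]; linarith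
  set e : Fin d → ℝ := r0⁻¹ • h0 with he
  have hee : esq e = 1 := by
    rw [he, esq_smul, ← hr0sq]; field_simp
  have hre : h0 = r0 • e := by rw [he, smul_inv_smul₀ hr0p.ne']
  have hw1 : ContDiff ℝ 1 w := hw.of_le (by norm_num)
  -- first order condition in h
  have hfo : ∀ i, pder i w (y0 + h0) = X * e i := by
    intro i
    set ξ : Fin d → ℝ := Pi.single i 1 with hξ
    have hloc : IsLocalMax (fun s : ℝ => w ((y0 + h0) + s • ξ) - w y0 -
        ((L + D) * √(esq (h0 + s • ξ)) - esq (h0 + s • ξ) / 2)) 0 := by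
      have hev : ∀ᶠ s : ℝ in 𝓝 0, esq (h0 + s • ξ) < D ^ 2 := by
        have hc : Continuous fun s : ℝ => esq (h0 + s • ξ) := by fun_prop
        refine hc.continuousAt.eventually_lt continuousAt_const ?_
        simpa using hesq0
      filter_upwards [hev] with s hs
      have := hall y0 (h0 + s • ξ) hs.le
      simp only [hΨ] at this
      simpa [add_assoc] using this
    have d1 := hasDerivAt_line hw1 (y0 + h0) ξ 0
    have d2 := hasDerivAt_line (contDiff_esq (d := d) (n := 1)) h0 ξ 0
    have d3 := d2.sqrt (by simp; rw [← hr0sq]; positivity)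
    have d4 := ((d1.sub_const (w y0)).fun_sub ((d3.const_mul (L + D)).fun_sub (d2.div_const 2)))
    have hz := hloc.hasDerivAt_eq_zero d4
    have hsum : ∀ f : Fin d → ℝ, ∑ j, f j * ξ j = f i := fun f => by
      simp [hξ, Pi.single_apply]
    simp only [hsum, zero_smul, add_zero, pder_esq] at hz
    rw [← hr0] at hz
    have e1 : e i = h0 i / r0 := by rw [he]; simp; ring
    rw [e1, hX]
    have : (L + D) * (2 * h0 i / (2 * r0)) = (L + D) * (h0 i / r0) := by field_simp
    rw [this] at hz
    have : (L + D - r0) * (h0 i / r0) = (L + D) * (h0 i / r0) - h0 i := by field_simp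
    rw [this]; linarith
  -- conditions in y
  have hym : ∀ ξ : Fin d → ℝ, IsLocalMax (fun s : ℝ => w ((y0 + h0) + s • ξ) - w (y0 + s • ξ)) 0 := by
    intro ξ
    refine Eventually.of_forall fun s => ?_
    have := hall (y0 + s • ξ) h0 hh0
    simp only [hΨ] at this
    have e1 : y0 + s • ξ + h0 = y0 + h0 + s • ξ := by abel
    rw [e1] at this
    simp only [zero_smul, add_zero]
    linarith
  have hgy : ∀ i, pder i w y0 = X * e i := by
    intro i
    rw [← hfo]
    have hz := (hym (Pi.single i 1)).hasDerivAt_eq_zero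
      ((hasDerivAt_line hw1 (y0 + h0) (Pi.single i 1) 0).fun_sub
        (hasDerivAt_line hw1 y0 (Pi.single i 1) 0))
    simp [Pi.single_apply] at hz
    linarith
  set Q : Fin d → Fin d → ℝ := fun i j =>
    pder j (pder i w) (y0 + h0) - pder j (pder i w) y0 with hQd
  have hQ : ∀ ξ : Fin d → ℝ, ∑ i, ∑ j, Q i j * ξ j * ξ i ≤ 0 := by
    intro ξ
    have := second_order (Eventually.of_forall fun s => (hasDerivAt_line hw1 (y0 + h0) ξ s).fun_sub
        (hasDerivAt_line hw1 y0 ξ s)) ((hasDerivAt_line2 hw (y0 + h0) ξ 0).fun_sub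
        (hasDerivAt_line2 hw y0 ξ 0)) (hym ξ)
    simp only [zero_smul, add_zero] at this
    refine le_trans (le_of_eq ?_) this
    simp only [← Finset.sum_sub_distrib]
    refine Finset.sum_congr rfl fun i _ => Finset.sum_congr rfl fun j _ => ?_
    simp only [hQd]; ring
  have hQe : ∑ i, ∑ j, Q i j * e j * e i ≤ -4 := by
    have hloc : IsLocalMax (fun s : ℝ => w ((y0 + h0) + s • e) - w (y0 + s • (-e)) -
        ((L + D) * (r0 + 2 * s) - (r0 + 2 * s) ^ 2 / 2)) 0 := by
      have hc : Continuous fun s : ℝ => r0 + 2 * s := by fun_prop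
      have hev1 : ∀ᶠ s : ℝ in 𝓝 0, 0 < r0 + 2 * s :=
        continuousAt_const.eventually_lt hc.continuousAt (by simpa using hr0p)
      have hev2 : ∀ᶠ s : ℝ in 𝓝 0, r0 + 2 * s < D :=
        hc.continuousAt.eventually_lt continuousAt_const (by simpa using hr0lt)
      filter_upwards [hev1, hev2] with s hs1 hs2
      have e1 : esq ((r0 + 2 * s) • e) = (r0 + 2 * s) ^ 2 := by rw [esq_smul, hee, mul_one]
      have := hall (y0 + s • (-e)) ((r0 + 2 * s) • e) (by rw [e1]; nlinarith)
      simp only [hΨ] at this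
      rw [e1, Real.sqrt_sq hs1.le, ← hr0, ← hr0sq] at this
      have e2 : y0 + s • (-e) + (r0 + 2 * s) • e = y0 + h0 + s • e := by
        conv_rhs => rw [hre]
        ext i; simp; ring
      rw [e2] at this
      simpa using this
    have dψ : ∀ s : ℝ, HasDerivAt (fun s : ℝ => (L + D) * (r0 + 2 * s) - (r0 + 2 * s) ^ 2 / 2)
        ((L + D) * 2 - (r0 + 2 * s) * 2) s := fun s => by
      have l : HasDerivAt (fun s : ℝ => r0 + 2 * s) 2 s := by
        simpa using ((hasDerivAt_id s).const_mul 2).const_add r0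
      refine ((l.const_mul (L + D)).fun_sub ((l.fun_pow 2).div_const 2)).congr_deriv ?_
      simp; ring
    have ddψ : HasDerivAt (fun s : ℝ => (L + D) * 2 - (r0 + 2 * s) * 2) (-4) 0 := by
      have l : HasDerivAt (fun s : ℝ => r0 + 2 * s) 2 0 := by
        simpa using ((hasDerivAt_id (0:ℝ)).const_mul 2).const_add r0
      refine ((l.mul_const 2).const_sub ((L + D) * 2)).congr_deriv (by norm_num)
    have := second_order (Eventually.of_forall fun s => ((hasDerivAt_line hw1 (y0 + h0) e s).fun_sub
        (hasDerivAt_line hw1 y0 (-e) s)).fun_sub (dψ s)) (((hasDerivAt_line2 hw (y0 + h0) e 0).fun_sub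
        (hasDerivAt_line2 hw y0 (-e) 0)).fun_sub ddψ) hloc
    simp only [zero_smul, add_zero] at this
    have e3 : ∑ i, ∑ j, Q i j * e j * e i =
      ∑ i, ∑ j, pder j (pder i w) (y0 + h0) * e j * e i -
        ∑ i, ∑ j, pder j (pder i w) y0 * (-e) j * (-e) i := by
      simp only [← Finset.sum_sub_distrib]
      refine Finset.sum_congr rfl fun i _ => Finset.sum_congr rfl fun j _ => ?_
      simp only [hQd, Pi.neg_apply]; ring
    rw [e3]; linarith
  set p : Fin d → ℝ := fun i => Λ i + X * e i with hp
  have hX0 : 0 < X := by linarith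
  have hei : ∀ i, |e i| ≤ 1 := fun i =>
    (norm_le_pi_norm e i).trans (norm_le_of_esq zero_le_one (by rw [hee]; norm_num))
  have heq : -(∑ i, ∑ j, Q i j * p j * p i) + (-∑ i, Q i i) ≤ 2 * G * (d * (N + X)) := by
    have q1 := nondiv hV hw hs (y0 + h0)
    have q2 := nondiv hV hw hs y0
    simp_rw [hfo] at q1
    simp_rw [hgy] at q2
    have s1 : ∑ i, ∑ j, Q i j * p j * p i =
        ∑ i, ∑ l, (Λ i + X * e i) * (Λ l + X * e l) * pder i (pder l w) (y0 + h0) -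
        ∑ i, ∑ l, (Λ i + X * e i) * (Λ l + X * e l) * pder i (pder l w) y0 := by
      rw [Finset.sum_comm]
      simp only [← Finset.sum_sub_distrib]
      refine Finset.sum_congr rfl fun i _ => Finset.sum_congr rfl fun j _ => ?_
      simp only [hQd, hp]; ring
    have s2 : ∑ i, Q i i = ∑ i, pder i (pder i w) (y0 + h0) - ∑ i, pder i (pder i w) y0 := by
      simp only [hQd, Finset.sum_sub_distrib]
    have s3 : ∑ i, (Λ i + X * e i) * pder i (V x) (y0 + h0) -
        ∑ i, (Λ i + X * e i) * pder i (V x) y0 ≤ 2 * G * (d * (N + X)) := by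
      rw [← Finset.sum_sub_distrib]
      calc _ ≤ ∑ i : Fin d, (N + X) * (2 * G) := Finset.sum_le_sum fun i _ => by
            rw [← mul_sub]
            refine (le_abs_self _).trans ?_
            rw [abs_mul]
            refine mul_le_mul ?_ ?_ (abs_nonneg _) (by positivity)
            · refine (abs_add_le _ _).trans (add_le_add (hΛ i) ?_)
              rw [abs_mul, abs_of_pos hX0]
              nlinarith [hei i]
            · refine (abs_sub _ _).trans ?_
              linarith [hVG i x (y0 + h0), hVG i x y0]
        _ = _ := by simp; ring
    linarith
  have hXe : X ^ 2 * 4 ≤ -2 * (∑ i, ∑ j, Q i j * p j * p i) - 2 * (∑ i, ∑ j, Q i j * Λ j * Λ i) := by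
    have f := form_expand Q p Λ
    have g := hQ (p + Λ)
    have e1 : ∑ i, ∑ j, Q i j * (p - Λ) j * (p - Λ) i = X ^ 2 * ∑ i, ∑ j, Q i j * e j * e i := by
      simp only [Finset.mul_sum]
      refine Finset.sum_congr rfl fun i _ => Finset.sum_congr rfl fun j _ => ?_
      simp only [hp, Pi.sub_apply]; ring
    rw [e1] at f
    nlinarith [sq_nonneg X]
  have hfl := form_le hQ hΛ
  have hTp := hQ p
  have hTd : 0 ≤ -∑ i, Q i i := by
    rw [← Finset.sum_neg_distrib]
    refine Finset.sum_nonneg fun i _ => ?_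
    have := hQ (Pi.single i 1 - Pi.single i 0)
    rw [form_single] at this
    linarith
  exact dbl_final hN (Nat.cast_nonneg d) hG hL hL1 hXL heq hXe hfl hTp hTd

lemma grad_bound {d : ℕ} {V : (Fin d → ℝ) → (Fin d → ℝ) → ℝ} (hV : SmoothV V) {N : ℝ} (hN : 0 ≤ N) :
    ∃ P : ℝ, 1 ≤ P ∧ ∀ (x Λ : Fin d → ℝ) (w : (Fin d → ℝ) → ℝ), (∀ i, |Λ i| ≤ N) → ContDiff ℝ 2 w →
      ZPer w → DivFormSol V x Λ w → ∀ i y, |pder i w y| ≤ P := by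
  choose G hG0 hG using fun i => (hV.pder i).bounded
  set GG := ∑ i, G i with hGG
  have hGG0 : 0 ≤ GG := Finset.sum_nonneg fun i _ => hG0 i
  have hGi : ∀ i x y, |pder i (V x) y| ≤ GG := fun i x y =>
    (hG i x y).trans (Finset.single_le_sum (fun j _ => hG0 j) (Finset.mem_univ i))
  set L := 4 * GG * d * (1 + N ^ 2 * d) * (N + 1) + 1 with hL
  set D : ℝ := d + 1 with hD
  have hD1 : 1 ≤ D := by rw [hD]; have : (0:ℝ) ≤ d := by positivity
                         linarith
  have hL1 : 1 ≤ L := by rw [hL]; have : 0 ≤ 4 * GG * d * (1 + N ^ 2 * d) * (N + 1) := by positivity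
                         linarith
  refine ⟨L + D, by linarith, fun x Λ w hΛ hw hper hs i y => ?_⟩
  have key : ∀ y h : Fin d → ℝ, esq h ≤ D ^ 2 → w (y + h) - w y ≤ (L + D) * √(esq h) := by
    intro y h hh
    have := doubling hV hN hGG0 hGi hΛ hw hper hs hL hD y h hh
    linarith [esq_nonneg h]
  have hd := hasDerivAt_line (hw.of_le (by norm_num) : ContDiff ℝ 1 w) y (Pi.single i 1) 0
  have hb := hd.le_of_lip' (C := L + D) (by linarith) (by
    have : ∀ᶠ s : ℝ in 𝓝 0, |s| < 1 := by
      have := continuous_abs.continuousAt (x := (0:ℝ)) |>.eventually_lt (continuousAt_const (y := (1:ℝ))) (by simp)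
      exact this
    filter_upwards [this] with s hs
    have he : esq (s • (Pi.single i 1 : Fin d → ℝ)) = s ^ 2 := by
      rw [esq_smul]; simp [esq, Pi.single_apply]
    have hD2 : s ^ 2 ≤ D ^ 2 := by
      rw [← sq_abs s]
      have := abs_nonneg s
      nlinarith
    have k1 := key y (s • Pi.single i 1) (by rw [he]; exact hD2)
    have k2 := key (y + s • Pi.single i 1) ((-s) • Pi.single i 1) (by
      rw [esq_smul]; rw [esq_smul] at he; rw [neg_sq, he]; exact hD2)
    have e2 : esq ((-s) • (Pi.single i 1 : Fin d → ℝ)) = s ^ 2 := by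
      rw [esq_smul] at he ⊢; rw [neg_sq]; exact he
    rw [he, Real.sqrt_sq_eq_abs] at k1
    rw [e2, Real.sqrt_sq_eq_abs] at k2
    have e3 : y + s • Pi.single i 1 + (-s) • Pi.single i 1 = y := by
      rw [add_assoc, ← add_smul]; simp
    rw [e3] at k2
    simp only [zero_smul, add_zero, sub_zero, Real.norm_eq_abs]
    exact abs_le.2 ⟨by linarith, k1⟩)
  simpa [Pi.single_apply] using hb

lemma diff_bound_ball {d : ℕ} {f : (Fin d → ℝ) → ℝ} (hf : ContDiff ℝ 1 f) {B R : ℝ}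
    (hB : ∀ i y, ‖y‖ ≤ R → |pder i f y| ≤ B) {y z : Fin d → ℝ} (hy : ‖y‖ ≤ R) (hz : ‖z‖ ≤ R) :
    |f z - f y| ≤ d * B * ‖z - y‖ := by
  have := Convex.norm_image_sub_le_of_norm_fderiv_le (𝕜 := ℝ) (f := f)
    (s := Metric.closedBall 0 R) (C := d * B) (x := y) (y := z)
    (fun x _ => hf.differentiable (by norm_num) x) (fun x hx => by
      refine (norm_fderiv_le f x).trans ((Finset.sum_le_sum fun i _ => hB i x (by simpa using hx)).trans ?_)
      simp) (convex_closedBall _ _) (by simpa using hy) (by simpa using hz)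
  simpa using this

lemma diff_bound {d : ℕ} {f : (Fin d → ℝ) → ℝ} (hf : ContDiff ℝ 1 f) {B : ℝ}
    (hB : ∀ i y, |pder i f y| ≤ B) (y z : Fin d → ℝ) : |f z - f y| ≤ d * B * ‖z - y‖ :=
  diff_bound_ball hf (R := max ‖y‖ ‖z‖) (fun i y _ => hB i y) (le_max_left _ _) (le_max_right _ _)

/-- Difference operator. -/
def Dl {d : ℕ} (h : Fin d → ℝ) (f : (Fin d → ℝ) → ℝ) : (Fin d → ℝ) → ℝ := fun z => f (z + h) - f z

lemma contDiff_Dl {d : ℕ} {f : (Fin d → ℝ) → ℝ} (hf : ContDiff ℝ 1 f) (h : Fin d → ℝ) :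
    ContDiff ℝ 1 (Dl h f) :=
  (hf.comp (contDiff_id.add contDiff_const)).sub hf

lemma pder_Dl {d : ℕ} {f : (Fin d → ℝ) → ℝ} (hf : ContDiff ℝ 1 f) (h : Fin d → ℝ) (i : Fin d) :
    pder i (Dl h f) = Dl h (pder i f) := by
  ext y
  have hd := hf.differentiable (by norm_num)
  have h2 : Differentiable ℝ fun z => f (z + h) := hd.comp (differentiable_id.add_const h)
  have := pder_sub i (h2 y) (hd y)
  unfold Dl
  rw [this]
  simp only [pder, fderiv_comp_add_right]

lemma Dl_bound {d : ℕ} {f : (Fin d → ℝ) → ℝ} (hf : ContDiff ℝ 1 f) {B : ℝ}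
    (hB : ∀ i y, |pder i f y| ≤ B) (h y : Fin d → ℝ) : |Dl h f y| ≤ d * B * ‖h‖ := by
  have := diff_bound hf hB y (y + h)
  simpa [Dl] using this

lemma pder_of_const {d : ℕ} {f : (Fin d → ℝ) → ℝ} (hf : ∀ x y, f x = f y) (i : Fin d) (y : Fin d → ℝ) :
    pder i f y = 0 := by
  have : f = fun _ => f 0 := funext fun x => hf x 0
  rw [this]; unfold pder; simp

/-! ### nonlinear Liouville -/

def Phi {d : ℕ} (a : Fin d → ℝ) : Fin d → ℝ := fun i => Real.exp ((∑ l, (a l) ^ 2) / 2) * a i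

lemma contDiff_Phi {d : ℕ} : ContDiff ℝ 1 (Phi (d := d)) := by
  unfold Phi
  fun_prop

lemma Phi_mono {d : ℕ} (a b : Fin d → ℝ) :
    ∑ i, (a i - b i) ^ 2 ≤ ∑ i, (Phi a i - Phi b i) * (a i - b i) := by
  set A := Real.exp ((∑ l, (a l) ^ 2) / 2) with hA
  set B := Real.exp ((∑ l, (b l) ^ 2) / 2) with hB
  have hA1 : 1 ≤ A := Real.one_le_exp (by have := esq_nonneg a; unfold esq at this; linarith)
  have hB1 : 1 ≤ B := Real.one_le_exp (by have := esq_nonneg b; unfold esq at this; linarith)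
  have e : ∑ i, (Phi a i - Phi b i) * (a i - b i) =
      (A + B) / 2 * ∑ i, (a i - b i) ^ 2 + (A - B) / 2 * (∑ i, (a i) ^ 2 - ∑ i, (b i) ^ 2) := by
    rw [← Finset.sum_sub_distrib, Finset.mul_sum, Finset.mul_sum, ← Finset.sum_add_distrib]
    refine Finset.sum_congr rfl fun i _ => ?_
    simp only [Phi, ← hA, ← hB]; ring
  have h2 : 0 ≤ (A - B) / 2 * (∑ i, (a i) ^ 2 - ∑ i, (b i) ^ 2) := by
    rcases le_total (∑ i, (a i) ^ 2) (∑ i, (b i) ^ 2) with h | h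
    · have : A ≤ B := Real.exp_le_exp.2 (by linarith)
      exact mul_nonneg_of_nonpos_of_nonpos (by linarith) (by linarith)
    · have : B ≤ A := Real.exp_le_exp.2 (by linarith)
      exact mul_nonneg (by linarith) (by linarith)
  have h3 : 0 ≤ ∑ i, (a i - b i) ^ 2 := Finset.sum_nonneg fun _ _ => sq_nonneg _
  rw [e]; nlinarith

lemma Phi_lip {d : ℕ} (R : ℝ) : ∃ M : ℝ, 0 < M ∧ ∀ a b : Fin d → ℝ, ‖a‖ ≤ R → ‖b‖ ≤ R →
    ∑ i, (Phi a i - Phi b i) ^ 2 ≤ M ^ 2 * ∑ i, (a i - b i) ^ 2 := by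
  have hc : Continuous (fderiv ℝ (Phi (d := d))) := contDiff_Phi.continuous_fderiv (by norm_num)
  obtain ⟨C, hC⟩ := (isCompact_closedBall (0 : Fin d → ℝ) R).exists_bound_of_continuousOn hc.continuousOn
  refine ⟨(d + 1) * (|C| + 1), by positivity, fun a b ha hb => ?_⟩
  have h := Convex.norm_image_sub_le_of_norm_fderiv_le (𝕜 := ℝ) (f := Phi (d := d))
    (fun x _ => contDiff_Phi.differentiable (by norm_num) x) hC (convex_closedBall _ _)
    (x := b) (y := a) (by simpa using hb) (by simpa using ha)
  have hn : ‖a - b‖ ^ 2 ≤ ∑ i, (a i - b i) ^ 2 := by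
    have h0 : 0 ≤ ∑ i, (a i - b i) ^ 2 := Finset.sum_nonneg fun _ _ => sq_nonneg _
    have := norm_le_of_esq (y := a - b) (Real.sqrt_nonneg (∑ i, (a i - b i) ^ 2)) (by
      rw [Real.sq_sqrt h0]; rfl)
    calc ‖a - b‖ ^ 2 ≤ (√(∑ i, (a i - b i) ^ 2)) ^ 2 := by gcongr
      _ = _ := Real.sq_sqrt h0
  have hi : ∀ i, (Phi a i - Phi b i) ^ 2 ≤ (|C| + 1) ^ 2 * ‖a - b‖ ^ 2 := fun i => by
    have h1 : |Phi a i - Phi b i| ≤ (|C| + 1) * ‖a - b‖ :=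
      (norm_le_pi_norm (Phi a - Phi b) i).trans (h.trans (by
        gcongr; linarith [le_abs_self C]))
    rw [← mul_pow, ← sq_abs]
    gcongr
  calc _ ≤ ∑ i : Fin d, (|C| + 1) ^ 2 * ‖a - b‖ ^ 2 := Finset.sum_le_sum fun i _ => hi i
    _ = d * (|C| + 1) ^ 2 * ‖a - b‖ ^ 2 := by simp; ring
    _ ≤ ((d + 1) * (|C| + 1)) ^ 2 * ‖a - b‖ ^ 2 := by
      rw [mul_pow]; gcongr
      have : (0:ℝ) ≤ d := by positivity
      nlinarith
    _ ≤ _ := by gcongr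

lemma entire_nonlin {d : ℕ} {u : (Fin d → ℝ) → ℝ} (hu : ContDiff ℝ 1 u)
    (hg : ∀ i, ContDiff ℝ 1 (pder i u)) (Λ : Fin d → ℝ) {P : ℝ} (hP : ∀ i y, |pder i u y| ≤ P)
    (heq : ∀ y, ∑ i, pder i (pder i u) y + ∑ i, ∑ l, (Λ i + pder i u y) * (Λ l + pder l u y) *
      pder i (pder l u) y = 0) (i j : Fin d) (y : Fin d → ℝ) : pder i (pder j u) y = 0 := by
  set p : (Fin d → ℝ) → Fin d → ℝ := fun z i => Λ i + pder i u z with hp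
  have hpc : ∀ i, ContDiff ℝ 1 fun z => p z i := fun i => contDiff_const.add (hg i)
  have hpc' : ContDiff ℝ 1 p := contDiff_pi.2 hpc
  have hpd : ∀ i j y, pder i (fun z => p z j) y = pder i (pder j u) y := fun i j y => by
    have : (fun z => p z j) = fun z => pder j u z + Λ j := by ext z; simp only [hp]; ring
    rw [this, pder_add_const]
  have hPhic : ∀ i, ContDiff ℝ 1 fun z => Phi (p z) i := fun i =>
    contDiff_pi.1 (contDiff_Phi.comp hpc') i
  have hdiv : ∀ y, ∑ i, pder i (fun z => Phi (p z) i) y = 0 := fun y => by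
    have := div_formula (p := fun i z => p z i) hpc (U := fun _ => 0) contDiff_const y
    simp only [add_zero] at this
    unfold Phi
    rw [this]
    have hz : ∀ i, pder i (fun _ : Fin d → ℝ => (0:ℝ)) y = 0 := fun i => pder_of_const (by simp) i y
    simp only [hpd, hz, mul_zero, Finset.sum_const_zero, add_zero]
    have := heq y
    simp only [hp]
    rw [this, mul_zero]
  have hP0 : 0 ≤ P := (abs_nonneg _).trans (hP i y)
  have hpb : ∀ z, ‖p z‖ ≤ ‖Λ‖ + P := fun z => by
    refine (pi_norm_le_iff_of_nonneg (by positivity)).2 fun i => ?_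
    simp only [hp]
    exact (norm_add_le _ _).trans (add_le_add (norm_le_pi_norm Λ i) (hP i z))
  obtain ⟨M, hM, hlip⟩ := Phi_lip (d := d) (‖Λ‖ + P)
  have key : ∀ h i, ∀ z, pder i u (z + h) = pder i u z := by
    intro h i z
    have dv : ∀ i y, pder i (Dl h u) y = p (y + h) i - p y i := fun i y => by
      rw [pder_Dl hu]; simp only [Dl, hp]; ring
    have H : EllSol 1 M (Dl h u) (fun i => Dl h fun z => Phi (p z) i) :=
      { cv := contDiff_Dl hu h
        cJ := fun i => contDiff_Dl (hPhic i) h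
        div0 := fun y => by
          simp only [fun i => pder_Dl (hPhic i) h i, Dl, Finset.sum_sub_distrib, hdiv, sub_zero]
        hel := fun y => by
          simp only [gsq, dv, Dl, one_mul]
          exact Phi_mono _ _
        hbd := fun y => by
          simp only [gsq, dv, Dl]
          exact hlip _ _ (hpb _) (hpb _) }
    have hc := liouville one_pos hM H (B := d * P * ‖h‖) (fun y => Dl_bound hu hP h y)
    have := pder_of_const hc i z
    rw [pder_Dl hu] at this
    simp only [Dl] at this
    linarith
  refine pder_of_const (fun x z => ?_) i y
  have := key (x - z) j z
  simpa using this

/-! ### linear Liouville -/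

lemma entire_lin {d : ℕ} {v : (Fin d → ℝ) → ℝ} (hv : ContDiff ℝ 1 v)
    (hg : ∀ i, ContDiff ℝ 1 (pder i v)) (P : Fin d → ℝ) {α : ℝ} (hα : α ∈ Set.Ioo (0:ℝ) 1)
    (hH : ∀ i j y z, |pder i (pder j v) y - pder i (pder j v) z| ≤ dist y z ^ α)
    (heq : ∀ y, ∑ i, pder i (pder i v) y + ∑ i, ∑ l, P i * P l * pder i (pder l v) y = 0)
    (i j : Fin d) (y z : Fin d → ℝ) : pder i (pder j v) y = pder i (pder j v) z := by
  have third : ∀ h1 h2 h3 j y, Dl h1 (Dl h2 (Dl h3 (pder j v))) y = 0 := by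
    intro h1 h2 h3 j y
    set T := Dl h1 (Dl h2 (Dl h3 v)) with hT
    have c1 := contDiff_Dl hv h3
    have c2 := contDiff_Dl c1 h2
    have c3 : ContDiff ℝ 1 T := contDiff_Dl c2 h1
    have gT : ∀ i, pder i T = Dl h1 (Dl h2 (Dl h3 (pder i v))) := fun i => by
      rw [hT, pder_Dl c2, pder_Dl c1, pder_Dl hv]
    have cg : ∀ i, ContDiff ℝ 1 (pder i T) := fun i => by
      rw [gT]; exact contDiff_Dl (contDiff_Dl (contDiff_Dl (hg i) _) _) _
    have ggT : ∀ k i, pder k (pder i T) = Dl h1 (Dl h2 (Dl h3 (pder k (pder i v)))) := fun k i => by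
      rw [gT, pder_Dl (contDiff_Dl (contDiff_Dl (hg i) _) _), pder_Dl (contDiff_Dl (hg i) _),
        pder_Dl (hg i)]
    have eqT : ∀ y, ∑ i, pder i (pder i T) y + ∑ i, ∑ l, P i * P l * pder i (pder l T) y = 0 := by
      intro y
      have hE : ∀ (F : Fin d → Fin d → (Fin d → ℝ) → ℝ) (h : Fin d → ℝ),
          (∀ y, ∑ i, F i i y + ∑ i, ∑ l, P i * P l * F i l y = 0) →
          ∀ y, ∑ i, Dl h (F i i) y + ∑ i, ∑ l, P i * P l * Dl h (F i l) y = 0 := by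
        intro F h hF y
        have a := hF (y + h)
        have b := hF y
        simp only [Dl, Finset.sum_sub_distrib, mul_sub]
        linarith
      have := hE (fun i l => Dl h2 (Dl h3 (pder i (pder l v)))) h1
        (hE (fun i l => Dl h3 (pder i (pder l v))) h2 (hE (fun i l => pder i (pder l v)) h3 heq)) y
      simpa only [ggT] using this
    set E := ∑ l, (P l) ^ 2 with hE
    have hE0 : 0 ≤ E := Finset.sum_nonneg fun _ _ => sq_nonneg _
    have H : EllSol 1 (2 + 2 * E) T (fun i z => pder i T z + P i * ∑ l, P l * pder l T z) :=
      { cv := c3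
        cJ := fun i => (cg i).add (contDiff_const.mul (ContDiff.sum fun l _ => contDiff_const.mul (cg l)))
        div0 := fun y => by
          rw [← eqT y, ← Finset.sum_add_distrib]
          refine Finset.sum_congr rfl fun i _ => ?_
          have dl : ∀ l, Differentiable ℝ fun z => P l * pder l T z := fun l =>
            ((cg l).differentiable (by norm_num)).const_mul _
          have ds : ContDiff ℝ 1 fun z => ∑ l, P l * pder l T z :=
            ContDiff.sum fun l _ => contDiff_const.mul (cg l)
          rw [pder_add i ((cg i).differentiable (by norm_num) y)
            (((ds.differentiable (by norm_num)).const_mul _) y), pder_const_mul ds,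
            pder_sum i fun l => dl l y, Finset.mul_sum]
          congr 1
          refine Finset.sum_congr rfl fun l _ => ?_
          rw [pder_const_mul (cg l)]; ring
        hel := fun y => by
          simp only [gsq, one_mul, add_mul, Finset.sum_add_distrib]
          have e1 : ∑ i, P i * (∑ l, P l * pder l T y) * pder i T y = (∑ l, P l * pder l T y) ^ 2 := by
            rw [sq, Finset.sum_mul]
            exact Finset.sum_congr rfl fun i _ => by ring
          rw [e1]
          have e2 : ∑ i, pder i T y * pder i T y = ∑ i, (pder i T y) ^ 2 :=
            Finset.sum_congr rfl fun i _ => by ring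
          rw [e2]
          nlinarith [sq_nonneg (∑ l, P l * pder l T y)]
        hbd := fun y => by
          have cs : (∑ l, P l * pder l T y) ^ 2 ≤ E * gsq T y := Finset.sum_mul_sq_le_sq_mul_sq _ _ _
          have hG := gsq_nonneg T y
          calc _ ≤ ∑ i, (2 * (pder i T y) ^ 2 + 2 * ((P i) ^ 2 * (∑ l, P l * pder l T y) ^ 2)) :=
                Finset.sum_le_sum fun i _ => by
                  nlinarith [sq_nonneg (pder i T y - P i * ∑ l, P l * pder l T y)]
            _ = 2 * gsq T y + 2 * (E * (∑ l, P l * pder l T y) ^ 2) := by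
                rw [Finset.sum_add_distrib, ← Finset.mul_sum, ← Finset.mul_sum, ← Finset.sum_mul]; rfl
            _ ≤ 2 * gsq T y + 2 * (E * (E * gsq T y)) := by gcongr
            _ ≤ _ := by nlinarith [mul_nonneg hE0 hG, mul_nonneg (mul_nonneg hE0 hE0) hG] }
    have b3 : ∀ j i y, |pder i (Dl h3 (pder j v)) y| ≤ ‖h3‖ ^ α := fun j i y => by
      rw [pder_Dl (hg j)]
      have := hH i j (y + h3) y
      simpa [Dl] using this
    have b2 : ∀ i y, |pder i (Dl h2 (Dl h3 v)) y| ≤ d * ‖h3‖ ^ α * ‖h2‖ := fun i y => by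
      rw [pder_Dl c1, pder_Dl hv]
      exact Dl_bound (contDiff_Dl (hg i) _) (b3 i) h2 y
    have hc := liouville one_pos (by positivity) H
      (B := d * (d * ‖h3‖ ^ α * ‖h2‖) * ‖h1‖) (fun y => Dl_bound c2 b2 h1 y)
    have := pder_of_const hc j y
    rwa [gT] at this
  set D := pder i (pder j v) with hD
  have const : ∀ h z, Dl h D z = Dl h D 0 := by
    intro h z
    have h0 := fun y => third 0 z h j y
    have h1 : ∀ y y', Dl z (Dl h (pder j v)) y = Dl z (Dl h (pder j v)) y' := fun y y' => by
      have := third (y - y') z h j y'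
      simp only [Dl, add_sub_cancel] at this ⊢
      linarith
    have h2 := pder_of_const h1 i 0
    rw [pder_Dl (contDiff_Dl (hg j) h), pder_Dl (hg j)] at h2
    simp only [Dl, zero_add] at h2 ⊢
    linarith
  have add : ∀ (h : Fin d → ℝ) (n : ℕ), D ((n:ℝ) • h) - D 0 = n * Dl h D 0 := by
    intro h n
    induction n with
    | zero => simp
    | succ n ih =>
      have := const h ((n:ℝ) • h)
      have e : ((n + 1 : ℕ) : ℝ) • h = (n:ℝ) • h + h := by push_cast; rw [add_smul, one_smul]
      rw [e]
      simp only [Dl] at this ih ⊢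
      push_cast
      linarith
  have zero : ∀ h, Dl h D 0 = 0 := by
    intro h
    by_contra hne
    have hm : 0 < |Dl h D 0| := abs_pos.2 hne
    have hb : ∀ n : ℕ, 0 < n → |Dl h D 0| ≤ ‖h‖ ^ α * ((n:ℝ) ^ (-(1 - α))) := by
      intro n hn
      have hn' : (0:ℝ) < n := by exact_mod_cast hn
      have a := hH i j ((n:ℝ) • h) 0
      rw [← hD, add h n, dist_zero_right, norm_smul, abs_mul, Real.norm_natCast,
        Real.mul_rpow hn'.le (norm_nonneg _), Nat.abs_cast] at a
      have e : (n:ℝ) ^ (-(1 - α)) = (n:ℝ) ^ α / n := by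
        rw [show -(1 - α) = α - 1 by ring, Real.rpow_sub_one hn'.ne']
      rw [e, mul_div_assoc', le_div_iff₀ hn']
      linarith
    have hlim : Tendsto (fun n : ℕ => ‖h‖ ^ α * ((n:ℝ) ^ (-(1 - α)))) atTop (𝓝 (‖h‖ ^ α * 0)) :=
      ((tendsto_rpow_neg_atTop (by linarith [hα.2] : 0 < 1 - α)).comp
        tendsto_natCast_atTop_atTop).const_mul _
    have := ge_of_tendsto hlim (eventually_atTop.2 ⟨1, fun n hn => hb n hn⟩)
    simp at this
    exact hne this
  have hall : ∀ h, D h = D 0 := fun h => by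
    have := zero h
    simp only [Dl, zero_add] at this
    linarith
  rw [hall y, hall z]

lemma ulim {F : Ultrafilter ℕ} {a : ℕ → ℝ} {B : ℝ} (h : ∀ n, |a n| ≤ B) :
    ∃ l, Tendsto a F (𝓝 l) := by
  obtain ⟨l, _, hl⟩ := (isCompact_Icc (a := -B) (b := B)).ultrafilter_le_nhds (F.map a) (by
    rw [le_principal_iff]
    exact Filter.mem_map.2 (Filter.univ_mem' fun n => abs_le.1 (h n)))
  exact ⟨l, hl⟩

lemma clm_eq_sum {d : ℕ} (L : (Fin d → ℝ) →L[ℝ] ℝ) (h : Fin d → ℝ) :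
    L h = ∑ i, L (Pi.single i 1) * h i := by
  have : h = ∑ i, h i • (Pi.single i (1:ℝ) : Fin d → ℝ) := by
    ext j; simp [Finset.sum_apply, Pi.single_apply]
  conv_lhs => rw [this]
  rw [map_sum]
  exact Finset.sum_congr rfl fun i _ => by rw [map_smul, smul_eq_mul, mul_comm]

lemma clm_norm_le {d : ℕ} (L : (Fin d → ℝ) →L[ℝ] ℝ) : ‖L‖ ≤ ∑ i, |L (Pi.single i 1)| := by
  refine ContinuousLinearMap.opNorm_le_bound _ (Finset.sum_nonneg fun _ _ => abs_nonneg _) fun v => ?_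
  rw [clm_eq_sum, Finset.sum_mul]
  refine (Finset.abs_sum_le_sum_abs _ _).trans (Finset.sum_le_sum fun i _ => ?_)
  rw [abs_mul]
  exact mul_le_mul_of_nonneg_left (norm_le_pi_norm v i) (abs_nonneg _)

/-- A first order Taylor estimate. -/
lemma taylor1 {d : ℕ} {f : (Fin d → ℝ) → ℝ} (hf : ContDiff ℝ 1 f) {z h : Fin d → ℝ} {C : ℝ}
    (hC : ∀ i y, ‖y - z‖ ≤ ‖h‖ → |pder i f y - pder i f z| ≤ C) :
    |f (z + h) - f z - ∑ i, pder i f z * h i| ≤ d * C * ‖h‖ := by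
  have := Convex.norm_image_sub_le_of_norm_fderiv_le' (𝕜 := ℝ) (f := f) (φ := fderiv ℝ f z)
    (s := Metric.closedBall z ‖h‖) (C := d * C) (x := z) (y := z + h)
    (fun x _ => hf.differentiable (by norm_num) x) (fun x hx => by
      refine (clm_norm_le _).trans ((Finset.sum_le_sum fun i _ =>
        hC i x (by simpa [dist_eq_norm] using hx)).trans ?_)
      simp) (convex_closedBall _ _) (by simp) (by simp)
  rw [clm_eq_sum] at this
  simpa [pder] using this

lemma limit_C1 {d : ℕ} {F : Ultrafilter ℕ} {f : ℕ → (Fin d → ℝ) → ℝ} {γ : ℝ} (hγ : 0 < γ)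
    (hf : ∀ n, ContDiff ℝ 1 (f n))
    (hm : ∀ R : ℝ, ∃ C, 0 ≤ C ∧ ∀ n i y z, ‖y‖ ≤ R → ‖z‖ ≤ R → |pder i (f n) y - pder i (f n) z| ≤ C * ‖y - z‖ ^ γ)
    {f0 : (Fin d → ℝ) → ℝ} {g : Fin d → (Fin d → ℝ) → ℝ}
    (hlim : ∀ y, Tendsto (fun n => f n y) F (𝓝 (f0 y)))
    (hlimg : ∀ i y, Tendsto (fun n => pder i (f n) y) F (𝓝 (g i y))) :
    ContDiff ℝ 1 f0 ∧ ∀ i, pder i f0 = g i := by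
  have hgm : ∀ R : ℝ, ∃ C, 0 ≤ C ∧ ∀ i y z, ‖y‖ ≤ R → ‖z‖ ≤ R → |g i y - g i z| ≤ C * ‖y - z‖ ^ γ := by
    intro R
    obtain ⟨C, hC0, hC⟩ := hm R
    exact ⟨C, hC0, fun i y z hy hz => le_of_tendsto (((hlimg i y).sub (hlimg i z)).abs)
      (Eventually.of_forall fun n => hC n i y z hy hz)⟩
  have hgc : ∀ i, Continuous (g i) := by
    intro i
    rw [continuous_iff_continuousAt]
    intro z
    obtain ⟨C, hC0, hC⟩ := hgm (‖z‖ + 1)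
    have hev : ∀ᶠ y in 𝓝 z, ‖g i y - g i z‖ ≤ C * ‖y - z‖ ^ γ := by
      filter_upwards [Metric.ball_mem_nhds z one_pos] with y hy
      have hy' : ‖y - z‖ < 1 := by simpa [dist_eq_norm] using hy
      refine hC i y z ?_ (by linarith)
      have := norm_add_le (y - z) z
      simp at this; linarith
    have ht : Tendsto (fun y => C * ‖y - z‖ ^ γ) (𝓝 z) (𝓝 0) := by
      have hc : Continuous fun y => C * ‖y - z‖ ^ γ :=
        continuous_const.mul ((continuous_id.sub continuous_const).norm.rpow_const fun _ => Or.inr hγ.le)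
      have := hc.tendsto z
      simpa [Real.zero_rpow hγ.ne'] using this
    exact tendsto_iff_norm_sub_tendsto_zero.2
      (squeeze_zero' (Eventually.of_forall fun _ => norm_nonneg _) hev ht)
  set L : (Fin d → ℝ) → (Fin d → ℝ) →L[ℝ] ℝ := fun z =>
    ∑ i, g i z • (ContinuousLinearMap.proj i : (Fin d → ℝ) →L[ℝ] ℝ) with hL
  have hLa : ∀ z h, L z h = ∑ i, g i z * h i := fun z h => by
    simp [hL]
  have hfd : ∀ z, HasFDerivAt f0 (L z) z := by
    intro z
    obtain ⟨C, hC0, hC⟩ := hm (‖z‖ + 1)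
    have hev : ∀ h : Fin d → ℝ, ‖h‖ ≤ 1 → |f0 (z + h) - f0 z - L z h| ≤ d * (C * ‖h‖ ^ γ) * ‖h‖ := by
      intro h hh
      rw [hLa]
      have ht : Tendsto (fun n => |f n (z + h) - f n z - ∑ i, pder i (f n) z * h i|) F
          (𝓝 |f0 (z + h) - f0 z - ∑ i, g i z * h i|) :=
        (((hlim _).sub (hlim _)).sub (tendsto_finsetSum _ fun i _ => (hlimg i z).mul_const _)).abs
      refine le_of_tendsto ht (Eventually.of_forall fun n => ?_)
      refine taylor1 (hf n) fun i y hy => ?_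
      refine (hC n i y z ?_ (by linarith)).trans (by gcongr)
      have := norm_add_le (y - z) z
      simp at this; linarith
    rw [hasFDerivAt_iff_isLittleO_nhds_zero, Asymptotics.isLittleO_iff]
    intro c hc
    have ht : Tendsto (fun h : Fin d → ℝ => d * (C * ‖h‖ ^ γ)) (𝓝 0) (𝓝 0) := by
      have hcont : Continuous fun h : Fin d → ℝ => d * (C * ‖h‖ ^ γ) :=
        continuous_const.mul (continuous_const.mul (continuous_norm.rpow_const fun _ => Or.inr hγ.le))
      have := hcont.tendsto 0
      simpa [Real.zero_rpow hγ.ne'] using this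
    filter_upwards [Metric.closedBall_mem_nhds (0 : Fin d → ℝ) one_pos, ht.eventually_le_const hc]
      with h h1 h2
    exact (hev h (by simpa using h1)).trans (by gcongr)
  have hp : ∀ i, pder i f0 = g i := fun i => by
    ext z
    unfold pder
    rw [(hfd z).fderiv, hLa]
    simp [Pi.single_apply]
  refine ⟨?_, hp⟩
  rw [contDiff_one_iff_fderiv]
  refine ⟨fun z => (hfd z).differentiableAt, ?_⟩
  have : fderiv ℝ f0 = L := funext fun z => (hfd z).fderiv
  rw [this]
  exact continuous_finsetSum _ fun i _ => (hgc i).smul continuous_const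

/-- Compactness in `C^{2,α}` along an ultrafilter. -/
lemma limit_C2 {d : ℕ} (F : Ultrafilter ℕ) {f : ℕ → (Fin d → ℝ) → ℝ} {α A : ℝ} (hα : 0 < α)
    (hA : 0 ≤ A) (hf : ∀ n, ContDiff ℝ 2 (f n)) (h0 : ∀ n, |f n 0| ≤ A) (h1 : ∀ n i, |pder i (f n) 0| ≤ A)
    (h2 : ∀ n i j, |pder i (pder j (f n)) 0| ≤ A)
    (hH : ∀ n i j y z, |pder i (pder j (f n)) y - pder i (pder j (f n)) z| ≤ dist y z ^ α) :
    ∃ u : (Fin d → ℝ) → ℝ, ContDiff ℝ 1 u ∧ (∀ i, ContDiff ℝ 1 (pder i u)) ∧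
      (∀ i y, Tendsto (fun n => pder i (f n) y) F (𝓝 (pder i u y))) ∧
      (∀ i j y, Tendsto (fun n => pder i (pder j (f n)) y) F (𝓝 (pder i (pder j u) y))) := by
  have c1 : ∀ n, ContDiff ℝ 1 (f n) := fun n => (hf n).of_le (by norm_num)
  have cg : ∀ n i, ContDiff ℝ 1 (pder i (f n)) := fun n i => contDiff_pder (hf n) i
  have b2 : ∀ n i j y R, ‖y‖ ≤ R → |pder i (pder j (f n)) y| ≤ A + R ^ α := fun n i j y R hy => by
    have a := hH n i j y 0
    have b := abs_add_le (pder i (pder j (f n)) y - pder i (pder j (f n)) 0) (pder i (pder j (f n)) 0)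
    rw [sub_add_cancel] at b
    rw [dist_zero_right] at a
    have : ‖y‖ ^ α ≤ R ^ α := by gcongr
    linarith [h2 n i j]
  have l1 : ∀ n j y z R, ‖y‖ ≤ R → ‖z‖ ≤ R →
      |pder j (f n) z - pder j (f n) y| ≤ d * (A + R ^ α) * ‖z - y‖ := fun n j y z R hy hz =>
    diff_bound_ball (cg n j) (fun i y hy => b2 n i j y R hy) hy hz
  have b1 : ∀ n j y R, ‖y‖ ≤ R → |pder j (f n) y| ≤ A + d * (A + R ^ α) * R := fun n j y R hy => by
    have hR : 0 ≤ R := (norm_nonneg _).trans hy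
    have a := l1 n j 0 y R (by simpa using hR) hy
    have b := abs_add_le (pder j (f n) y - pder j (f n) 0) (pder j (f n) 0)
    rw [sub_add_cancel] at b
    rw [sub_zero] at a
    have : d * (A + R ^ α) * ‖y‖ ≤ d * (A + R ^ α) * R := by gcongr
    linarith [h1 n j]
  have b0 : ∀ n y, |f n y| ≤ A + d * (A + d * (A + ‖y‖ ^ α) * ‖y‖) * ‖y‖ := fun n y => by
    have a := diff_bound_ball (c1 n) (R := ‖y‖) (fun i z hz => b1 n i z ‖y‖ hz) (y := 0) (z := y)
      (by simp) le_rfl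
    have b := abs_add_le (f n y - f n 0) (f n 0)
    rw [sub_add_cancel] at b
    rw [sub_zero] at a
    linarith [h0 n]
  choose u hu using fun y => ulim (F := F) (a := fun n => f n y) fun n => b0 n y
  choose g hg using fun i y => ulim (F := F) (a := fun n => pder i (f n) y) fun n => b1 n i y ‖y‖ le_rfl
  choose D hD using fun j i y => ulim (F := F) (a := fun n => pder i (pder j (f n)) y)
    fun n => b2 n i j y ‖y‖ le_rfl
  have U := limit_C1 (F := F) (f := f) (γ := 1) one_pos c1 (fun R => by
    rcases lt_or_ge R 0 with h | h
    · exact ⟨0, le_rfl, fun n i y z hy => absurd ((norm_nonneg _).trans hy) (not_le.2 h)⟩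
    · exact ⟨d * (A + R ^ α), by positivity, fun n i y z hy hz => by
        rw [Real.rpow_one]; exact l1 n i z y R hz hy⟩) hu hg
  have W := fun j => limit_C1 (F := F) (f := fun n => pder j (f n)) (γ := α) hα (fun n => cg n j) (fun R =>
    ⟨1, zero_le_one, fun n i y z _ _ => by
      rw [one_mul, ← dist_eq_norm]; exact hH n i j y z⟩) (hg j) (hD j)
  refine ⟨u, U.1, fun i => ?_, fun i y => ?_, fun i j y => ?_⟩
  · rw [U.2 i]; exact (W i).1
  · rw [U.2 i]; exact hg i y
  · rw [U.2 j, (W j).2 i]; exact hD j i y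

/-- Rescaled solutions. -/
structure USol {d : ℕ} (Λ : Fin d → ℝ) (P δ α : ℝ) (u : (Fin d → ℝ) → ℝ) : Prop where
  c2 : ContDiff ℝ 2 u
  z0 : u 0 = 0
  gb : ∀ i y, |pder i u y| ≤ P
  hb : ∀ i j y, |pder i (pder j u) y| ≤ P
  hH : ∀ i j y z, |pder i (pder j u) y - pder i (pder j u) z| ≤ dist y z ^ α
  eq : ∃ b : (Fin d → ℝ) → ℝ, (∀ y, ∑ i, pder i (pder i u) y + ∑ i, ∑ l, (Λ i + pder i u y) *
    (Λ l + pder l u y) * pder i (pder l u) y + b y = 0) ∧ (∀ y, |b y| ≤ δ) ∧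
    (∀ y, |b y - b 0| ≤ δ * ‖y‖)

lemma step_one {d : ℕ} (F : Ultrafilter ℕ) {Λ : ℕ → Fin d → ℝ} {P N α : ℝ} {δ : ℕ → ℝ}
    {u : ℕ → (Fin d → ℝ) → ℝ} (hα : 0 < α) (hP : 0 ≤ P) (h : ∀ n, USol (Λ n) P (δ n) α (u n))
    (hΛ : ∀ n i, |Λ n i| ≤ N) (hδ : Tendsto δ F (𝓝 0)) (i j : Fin d) :
    Tendsto (fun n => pder i (pder j (u n)) 0) F (𝓝 0) := by
  obtain ⟨u0, c1, cg, l1, l2⟩ := limit_C2 F hα hP (fun n => (h n).c2) (fun n => by rw [(h n).z0]; simpa using hP)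
    (fun n i => (h n).gb i 0) (fun n i j => (h n).hb i j 0) (fun n => (h n).hH)
  choose Λ0 hΛ0 using fun i => ulim (F := F) (a := fun n => Λ n i) fun n => hΛ n i
  choose b hb1 hb2 hb3 using fun n => (h n).eq
  have hbl : ∀ y, Tendsto (fun n => b n y) F (𝓝 0) := fun y =>
    squeeze_zero_norm (fun n => hb2 n y) hδ
  have gb0 : ∀ i y, |pder i u0 y| ≤ P := fun i y =>
    le_of_tendsto (l1 i y).abs (Eventually.of_forall fun n => (h n).gb i y)
  have := entire_nonlin c1 cg Λ0 gb0 (fun y => by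
    have t : Tendsto (fun n => ∑ i, pder i (pder i (u n)) y + ∑ i, ∑ l, (Λ n i + pder i (u n) y) *
        (Λ n l + pder l (u n) y) * pder i (pder l (u n)) y + b n y) F
        (𝓝 (∑ i, pder i (pder i u0) y + ∑ i, ∑ l, (Λ0 i + pder i u0 y) *
        (Λ0 l + pder l u0 y) * pder i (pder l u0) y + 0)) :=
      ((tendsto_finsetSum _ fun i _ => l2 i i y).add (tendsto_finsetSum _ fun i _ =>
        tendsto_finsetSum _ fun l _ => (((hΛ0 i).add (l1 i y)).mul ((hΛ0 l).add (l1 l y))).mul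
          (l2 i l y))).add (hbl y)
    rw [add_zero] at t
    simp only [hb1] at t
    exact (tendsto_nhds_unique t tendsto_const_nhds)) i j 0
  rw [← this]
  exact l2 i j 0

lemma pder_comm {d : ℕ} {u : (Fin d → ℝ) → ℝ} (hu : ContDiff ℝ 2 u) (i j : Fin d) (y : Fin d → ℝ) :
    pder i (pder j u) y = pder j (pder i u) y := by
  have hd : Differentiable ℝ (fderiv ℝ u) :=
    (hu.fderiv_right (m := 1) (by norm_num)).differentiable (by norm_num)
  have key : ∀ i j, pder i (pder j u) y = fderiv ℝ (fderiv ℝ u) y (Pi.single i 1) (Pi.single j 1) := by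
    intro i j
    unfold pder
    rw [fderiv_clm_apply (hd y) (differentiableAt_const _)]
    simp
  rw [key, key]
  have hs : IsSymmSndFDerivAt ℝ u y := hu.contDiffAt.isSymmSndFDerivAt (by simp)
  exact hs _ _

lemma pder_lin {d : ℕ} (l : Fin d → ℝ) (j : Fin d) (y : Fin d → ℝ) :
    pder j (fun z => ∑ i, l i * z i) y = l j := by
  have : (fun z : Fin d → ℝ => ∑ i, l i * z i) =
      (∑ i, l i • (ContinuousLinearMap.proj i : (Fin d → ℝ) →L[ℝ] ℝ) : (Fin d → ℝ) →L[ℝ] ℝ) := by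
    ext z; simp
  rw [this]; unfold pder
  rw [ContinuousLinearMap.fderiv]
  simp [Pi.single_apply]

lemma contDiff_lin {d : ℕ} (l : Fin d → ℝ) : ContDiff ℝ 2 fun z : Fin d → ℝ => ∑ i, l i * z i := by
  fun_prop

lemma pder_quad {d : ℕ} (m : Fin d → Fin d → ℝ) (hm : ∀ i j, m i j = m j i) (j : Fin d) (y : Fin d → ℝ) :
    pder j (fun z => ∑ i, (1 / 2 * z i) * ∑ k, m i k * z k) y = ∑ k, m j k * y k := by
  have dc : ∀ i : Fin d, Differentiable ℝ fun z : Fin d → ℝ => 1 / 2 * z i := fun i => by fun_prop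
  have dl : ∀ i : Fin d, Differentiable ℝ fun z : Fin d → ℝ => ∑ k, m i k * z k := fun i => by fun_prop
  rw [pder_sum j (f := fun i z => (1 / 2 * z i) * ∑ k, m i k * z k) fun l => ((dc l).mul (dl l)) y]
  have pc : ∀ i, pder j (fun z : Fin d → ℝ => 1 / 2 * z i) y = 1 / 2 * if i = j then 1 else 0 := by
    intro i
    have := pder_lin (fun k => if k = i then (1 / 2 : ℝ) else 0) j y
    simp only [ite_mul, zero_mul, Finset.sum_ite_eq', Finset.mem_univ, if_true] at this
    rw [this]; simp [eq_comm]
  have : ∀ i, pder j (fun z : Fin d → ℝ => (1 / 2 * z i) * ∑ k, m i k * z k) y =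
      1 / 2 * (m j i * y i) + (if i = j then 1 / 2 * ∑ k, m i k * y k else 0) := by
    intro i
    rw [pder_mul j (dc i y) (dl i y), pder_lin, pc, hm i j]
    split_ifs <;> ring
  simp only [this, Finset.sum_add_distrib, Finset.sum_ite_eq', Finset.mem_univ, if_true,
    ← Finset.mul_sum]
  ring

/-- Second blow-up function. -/
lemma blow_v {d : ℕ} {u : (Fin d → ℝ) → ℝ} (hu : ContDiff ℝ 2 u) {τ α : ℝ} (hτ : 0 < τ) :
    ∃ v : (Fin d → ℝ) → ℝ, ContDiff ℝ 2 v ∧ v 0 = 0 ∧ (∀ i, pder i v 0 = 0) ∧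
      ∀ i j y, pder i (pder j v) y =
        (τ ^ α)⁻¹ * (pder i (pder j u) (τ • y) - pder i (pder j u) 0) := by
  set a : ℝ := (τ ^ α)⁻¹ / τ ^ 2 with ha
  set m : Fin d → Fin d → ℝ := fun i k => τ ^ 2 * pder k (pder i u) 0 with hm
  have hms : ∀ i j, m i j = m j i := fun i j => by simp only [hm]; rw [pder_comm hu]
  have hu1 : ContDiff ℝ 1 u := hu.of_le (by norm_num)
  have cs : ContDiff ℝ 2 fun y : Fin d → ℝ => τ • y := by fun_prop
  have cs1 : ContDiff ℝ 1 fun y : Fin d → ℝ => τ • y := by fun_prop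
  have k1 : ContDiff ℝ 2 fun z => u (τ • z) := hu.comp cs
  have k2 : ContDiff ℝ 2 fun z : Fin d → ℝ => ∑ i, (τ * pder i u 0) * z i := contDiff_lin _
  have k3 : ContDiff ℝ 2 fun z : Fin d → ℝ => ∑ i, (1 / 2 * z i) * ∑ k, m i k * z k := by fun_prop
  have k4 : ContDiff ℝ 2 fun z : Fin d → ℝ => ∑ i, (τ * pder i u 0) * z i +
      ∑ i, (1 / 2 * z i) * ∑ k, m i k * z k := k2.add k3
  have k5 : ContDiff ℝ 2 fun z : Fin d → ℝ => u (τ • z) - (∑ i, (τ * pder i u 0) * z i +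
      ∑ i, (1 / 2 * z i) * ∑ k, m i k * z k) := k1.sub k4
  have df : ∀ {f : (Fin d → ℝ) → ℝ}, ContDiff ℝ 2 f → Differentiable ℝ f := fun h =>
    h.differentiable (by norm_num)
  set v : (Fin d → ℝ) → ℝ := fun z => a * (u (τ • z) - (∑ i, (τ * pder i u 0) * z i +
      ∑ i, (1 / 2 * z i) * ∑ k, m i k * z k) + -u 0) with hv
  have g : ∀ j, pder j v = fun z => a * (τ * pder j u (τ • z) - ∑ k, m j k * z k + -(τ * pder j u 0)) := by
    intro j
    ext y
    rw [hv, pder_const_mul ((k5.add contDiff_const).of_le (by norm_num)), pder_add_const,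
      pder_sub j (df k1 y) (df k4 y), pder_add j (df k2 y) (df k3 y), pder_scale hu1, pder_lin,
      pder_quad m hms]
    ring
  have cg := contDiff_pder hu
  have cgs : ∀ j, ContDiff ℝ 1 fun z => pder j u (τ • z) := fun j => (cg j).comp cs1
  have cl : ∀ j, ContDiff ℝ 1 fun z : Fin d → ℝ => ∑ k, m j k * z k := fun j =>
    (contDiff_lin _).of_le (by norm_num)
  refine ⟨v, contDiff_const.mul (k5.add contDiff_const), by simp [hv], fun i => by rw [g]; simp,
    fun i j y => ?_⟩
  have c5 : ContDiff ℝ 1 fun z => τ * pder j u (τ • z) - ∑ k, m j k * z k :=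
    (contDiff_const.mul (cgs j)).sub (cl j)
  have d1 : ∀ {f : (Fin d → ℝ) → ℝ}, ContDiff ℝ 1 f → Differentiable ℝ f := fun h =>
    h.differentiable (by norm_num)
  rw [g, pder_const_mul (c5.add contDiff_const), pder_add_const,
    pder_sub i (d1 (contDiff_const.mul (cgs j)) y) (d1 (cl j) y), pder_const_mul (cgs j),
    pder_scale (cg j), pder_lin, ha]
  simp only [hm]
  field_simp

lemma step_two {d : ℕ} (F : Ultrafilter ℕ) {Λ : ℕ → Fin d → ℝ} {P N α : ℝ} {δ τ : ℕ → ℝ}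
    {u : ℕ → (Fin d → ℝ) → ℝ} (hα : α ∈ Set.Ioo (0:ℝ) 1) (hP : 0 ≤ P)
    (h : ∀ n, USol (Λ n) P (δ n) α (u n))
    (hΛ : ∀ n i, |Λ n i| ≤ N) (hδ : Tendsto δ F (𝓝 0)) (hτ0 : ∀ n, 0 < τ n) (hτ : Tendsto τ F (𝓝 0))
    {e : ℕ → Fin d → ℝ} (he : ∀ n, ‖e n‖ ≤ 1) (i j : Fin d) :
    Tendsto (fun n => ((τ n) ^ α)⁻¹ * (pder i (pder j (u n)) (τ n • e n) - pder i (pder j (u n)) 0)) F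
      (𝓝 0) := by
  have hN : 0 ≤ N := (abs_nonneg _).trans (hΛ 0 i)
  choose v vc2 v0 v1 v2 using fun n => blow_v (h n).c2 (α := α) (hτ0 n)
  have vH : ∀ n i j y z, |pder i (pder j (v n)) y - pder i (pder j (v n)) z| ≤ dist y z ^ α := by
    intro n i j y z
    have hp : 0 < (τ n) ^ α := Real.rpow_pos_of_pos (hτ0 n) α
    rw [v2, v2, ← mul_sub, sub_sub_sub_cancel_right, abs_mul, abs_of_pos (inv_pos.2 hp),
      inv_mul_le_iff₀ hp, ← Real.mul_rpow (hτ0 n).le dist_nonneg]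
    refine ((h n).hH i j _ _).trans (le_of_eq ?_)
    rw [dist_smul₀, Real.norm_eq_abs, abs_of_pos (hτ0 n)]
  obtain ⟨w, c1, cg, l1, l2⟩ := limit_C2 F hα.1 (le_refl (0:ℝ)) vc2 (fun n => by rw [v0]; simp)
    (fun n i => by rw [v1]; simp) (fun n i j => by rw [v2]; simp) vH
  have hb1 : ∀ n i, |Λ n i + pder i (u n) 0| ≤ N + P := fun n i =>
    (abs_add_le _ _).trans (add_le_add (hΛ n i) ((h n).gb i 0))
  choose Q hQ using fun i => ulim (F := F) (a := fun n => Λ n i + pder i (u n) 0) fun n => hb1 n i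
  -- increments
  have inc : ∀ n i z, |pder i (u n) (τ n • z) - pder i (u n) 0| ≤ d * P * ‖z‖ * τ n := fun n i z => by
    have := diff_bound (contDiff_pder (h n).c2 i) (fun k y => (h n).hb k i y) 0 (τ n • z)
    rw [sub_zero, norm_smul, Real.norm_eq_abs, abs_of_pos (hτ0 n)] at this
    linarith
  have lp : ∀ i z, Tendsto (fun n => Λ n i + pder i (u n) (τ n • z)) F (𝓝 (Q i)) := by
    intro i z
    have t1 : Tendsto (fun n => pder i (u n) (τ n • z) - pder i (u n) 0) F (𝓝 0) := by
      refine squeeze_zero_norm (fun n => inc n i z) ?_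
      simpa using hτ.const_mul (d * P * ‖z‖)
    have := (hQ i).add t1
    rw [add_zero] at this
    refine this.congr fun n => by ring
  have ht1 : Tendsto (fun n => (τ n) ^ (1 - α)) F (𝓝 0) := by
    have h1 : 0 < 1 - α := by linarith [hα.2]
    have := hτ.rpow_const (p := 1 - α) (Or.inr h1.le)
    rwa [Real.zero_rpow h1.ne'] at this
  have hte : ∀ n, ((τ n) ^ α)⁻¹ * τ n = (τ n) ^ (1 - α) := fun n => by
    rw [Real.rpow_sub (hτ0 n), Real.rpow_one]; field_simp
  have hpi : ∀ n, 0 < ((τ n) ^ α)⁻¹ := fun n => inv_pos.2 (Real.rpow_pos_of_pos (hτ0 n) α)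
  choose b be bb bl using fun n => (h n).eq
  have e3 : ∀ i l z, Tendsto (fun n => ((τ n) ^ α)⁻¹ * ((Λ n i + pder i (u n) (τ n • z)) *
      (Λ n l + pder l (u n) (τ n • z)) - (Λ n i + pder i (u n) 0) * (Λ n l + pder l (u n) 0)) *
      pder i (pder l (u n)) 0) F (𝓝 0) := by
    intro i l z
    refine squeeze_zero_norm (a := fun n => (2 * (N + P) * (d * P * ‖z‖) * P) * (τ n) ^ (1 - α)) (fun n => ?_) ?_
    · have b1 : |Λ n i + pder i (u n) (τ n • z)| ≤ N + P :=
        (abs_add_le _ _).trans (add_le_add (hΛ n i) ((h n).gb i _))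
      have b2 := hb1 n l
      have i1 := inc n i z
      have i2 := inc n l z
      have hK : 0 ≤ d * P * ‖z‖ * τ n := (abs_nonneg _).trans i1
      have e : (Λ n i + pder i (u n) (τ n • z)) *
        (Λ n l + pder l (u n) (τ n • z)) - (Λ n i + pder i (u n) 0) * (Λ n l + pder l (u n) 0) =
        (Λ n i + pder i (u n) (τ n • z)) * (pder l (u n) (τ n • z) - pder l (u n) 0) +
        (pder i (u n) (τ n • z) - pder i (u n) 0) * (Λ n l + pder l (u n) 0) := by ring
      have hb : |(Λ n i + pder i (u n) (τ n • z)) *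
        (Λ n l + pder l (u n) (τ n • z)) - (Λ n i + pder i (u n) 0) * (Λ n l + pder l (u n) 0)| ≤
        2 * (N + P) * (d * P * ‖z‖ * τ n) := by
        rw [e]
        refine (abs_add_le _ _).trans ?_
        rw [abs_mul, abs_mul]
        have m1 := mul_le_mul b1 i2 (abs_nonneg _) (by positivity)
        have m2 := mul_le_mul i1 b2 (abs_nonneg _) hK
        linarith
      rw [Real.norm_eq_abs, abs_mul, abs_mul, abs_of_pos (hpi n), ← hte]
      calc _ ≤ ((τ n) ^ α)⁻¹ * (2 * (N + P) * (d * P * ‖z‖ * τ n)) * P := by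
            have := hpi n
            gcongr
            exact (h n).hb i l 0
        _ = _ := by ring
    · simpa using ht1.const_mul (2 * (N + P) * (d * P * ‖z‖) * P)
  have e4 : ∀ z, Tendsto (fun n => ((τ n) ^ α)⁻¹ * (b n (τ n • z) - b n 0)) F (𝓝 0) := by
    intro z
    refine squeeze_zero_norm (a := fun n => δ n * ‖z‖ * (τ n) ^ (1 - α)) (fun n => ?_) ?_
    · rw [Real.norm_eq_abs, abs_mul, abs_of_pos (hpi n), ← hte]
      have := bl n (τ n • z)
      rw [norm_smul, Real.norm_eq_abs, abs_of_pos (hτ0 n)] at this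
      calc _ ≤ ((τ n) ^ α)⁻¹ * (δ n * (τ n * ‖z‖)) := by
            have := hpi n
            gcongr
        _ = _ := by ring
    · simpa using (hδ.mul_const ‖z‖).mul ht1
  have weq : ∀ y, ∑ i, pder i (pder i w) y + ∑ i, ∑ l, Q i * Q l * pder i (pder l w) y = 0 := by
    intro y
    have t : Tendsto (fun n => ∑ i, pder i (pder i (v n)) y +
        ∑ i, ∑ l, (Λ n i + pder i (u n) (τ n • y)) * (Λ n l + pder l (u n) (τ n • y)) *
          pder i (pder l (v n)) y + ∑ i, ∑ l, ((τ n) ^ α)⁻¹ * ((Λ n i + pder i (u n) (τ n • y)) *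
      (Λ n l + pder l (u n) (τ n • y)) - (Λ n i + pder i (u n) 0) * (Λ n l + pder l (u n) 0)) *
      pder i (pder l (u n)) 0 + ((τ n) ^ α)⁻¹ * (b n (τ n • y) - b n 0)) F
      (𝓝 (∑ i, pder i (pder i w) y + ∑ i, ∑ l, Q i * Q l * pder i (pder l w) y +
        ∑ i : Fin d, ∑ l : Fin d, 0 + 0)) :=
      (((tendsto_finsetSum _ fun i _ => l2 i i y).add (tendsto_finsetSum _ fun i _ =>
        tendsto_finsetSum _ fun l _ => ((lp i y).mul (lp l y)).mul (l2 i l y))).add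
        (tendsto_finsetSum _ fun i _ => tendsto_finsetSum _ fun l _ => e3 i l y)).add (e4 y)
    simp only [Finset.sum_const_zero, add_zero] at t
    refine tendsto_nhds_unique t (tendsto_const_nhds.congr fun n => ?_)
    have q1 := be n (τ n • y)
    have q0 := be n 0
    simp only [v2]
    have := congrArg (fun s => ((τ n) ^ α)⁻¹ * s) (q1.trans q0.symm)
    simp only [mul_add, Finset.mul_sum] at this
    rw [eq_comm, ← sub_eq_zero.2 this]
    simp only [mul_sub, sub_mul, Finset.sum_sub_distrib]
    have s1 : ∀ (f : Fin d → Fin d → ℝ) (g : Fin d → Fin d → ℝ), (∀ i l, f i l = g i l) →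
      ∑ i, ∑ l, f i l = ∑ i, ∑ l, g i l := fun f g hfg =>
        Finset.sum_congr rfl fun i _ => Finset.sum_congr rfl fun l _ => hfg i l
    rw [s1 (fun i l => (Λ n i + pder i (u n) (τ n • y)) * (Λ n l + pder l (u n) (τ n • y)) *
        (((τ n) ^ α)⁻¹ * pder i (pder l (u n)) (τ n • y))) (fun i l => ((τ n) ^ α)⁻¹ *
        ((Λ n i + pder i (u n) (τ n • y)) * (Λ n l + pder l (u n) (τ n • y)) *
          pder i (pder l (u n)) (τ n • y))) fun i l => by ring]
    rw [s1 (fun i l => (Λ n i + pder i (u n) (τ n • y)) * (Λ n l + pder l (u n) (τ n • y)) *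
        (((τ n) ^ α)⁻¹ * pder i (pder l (u n)) 0)) (fun i l => ((τ n) ^ α)⁻¹ *
        ((Λ n i + pder i (u n) (τ n • y)) * (Λ n l + pder l (u n) (τ n • y))) *
          pder i (pder l (u n)) 0) fun i l => by ring]
    rw [s1 (fun i l => ((τ n) ^ α)⁻¹ *
        ((Λ n i + pder i (u n) 0) * (Λ n l + pder l (u n) 0)) *
          pder i (pder l (u n)) 0) (fun i l => ((τ n) ^ α)⁻¹ *
        ((Λ n i + pder i (u n) 0) * (Λ n l + pder l (u n) 0) *
          pder i (pder l (u n)) 0)) fun i l => by ring]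
    ring
  have wH : ∀ i j y z, |pder i (pder j w) y - pder i (pder j w) z| ≤ dist y z ^ α := fun i j y z =>
    le_of_tendsto ((l2 i j y).sub (l2 i j z)).abs (Eventually.of_forall fun n => vH n i j y z)
  have w0 : pder i (pder j w) 0 = 0 := tendsto_nhds_unique (l2 i j 0)
    (tendsto_const_nhds.congr fun n => by rw [v2]; simp)
  have hz : ∀ z, Tendsto (fun n => pder i (pder j (v n)) z) F (𝓝 0) := fun z => by
    have := entire_lin c1 cg Q hα wH weq i j z 0
    rw [w0] at this
    rw [← this]; exact l2 i j z
  choose e0 he0 using fun k => ulim (F := F) (a := fun n => e n k) (B := 1) fun n =>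
    (norm_le_pi_norm (e n) k).trans (he n)
  have het : Tendsto e F (𝓝 e0) := tendsto_pi_nhds.2 he0
  have hdist : Tendsto (fun n => dist (e n) e0 ^ α) F (𝓝 0) := by
    have := (tendsto_iff_dist_tendsto_zero.1 het).rpow_const (p := α) (Or.inr hα.1.le)
    rwa [Real.zero_rpow hα.1.ne'] at this
  have hfin : Tendsto (fun n => (pder i (pder j (v n)) (e n) - pder i (pder j (v n)) e0) +
      pder i (pder j (v n)) e0) F (𝓝 (0 + 0)) :=
    (squeeze_zero_norm (fun n => vH n i j (e n) e0) hdist).add (hz e0)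
  rw [add_zero] at hfin
  refine hfin.congr fun n => ?_
  rw [sub_add_cancel, v2]

lemma pder_aff {d : ℕ} {f : (Fin d → ℝ) → ℝ} (hf : ContDiff ℝ 1 f) (y0 : Fin d → ℝ) (s : ℝ) (i : Fin d)
    (y : Fin d → ℝ) : pder i (fun z => f (y0 + s • z)) y = s * pder i f (y0 + s • y) := by
  have c : ContDiff ℝ 1 fun z => f (y0 + z) := hf.comp (contDiff_const.add contDiff_id)
  have := pder_scale c s i y
  rw [this]
  unfold pder
  rw [fderiv_comp_add_left]

lemma interp {d : ℕ} {f : (Fin d → ℝ) → ℝ} (hf : ContDiff ℝ 1 f) {P α : ℝ} (hα : 0 < α) (i : Fin d)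
    (hP : ∀ y, |f y| ≤ P) (hH : ∀ y z, |pder i f y - pder i f z| ≤ dist y z ^ α) (y : Fin d → ℝ) :
    |pder i f y| ≤ 2 * P + 1 := by
  have hd : ∀ s : ℝ, HasDerivAt (fun s : ℝ => f (y + s • (Pi.single i 1 : Fin d → ℝ)))
      (pder i f (y + s • (Pi.single i 1 : Fin d → ℝ))) s := fun s => by
    have := hasDerivAt_line hf y (Pi.single i 1) s
    simpa [Pi.single_apply] using this
  obtain ⟨c, hc, hce⟩ := exists_hasDerivAt_eq_slope (fun s : ℝ => f (y + s • (Pi.single i 1 : Fin d → ℝ)))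
    (fun s => pder i f (y + s • (Pi.single i 1 : Fin d → ℝ))) zero_lt_one
    (fun s _ => (hd s).continuousAt.continuousWithinAt) (fun s _ => hd s)
  have a := hH y (y + c • (Pi.single i 1 : Fin d → ℝ))
  have hdist : dist y (y + c • (Pi.single i 1 : Fin d → ℝ)) ≤ 1 := by
    rw [dist_self_add_right, norm_smul, Pi.norm_single, Real.norm_eq_abs, abs_of_pos hc.1]
    simpa using hc.2.le
  have h1 : dist y (y + c • (Pi.single i 1 : Fin d → ℝ)) ^ α ≤ 1 :=
    Real.rpow_le_one dist_nonneg hdist hα.le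
  have h2 : |pder i f (y + c • (Pi.single i 1 : Fin d → ℝ))| ≤ 2 * P := by
    rw [hce]; simp only [sub_zero, div_one]
    refine (abs_sub _ _).trans ?_
    linarith [hP (y + (1:ℝ) • (Pi.single i 1 : Fin d → ℝ)), hP (y + (0:ℝ) • (Pi.single i 1 : Fin d → ℝ))]
  have h3 := abs_add_le (pder i f y - pder i f (y + c • (Pi.single i 1 : Fin d → ℝ)))
    (pder i f (y + c • (Pi.single i 1 : Fin d → ℝ)))
  rw [sub_add_cancel] at h3
  linarith

lemma toU {d : ℕ} {V : (Fin d → ℝ) → (Fin d → ℝ) → ℝ} (hV : SmoothV V) {N α : ℝ} (hN : 0 ≤ N)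
    (hα : α ∈ Set.Ioo (0:ℝ) 1) :
    ∃ P C : ℝ, 0 ≤ P ∧ ∀ (x Λ : Fin d → ℝ) (w : (Fin d → ℝ) → ℝ) (κ : ℝ) (y0 : Fin d → ℝ),
      (∀ i, |Λ i| ≤ N) → ContDiff ℝ 2 w → ZPer w → DivFormSol V x Λ w → 1 ≤ κ →
      (∀ i j y z, |pder i (pder j w) y - pder i (pder j w) z| ≤ κ ^ (1 + α) * dist y z ^ α) →
      ∃ u, USol Λ P (C * κ⁻¹) α u ∧
        ∀ i j z, pder i (pder j u) z = κ⁻¹ * pder i (pder j w) (y0 + κ⁻¹ • z) := by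
  obtain ⟨P, hP1, hPb⟩ := grad_bound hV hN
  choose G hG0 hG using fun i => (hV.pder i).bounded
  choose G2 hG20 hG2 using fun i j => ((hV.pder i).pder j).bounded
  set GG := ∑ i, G i with hGG
  have hGG0 : 0 ≤ GG := Finset.sum_nonneg fun i _ => hG0 i
  have hGi : ∀ i x y, |pder i (V x) y| ≤ GG := fun i x y =>
    (hG i x y).trans (Finset.single_le_sum (fun j _ => hG0 j) (Finset.mem_univ i))
  set HH := ∑ i, ∑ j, G2 i j with hHH
  have hHH0 : 0 ≤ HH := Finset.sum_nonneg fun i _ => Finset.sum_nonneg fun j _ => hG20 i j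
  have hHi : ∀ i j x y, |pder j (pder i (V x)) y| ≤ HH := fun i j x y =>
    (hG2 i j x y).trans ((Finset.single_le_sum (fun j _ => hG20 i j) (Finset.mem_univ j)).trans
      (Finset.single_le_sum (f := fun i => ∑ j, G2 i j)
        (fun i _ => Finset.sum_nonneg fun j _ => hG20 i j) (Finset.mem_univ i)))
  set P' := 2 * P + 1 with hP'
  set C := d * ((N + P) * GG) + d * (d * P' * GG + (N + P) * (d * HH)) with hC
  have hP0 : 0 ≤ P := by linarith
  have hP'0 : 0 ≤ P' := by linarith
  have hC1 : d * ((N + P) * GG) ≤ C := by rw [hC]; simp only [le_add_iff_nonneg_right]; positivity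
  have hC2 : d * (d * P' * GG + (N + P) * (d * HH)) ≤ C := by
    rw [hC]; simp only [le_add_iff_nonneg_left]; positivity
  refine ⟨P', C, hP'0, fun x Λ w κ y0 hΛ hw hper hs hκ hH => ?_⟩
  have hκ0 : 0 < κ := by linarith
  have hw1 : ContDiff ℝ 1 w := hw.of_le (by norm_num)
  have hgw := hPb x Λ w hΛ hw hper hs
  have cg := contDiff_pder hw
  have ca : ContDiff ℝ 2 fun z : Fin d → ℝ => y0 + κ⁻¹ • z := by fun_prop
  have ca1 : ContDiff ℝ 1 fun z : Fin d → ℝ => y0 + κ⁻¹ • z := by fun_prop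
  set u : (Fin d → ℝ) → ℝ := fun z => κ * (w (y0 + κ⁻¹ • z) + -w y0) with hu
  have cu : ContDiff ℝ 2 u := contDiff_const.mul ((hw.comp ca).add contDiff_const)
  have gu : ∀ i, pder i u = fun z => pder i w (y0 + κ⁻¹ • z) := fun i => by
    ext y
    have c1 : ContDiff ℝ 1 fun z => w (y0 + κ⁻¹ • z) := hw1.comp ca1
    rw [hu, pder_const_mul (c1.add contDiff_const), pder_add_const, pder_aff hw1]
    field_simp
  have hu2 : ∀ i j z, pder i (pder j u) z = κ⁻¹ * pder i (pder j w) (y0 + κ⁻¹ • z) := fun i j z => by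
    rw [gu, pder_aff (cg j)]
  have gub : ∀ i y, |pder i u y| ≤ P := fun i y => by rw [gu]; exact hgw i _
  have uH : ∀ i j y z, |pder i (pder j u) y - pder i (pder j u) z| ≤ dist y z ^ α := fun i j y z => by
    rw [hu2, hu2, ← mul_sub, abs_mul, abs_of_pos (inv_pos.2 hκ0), inv_mul_le_iff₀ hκ0]
    refine (hH i j _ _).trans (le_of_eq ?_)
    rw [dist_add_left, dist_smul₀, Real.norm_eq_abs, abs_of_pos (inv_pos.2 hκ0),
      Real.mul_rpow (inv_pos.2 hκ0).le dist_nonneg, Real.inv_rpow hκ0.le, Real.rpow_add hκ0, Real.rpow_one]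
    have : κ ^ α ≠ 0 := (Real.rpow_pos_of_pos hκ0 α).ne'
    field_simp
  have hub : ∀ i j y, |pder i (pder j u) y| ≤ P' := fun i j y =>
    interp (contDiff_pder cu j) hα.1 i (gub j) (uH i j) y
  refine ⟨u, ⟨cu, by simp [hu], fun i y => (gub i y).trans (by linarith), hub, uH, ?_⟩, hu2⟩
  have hpb : ∀ i y, |Λ i + pder i u y| ≤ N + P := fun i y =>
    (abs_add_le _ _).trans (add_le_add (hΛ i) (gub i y))
  have hκi : 0 < κ⁻¹ := inv_pos.2 hκ0
  have hκ1 : κ⁻¹ ≤ 1 := inv_le_one_of_one_le₀ hκ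
  refine ⟨fun z => κ⁻¹ * ∑ i, (Λ i + pder i u z) * pder i (V x) (y0 + κ⁻¹ • z), fun y => ?_,
    fun y => ?_, fun y => ?_⟩
  · have := congrArg (fun t => κ⁻¹ * t) (nondiv hV hw hs (y0 + κ⁻¹ • y))
    simp only [mul_add, mul_zero, Finset.mul_sum] at this
    simp only [hu2, Finset.mul_sum]
    simp only [gu]
    rw [← this]
    simp only [add_left_inj, add_right_inj]
    exact Finset.sum_congr rfl fun i _ => Finset.sum_congr rfl fun l _ => by ring
  · rw [abs_mul, abs_of_pos hκi, mul_comm]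
    gcongr
    refine le_trans ?_ hC1
    refine (Finset.abs_sum_le_sum_abs _ _).trans ?_
    calc _ ≤ ∑ i : Fin d, (N + P) * GG := Finset.sum_le_sum fun i _ => by
          rw [abs_mul]
          exact mul_le_mul (hpb i y) (hGi i _ _) (abs_nonneg _) (by positivity)
      _ = _ := by simp
  · rw [← mul_sub, abs_mul, abs_of_pos hκi, ← Finset.sum_sub_distrib, mul_comm C, mul_assoc]
    gcongr
    refine le_trans ?_ (mul_le_mul_of_nonneg_right hC2 (norm_nonneg _))
    refine (Finset.abs_sum_le_sum_abs _ _).trans ?_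
    calc _ ≤ ∑ i : Fin d, (d * P' * GG + (N + P) * (d * HH)) * ‖y‖ := Finset.sum_le_sum fun i _ => by
          have e : (Λ i + pder i u y) * pder i (V x) (y0 + κ⁻¹ • y) -
              (Λ i + pder i u 0) * pder i (V x) (y0 + κ⁻¹ • 0) =
              (pder i u y - pder i u 0) * pder i (V x) (y0 + κ⁻¹ • y) +
              (Λ i + pder i u 0) * (pder i (V x) (y0 + κ⁻¹ • y) - pder i (V x) (y0 + κ⁻¹ • 0)) := by ring
          have i1 : |pder i u y - pder i u 0| ≤ d * P' * ‖y‖ := by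
            simpa using diff_bound (contDiff_pder cu i) (fun k z => hub k i z) 0 y
          have i2 : |pder i (V x) (y0 + κ⁻¹ • y) - pder i (V x) (y0 + κ⁻¹ • 0)| ≤ d * HH * ‖y‖ := by
            have := diff_bound ((hV.pder i).contDiff x) (fun k z => hHi i k x z) (y0 + κ⁻¹ • 0)
              (y0 + κ⁻¹ • y)
            refine this.trans ?_
            rw [add_sub_add_left_eq_sub, smul_zero, sub_zero, norm_smul, Real.norm_eq_abs,
              abs_of_pos hκi]
            gcongr
            nlinarith [norm_nonneg y]
          rw [e]
          refine (abs_add_le _ _).trans ?_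
          rw [abs_mul, abs_mul]
          have m1 := mul_le_mul i1 (hGi i x (y0 + κ⁻¹ • y)) (abs_nonneg _) (by positivity)
          have m2 := mul_le_mul (hpb i 0) i2 (abs_nonneg _) (by positivity)
          linarith
      _ = _ := by simp; ring

lemma extremal {d : ℕ} {α : ℝ} (hα : 0 < α) {w : (Fin d → ℝ) → ℝ} (hw : C2Holder α w) {k : ℝ} (hk : 1 ≤ k)
    (hviol : ∃ i j y z, k * dist y z ^ α < |pder i (pder j w) y - pder i (pder j w) z|) :
    ∃ K, k ≤ K ∧ (∀ i j y z, |pder i (pder j w) y - pder i (pder j w) z| ≤ K * dist y z ^ α) ∧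
      ∃ i j y z, y ≠ z ∧ K / 2 * dist y z ^ α < |pder i (pder j w) y - pder i (pder j w) z| := by
  set S : Set ℝ := {K | 0 ≤ K ∧ ∀ i j y z,
    |pder i (pder j w) y - pder i (pder j w) z| ≤ K * dist y z ^ α} with hS
  choose C hC using hw.2
  have hne : S.Nonempty := by
    refine ⟨∑ i, ∑ j, |C i j|, Finset.sum_nonneg fun _ _ => Finset.sum_nonneg fun _ _ => abs_nonneg _,
      fun i j y z => (hC i j y z).trans ?_⟩
    gcongr
    exact (le_abs_self _).trans ((Finset.single_le_sum (f := fun j => |C i j|)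
      (fun j _ => abs_nonneg _) (Finset.mem_univ j)).trans
      (Finset.single_le_sum (f := fun i => ∑ j, |C i j|)
        (fun i _ => Finset.sum_nonneg fun j _ => abs_nonneg _) (Finset.mem_univ i)))
  have hbd : BddBelow S := ⟨0, fun K hK => hK.1⟩
  have hmem : sInf S ∈ S := by
    refine ⟨le_csInf hne fun K hK => hK.1, fun i j y z => ?_⟩
    have hD : 0 ≤ dist y z ^ α := Real.rpow_nonneg dist_nonneg _
    rcases hD.eq_or_lt with h | h
    · obtain ⟨K, hK⟩ := hne
      have := hK.2 i j y z
      rw [← h] at this ⊢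
      simpa using this
    · rw [← div_le_iff₀ h]
      exact le_csInf hne fun K hK => (div_le_iff₀ h).2 (hK.2 i j y z)
  obtain ⟨i, j, y, z, hv⟩ := hviol
  have hkK : k ≤ sInf S := by
    have := hv.trans_le (hmem.2 i j y z)
    exact (lt_of_mul_lt_mul_right this (Real.rpow_nonneg dist_nonneg _)).le
  refine ⟨sInf S, hkK, hmem.2, ?_⟩
  have hnot : sInf S / 2 ∉ S := fun h => by
    have := csInf_le hbd h
    linarith
  have : ¬ ∀ i j y z, |pder i (pder j w) y - pder i (pder j w) z| ≤ sInf S / 2 * dist y z ^ α :=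
    fun h => hnot ⟨by linarith, h⟩
  push Not at this
  obtain ⟨i, j, y, z, h⟩ := this
  refine ⟨i, j, y, z, fun hyz => ?_, h⟩
  rw [hyz] at h
  simp [Real.zero_rpow hα.ne'] at h

lemma holder_bound {d : ℕ} {V : (Fin d → ℝ) → (Fin d → ℝ) → ℝ} (hV : SmoothV V) {N α : ℝ} (hN : 0 ≤ N)
    (hα : α ∈ Set.Ioo (0:ℝ) 1) :
    ∃ K : ℝ, 1 ≤ K ∧ ∀ (x Λ : Fin d → ℝ) (w : (Fin d → ℝ) → ℝ), (∀ i, |Λ i| ≤ N) → C2Holder α w →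
      ZPer w → DivFormSol V x Λ w →
      ∀ i j y z, |pder i (pder j w) y - pder i (pder j w) z| ≤ K * dist y z ^ α := by
  by_contra hcon
  push Not at hcon
  obtain ⟨P, C, hP0, hU⟩ := toU hV hN hα
  have h1α : 0 < 1 + α := by linarith [hα.1]
  have data : ∀ n : ℕ, ∃ (x Λ : Fin d → ℝ) (w : (Fin d → ℝ) → ℝ) (κ : ℝ) (i j : Fin d) (y z : Fin d → ℝ),
      (∀ i, |Λ i| ≤ N) ∧ C2Holder α w ∧ ZPer w ∧ DivFormSol V x Λ w ∧ 1 ≤ κ ∧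
      ((n:ℝ) + 1) ^ (1 / (1 + α)) ≤ κ ∧
      (∀ i j y z, |pder i (pder j w) y - pder i (pder j w) z| ≤ κ ^ (1 + α) * dist y z ^ α) ∧
      y ≠ z ∧ κ ^ (1 + α) / 2 * dist y z ^ α < |pder i (pder j w) y - pder i (pder j w) z| := by
    intro n
    have hn1 : (1:ℝ) ≤ (n:ℝ) + 1 := by have : (0:ℝ) ≤ n := by positivity
                                       linarith
    obtain ⟨x, Λ, w, hΛ, hw, hper, hs, hv⟩ := hcon ((n:ℝ) + 1) hn1
    obtain ⟨K, hK, hKH, i, j, y, z, hyz, hlt⟩ := extremal hα.1 hw hn1 hv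
    have e : (K ^ (1 / (1 + α))) ^ (1 + α) = K := by
      rw [← Real.rpow_mul (by linarith), one_div_mul_cancel h1α.ne', Real.rpow_one]
    refine ⟨x, Λ, w, K ^ (1 / (1 + α)), i, j, y, z, hΛ, hw, hper, hs, ?_, ?_, ?_, hyz, ?_⟩
    · exact Real.one_le_rpow (by linarith) (by positivity)
    · gcongr
    · rwa [e]
    · rwa [e]
  choose x Λ w κ i j y z hΛ hw hper hs hκ1 hκn hH hyz hlt using data
  choose u hu hu2 using fun n => hU (x n) (Λ n) (w n) (κ n) (y n) (hΛ n) (hw n).1 (hper n) (hs n)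
    (hκ1 n) (hH n)
  choose u' hu' hu2' using fun n => hU (x n) (Λ n) (w n) (κ n) (z n) (hΛ n) (hw n).1 (hper n) (hs n)
    (hκ1 n) (hH n)
  set F := hyperfilter ℕ with hF
  have hFle : (F : Filter ℕ) ≤ atTop := Nat.hyperfilter_le_atTop
  have hκ0 : ∀ n, 0 < κ n := fun n => by linarith [hκ1 n]
  have hκt : Tendsto κ atTop atTop := by
    refine tendsto_atTop_mono hκn ?_
    exact (tendsto_rpow_atTop (by positivity)).comp
      (tendsto_atTop_add_const_right _ _ tendsto_natCast_atTop_atTop)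
  have hδ : Tendsto (fun n => C * (κ n)⁻¹) F (𝓝 0) := by
    have := (tendsto_inv_atTop_zero.comp hκt).const_mul C
    rw [mul_zero] at this
    exact this.mono_left hFle
  have s1 := step_one F hα.1 hP0 hu hΛ hδ
  have s1' := step_one F hα.1 hP0 hu' hΛ hδ
  set τ : ℕ → ℝ := fun n => κ n * dist (y n) (z n) with hτ
  have hdp : ∀ n, 0 < dist (y n) (z n) := fun n => dist_pos.2 (hyz n)
  have hτ0 : ∀ n, 0 < τ n := fun n => mul_pos (hκ0 n) (hdp n)
  have half : ∀ n, (τ n) ^ α / 2 ≤ (κ n)⁻¹ *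
      |pder (i n) (pder (j n) (w n)) (y n) - pder (i n) (pder (j n) (w n)) (z n)| := by
    intro n
    have := (hlt n).le
    rw [← inv_mul_le_iff₀ (inv_pos.2 (hκ0 n)), inv_inv]
    refine le_trans (le_of_eq ?_) this
    simp only [hτ]
    rw [Real.mul_rpow (hκ0 n).le dist_nonneg, Real.rpow_add (hκ0 n), Real.rpow_one]; ring
  have z1 : ∀ n i j, pder i (pder j (u n)) 0 = (κ n)⁻¹ * pder i (pder j (w n)) (y n) := fun n i j => by
    rw [hu2]; simp
  have z1' : ∀ n i j, pder i (pder j (u' n)) 0 = (κ n)⁻¹ * pder i (pder j (w n)) (z n) := fun n i j => by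
    rw [hu2']; simp
  have dsum : ∀ (f : Fin d → Fin d → ℝ) i j, |f i j| ≤ ∑ i, ∑ j, |f i j| := fun f i j =>
    (Finset.single_le_sum (f := fun j => |f i j|) (fun j _ => abs_nonneg _) (Finset.mem_univ j)).trans
      (Finset.single_le_sum (f := fun i => ∑ j, |f i j|)
        (fun i _ => Finset.sum_nonneg fun j _ => abs_nonneg _) (Finset.mem_univ i))
  have tsum : ∀ {f : ℕ → Fin d → Fin d → ℝ}, (∀ i j, Tendsto (fun n => f n i j) F (𝓝 0)) →
      Tendsto (fun n => ∑ i, ∑ j, |f n i j|) F (𝓝 0) := fun {f} hf => by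
    have : Tendsto (fun n => ∑ i, ∑ j, |f n i j|) F (𝓝 (∑ i : Fin d, ∑ j : Fin d, |(0:ℝ)|)) :=
      tendsto_finsetSum _ fun i _ => tendsto_finsetSum _ fun j _ => (hf i j).abs
    simpa using this
  have hτα : Tendsto (fun n => (τ n) ^ α) F (𝓝 0) := by
    have t1 := ((tsum (f := fun n i j => pder i (pder j (u n)) 0) s1).add
      (tsum (f := fun n i j => pder i (pder j (u' n)) 0) s1')).const_mul 2
    simp only [add_zero, mul_zero] at t1
    refine squeeze_zero (fun n => (Real.rpow_pos_of_pos (hτ0 n) α).le) (fun n => ?_) t1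
    have h1 := half n
    rw [← abs_of_pos (inv_pos.2 (hκ0 n)), ← abs_mul, mul_sub, ← z1, ← z1'] at h1
    have h2 := abs_sub (pder (i n) (pder (j n) (u n)) 0) (pder (i n) (pder (j n) (u' n)) 0)
    have h3 := dsum (fun i j => pder i (pder j (u n)) 0) (i n) (j n)
    have h4 := dsum (fun i j => pder i (pder j (u' n)) 0) (i n) (j n)
    linarith
  have hτt : Tendsto τ F (𝓝 0) := by
    have := hτα.rpow_const (p := 1 / α) (Or.inr (by have := hα.1; positivity))
    rw [Real.zero_rpow (by have := hα.1; positivity)] at this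
    refine this.congr fun n => ?_
    rw [← Real.rpow_mul (hτ0 n).le, mul_one_div_cancel hα.1.ne', Real.rpow_one]
  set e : ℕ → Fin d → ℝ := fun n => (dist (y n) (z n))⁻¹ • (z n - y n) with he
  have he1 : ∀ n, ‖e n‖ ≤ 1 := fun n => by
    simp only [he]
    rw [norm_smul, norm_inv, Real.norm_eq_abs, abs_of_pos (hdp n), ← dist_eq_norm, dist_comm (z n),
      inv_mul_cancel₀ (hdp n).ne']
  have hpt : ∀ n, y n + (κ n)⁻¹ • (τ n • e n) = z n := fun n => by
    simp only [he, hτ, smul_smul]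
    have : (κ n)⁻¹ * (κ n * dist (y n) (z n)) * (dist (y n) (z n))⁻¹ = 1 := by
      have := (hκ0 n).ne'
      have := (hdp n).ne'
      field_simp
    rw [← mul_assoc, this, one_smul, add_sub_cancel]
  have s2 := tsum (f := fun n i j => ((τ n) ^ α)⁻¹ * (pder i (pder j (u n)) (τ n • e n) -
    pder i (pder j (u n)) 0)) (step_two F hα hP0 hu hΛ hδ hτ0 hτt he1)
  have hlow : ∀ n, (1 / 2 : ℝ) ≤ ∑ i, ∑ j, |((τ n) ^ α)⁻¹ * (pder i (pder j (u n)) (τ n • e n) -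
    pder i (pder j (u n)) 0)| := fun n => by
    refine le_trans ?_ (dsum _ (i n) (j n))
    have hp : 0 < (τ n) ^ α := Real.rpow_pos_of_pos (hτ0 n) α
    rw [abs_mul, abs_of_pos (inv_pos.2 hp), le_inv_mul_iff₀ hp, hu2, hpt, z1, ← mul_sub, abs_mul,
      abs_of_pos (inv_pos.2 (hκ0 n)), abs_sub_comm]
    linarith [half n]
  have := ge_of_tendsto s2 (Eventually.of_forall hlow)
  norm_num at this

lemma osc_bound {d : ℕ} {w : (Fin d → ℝ) → ℝ} (hw : ContDiff ℝ 1 w) (hper : ZPer w) {P : ℝ} (hP : 0 ≤ P)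
    (hb : ∀ i y, |pder i w y| ≤ P) (y z : Fin d → ℝ) : |w y - w z| ≤ d * P := by
  obtain ⟨k, hk⟩ := exists_rep y
  obtain ⟨l, hl⟩ := exists_rep z
  rw [← hper y k, ← hper z l]
  refine (diff_bound hw hb _ _).trans ?_
  have : ‖(fun i => y i + (k i : ℝ)) - fun i => z i + (l i : ℝ)‖ ≤ 1 := by
    rw [pi_norm_le_iff_of_nonneg zero_le_one]
    intro i
    have a1 := hk.1 i
    have a2 := hk.2 i
    have b1 := hl.1 i
    have b2 := hl.2 i
    simp only [Pi.zero_apply, Pi.one_apply] at a1 a2 b1 b2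
    rw [Pi.sub_apply, Real.norm_eq_abs, abs_le]
    constructor <;> linarith
  have h0 : 0 ≤ d * P := by positivity
  nlinarith

lemma per_deriv_bound {d : ℕ} {f : (Fin d → ℝ) → ℝ} (hf : ContDiff ℝ 1 f) (hper : ZPer f) {K α : ℝ}
    (hK : 0 ≤ K) (hα : 0 < α) (i : Fin d)
    (hH : ∀ y z, |pder i f y - pder i f z| ≤ K * dist y z ^ α) (y : Fin d → ℝ) : |pder i f y| ≤ K := by
  have hd := fun s => hasDerivAt_line hf y (Pi.single i 1) s
  obtain ⟨c, hc, h⟩ := exists_hasDerivAt_eq_slope _ _ (zero_lt_one' ℝ)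
    (fun s _ => (hd s).continuousAt.continuousWithinAt) (fun s _ => hd s)
  have e : f (y + (1:ℝ) • Pi.single i 1) = f y := by
    have := hper y (Pi.single i 1)
    rw [← this]
    congr 1
    ext j
    by_cases hj : j = i
    · subst hj; simp
    · simp [hj]
  rw [e] at h
  simp [Pi.single_apply] at h
  have h2 := hH y (y + c • Pi.single i 1)
  rw [h, sub_zero] at h2
  refine h2.trans ?_
  have hdist : dist y (y + c • Pi.single i 1) ≤ 1 := by
    rw [dist_eq_norm, pi_norm_le_iff_of_nonneg zero_le_one]
    intro j
    by_cases hj : j = i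
    · subst hj; simp [abs_of_pos hc.1, hc.2.le]
    · simp [hj]
  have := Real.rpow_le_one dist_nonneg hdist hα.le
  nlinarith

/-- a priori Hölder estimate: there are `β ∈ (0,1)` and constants `C_Λ > 0`,
independent of `x` and bounded uniformly for `Λ` in compact sets, such that any
`𝒴^d`-periodic `C^{2,α}` solution `w̃` of the divergence-form cell equation satisfies
`‖w̃‖_{C^{2,β}_#(𝒴^d)/ℝ} ≤ C_Λ` (oscillation of `w̃`, its first and second derivatives,
and the `β`-Hölder seminorm of the second derivatives are all bounded by `C_Λ`). -/
theorem stmt14 {d : ℕ} (V : (Fin d → ℝ) → (Fin d → ℝ) → ℝ) (hV : SmoothV V)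
    (α : ℝ) (hα : α ∈ Set.Ioo (0 : ℝ) 1) :
    ∃ β ∈ Set.Ioo (0 : ℝ) 1, ∃ C : (Fin d → ℝ) → ℝ,
      (∀ Λ, 0 < C Λ) ∧
      (∀ K : Set (Fin d → ℝ), IsCompact K → ∃ M : ℝ, ∀ Λ ∈ K, C Λ ≤ M) ∧
      ∀ (x Λ : Fin d → ℝ) (w : (Fin d → ℝ) → ℝ),
        C2Holder α w → ZPer w → DivFormSol V x Λ w →
          (∀ y z, |w y - w z| ≤ C Λ) ∧
          (∀ i y, |pder i w y| ≤ C Λ) ∧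
          (∀ i j y, |pder i (fun z => pder j w z) y| ≤ C Λ) ∧
          (∀ i j y z, |pder i (fun z' => pder j w z') y - pder i (fun z' => pder j w z') z|
            ≤ C Λ * dist y z ^ β) := by
  choose P hP1 hP using fun n : ℕ => grad_bound hV (N := (n : ℝ)) (Nat.cast_nonneg n)
  choose K hK1 hK using fun n : ℕ => holder_bound hV (N := (n : ℝ)) (Nat.cast_nonneg n) hα
  have hP0 : ∀ n, 0 ≤ P n := fun n => zero_le_one.trans (hP1 n)
  have hK0 : ∀ n, 0 ≤ K n := fun n => zero_le_one.trans (hK1 n)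
  have hA : ∀ n, 0 ≤ d * P n := fun n => mul_nonneg (Nat.cast_nonneg _) (hP0 n)
  refine ⟨α, hα, fun Λ => d * P ⌈‖Λ‖⌉₊ + P ⌈‖Λ‖⌉₊ + K ⌈‖Λ‖⌉₊, fun Λ => ?_, fun S hS => ?_,
    fun x Λ w hw hper hs => ?_⟩
  · have := hA ⌈‖Λ‖⌉₊
    have := hP1 ⌈‖Λ‖⌉₊
    have := hK1 ⌈‖Λ‖⌉₊
    linarith
  · obtain ⟨R, hR⟩ := hS.isBounded.exists_norm_le
    refine ⟨∑ n ∈ Finset.range (⌈R⌉₊ + 1), (d * P n + P n + K n), fun Λ hΛ => ?_⟩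
    refine Finset.single_le_sum (f := fun n => d * P n + P n + K n) (fun n _ => ?_) ?_
    · have := hA n
      have := hP0 n
      have := hK0 n
      linarith
    · rw [Finset.mem_range, Nat.lt_succ_iff]
      exact Nat.ceil_mono (hR Λ hΛ)
  · have hΛ : ∀ i, |Λ i| ≤ (⌈‖Λ‖⌉₊ : ℝ) := fun i => (norm_le_pi_norm Λ i).trans (Nat.le_ceil _)
    have g := hP _ x Λ w hΛ hw.1 hper hs
    have h := hK _ x Λ w hΛ hw hper hs
    have a1 := hA ⌈‖Λ‖⌉₊
    have a2 := hP0 ⌈‖Λ‖⌉₊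
    have a3 := hK0 ⌈‖Λ‖⌉₊
    refine ⟨fun y z => ?_, fun i y => ?_, fun i j y => ?_, fun i j y z => ?_⟩
    · have := osc_bound (hw.1.of_le (by norm_num)) hper a2 g y z
      linarith
    · have := g i y
      linarith
    · have := per_deriv_bound (contDiff_pder hw.1 j) (hper.pder j) a3 hα.1 i (h i j) y
      exact this.trans (by linarith)
    · refine (h i j y z).trans ?_
      exact mul_le_mul_of_nonneg_right (by linarith) (Real.rpow_nonneg dist_nonneg _)
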